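/- arXiv:1007.5400 — 2 statements merged into one kernel-verified Lean document; each statement's English description precedes it below -/
import Mathlib

section
/- Suppose G is a graph with a vertex x of degree 10 such that the complement of the subgraph induced by the neighbourhood of x is connected and 3-regular (cubic). Moreover, suppose there is a vertex z of G outside the closed neighbourhood of x such that G contains at least six pairwise internally vertex-disjoint paths from x to z. Then G contains a minor isomorphic to the complete graph on 8 vertices with one edge removed. -/
/-- `G.HasMinor H` means `H` is a minor of `G`, witnessed by nonempty pairwise disjoint
branch sets inducing connected subgraphs, with edges of `G` between branch sets
corresponding to adjacent vertices of `H`. -/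
def SimpleGraph.HasMinor {V W : Type*} (G : SimpleGraph V) (H : SimpleGraph W) : Prop :=
  ∃ B : W → Set V,
    (∀ w, (B w).Nonempty) ∧
    (Pairwise fun w₁ w₂ => Disjoint (B w₁) (B w₂)) ∧
    (∀ w, (G.induce (B w)).Connected) ∧
    (∀ w₁ w₂, H.Adj w₁ w₂ → ∃ v₁ ∈ B w₁, ∃ v₂ ∈ B w₂, G.Adj v₁ v₂)

/-- The complete graph on 8 vertices with one edge removed. -/
def K8minus : SimpleGraph (Fin 8) :=
  (⊤ : SimpleGraph (Fin 8)).deleteEdges {s((0 : Fin 8), (1 : Fin 8))}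

namespace K8Proof

/-- All ten-bit masks with exactly three bits set. -/
def tripleMasks : List ℕ := [
  7, 11, 19, 35, 67, 131, 259, 515, 13, 21, 37, 69, 133, 261, 517, 25, 41, 73, 137, 265, 521, 49,
  81, 145, 273, 529, 97, 161, 289, 545, 193, 321, 577, 385, 641, 769, 14, 22, 38, 70, 134, 262,
  518, 26, 42, 74, 138, 266, 522, 50, 82, 146, 274, 530, 98, 162, 290, 546, 194, 322, 578, 386,
  642, 770, 28, 44, 76, 140, 268, 524, 52, 84, 148, 276, 532, 100, 164, 292, 548, 196, 324, 580,
  388, 644, 772, 56, 88, 152, 280, 536, 104, 168, 296, 552, 200, 328, 584, 392, 648, 776, 112,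
  176, 304, 560, 208, 336, 592, 400, 656, 784, 224, 352, 608, 416, 672, 800, 448, 704, 832, 896]

/-- All ten-bit masks with exactly six bits set. -/
def sixMasks : List ℕ := [
  63, 95, 159, 287, 543, 111, 175, 303, 559, 207, 335, 591, 399, 655, 783, 119, 183, 311, 567,
  215, 343, 599, 407, 663, 791, 231, 359, 615, 423, 679, 807, 455, 711, 839, 903, 123, 187, 315,
  571, 219, 347, 603, 411, 667, 795, 235, 363, 619, 427, 683, 811, 459, 715, 843, 907, 243, 371,
  627, 435, 691, 819, 467, 723, 851, 915, 483, 739, 867, 931, 963, 125, 189, 317, 573, 221, 349,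
  605, 413, 669, 797, 237, 365, 621, 429, 685, 813, 461, 717, 845, 909, 245, 373, 629, 437, 693,
  821, 469, 725, 853, 917, 485, 741, 869, 933, 965, 249, 377, 633, 441, 697, 825, 473, 729, 857,
  921, 489, 745, 873, 937, 969, 497, 753, 881, 945, 977, 993, 126, 190, 318, 574, 222, 350, 606,
  414, 670, 798, 238, 366, 622, 430, 686, 814, 462, 718, 846, 910, 246, 374, 630, 438, 694, 822,
  470, 726, 854, 918, 486, 742, 870, 934, 966, 250, 378, 634, 442, 698, 826, 474, 730, 858, 922,
  490, 746, 874, 938, 970, 498, 754, 882, 946, 978, 994, 252, 380, 636, 444, 700, 828, 476, 732,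
  860, 924, 492, 748, 876, 940, 972, 500, 756, 884, 948, 980, 996, 504, 760, 888, 952, 984, 1000,
  1008]

/-- Relabellings (the ten lowest decimal digits) taking the enumerated tables to the
representatives below, whose number is stored in the remaining digits. -/
def relabels : List ℕ := [
  9876543210, 19876543210, 29876543210, 29867543210, 39876543210, 38976543210, 49876543210,
  9876543120, 19876543120, 29876543120, 29867543120, 39876543120, 38976543120, 49876543120,
  9876534021, 19876534021, 18795634021, 39865734021, 28965734021, 28956734021, 29856734021,
  49865734021, 20213547698, 21204537698, 34310629587, 59876543210, 59867534201, 69876543210,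
  68976543210, 79876543210, 22105437698, 59786453120, 35320619487, 59867435102, 59768435102,
  78796453120, 68796453120, 67896453120, 59786354021, 59687354021, 59786345012, 59687345012,
  35421809376, 67698354021, 66798354021, 77698354021, 89876543210, 88976543210, 109876543210,
  99876543210, 119876543210, 129876543210, 119786534201, 129786534201, 99867543210, 129867543210,
  119867543210, 109867543210, 119687534201, 129687534201, 89876453120, 88976453120, 119786435102,
  129786435102, 118796435102, 128796435102, 119687435102, 129687435102, 118697435102,
  128697435102, 87698354021, 86798354021, 9876542130, 19876542130, 29876542130, 29867542130,
  39876542130, 38976542130, 49876542130, 9876524031, 20312547698, 34210537698, 21304629587,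
  58975642310, 69875642310, 59857624301, 58957624301, 79875642310, 19876524031, 18795624031,
  39865724031, 28965724031, 28956724031, 29856724031, 49865724031, 23105427698, 59786452130,
  35230619487, 59867425103, 59768425103, 78796452130, 68796452130, 67896452130, 58795462130,
  23106427598, 36230519487, 78795462130, 59758426103, 68795462130, 59857426103, 67895462130,
  89865742310, 58695274031, 119685724301, 109865742310, 119865742310, 129865742310, 99865742310,
  129685724301, 58596274031, 59586274031, 119586724301, 129856742310, 119856742310, 99856742310,
  109856742310, 129586724301, 66598274031, 65698274031, 37431809265, 59685247013, 59586247013,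
  76598274031, 118695427103, 119685427103, 118596427103, 86598274031, 119586427103, 85698274031,
  89865472130, 128695427103, 88965472130, 129685427103, 128596427103, 129586427103, 9876514032,
  20321547698, 34120537698, 22304619587, 58975641320, 69875641320, 59857614302, 58957614302,
  79875641320, 20231547698, 9876415032, 35120437698, 57984651320, 22305619487, 69874651320,
  69784651320, 78794651320, 58749615302, 57849615302, 34130527698, 23204619587, 58975641230,
  69875641230, 59857614203, 58957614203, 79875641230, 35130427698, 57984651230, 23205619487,
  69874651230, 69784651230, 78794651230, 58749615203, 57849615203, 38754916032, 19875416032,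
  18794516032, 48754916032, 27954816032, 27845916032, 28954716032, 28745916032, 118594716302,
  118594617203, 118495716302, 118495617203, 37632908154, 65498176032, 64589176032, 85498176032,
  109854761320, 108954761320, 89854761320, 98954761320, 119854761320, 128954761320, 58594176032,
  128594716302, 98945761320, 129845761320, 118945761320, 89854671230, 58594167023, 128594617203,
  109845761320, 108945761320, 58495176032, 128495716302, 59485176032, 129485716302, 58495167023,
  128495617203, 59485167023, 129485617203, 75498176032, 75489176032, 42140537698, 42150437698,
  9876302154, 72140563897, 72140573896, 72150463897, 72150473896, 45421809376, 72154098376,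
  72145089376, 139876543210, 43140527698, 43240619587, 74021365798, 74031275698, 74032176598,
  74023167598, 137698325401, 90321654987, 21540327698, 68753910642, 121034527869, 121025436879,
  68642910753, 91540832976, 149876543210, 159876543210, 169876543210, 69763820541, 22640317598,
  122034617859, 122034617958, 122016435879, 149875643120, 92640831975, 159875643120, 68541920763,
  169875643120, 24512609387, 58963720541, 57963820541, 78763920541, 57836902514, 58736902514,
  24621509387, 78753910642, 57953810642, 57835901624, 58953710642, 58735901624, 152410675398,
  151420576398, 86521940873, 121470523968, 122470613958, 179876543210, 152410685397, 151420586397,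
  86521940783, 179786543210, 122480613957, 121480523967, 178769325401, 124261905837, 177869325401,
  124261905738, 124152906837, 124152906738, 158573916042, 157583916042, 158673925041, 94921650873,
  157683925041, 94912560873, 43150427698, 90231654987, 21450327698, 121024536879, 68652910743,
  68743910652, 121035427869, 91450832976, 158976453210, 148976453210, 168976453210, 43250619487,
  75021364798, 75031274698, 75032176498, 75023167498, 137698324501, 69763820451, 122016534978,
  149874653120, 158974653120, 92650931874, 22650317498, 122035617849, 122035617948, 68451920763,
  169874653120, 69451820763, 168974653120, 25412609387, 58963720451, 57963820451, 78763920451,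
  57836902415, 58736902415, 152510684397, 178769324501, 125261904837, 152510674398, 177869324501,
  125261904738, 25621409387, 151520476398, 86421950873, 151520486397, 86421950783, 125142906837,
  125142906738, 78743910652, 158473916052, 157483916052, 57943810652, 57834901625, 121570423968,
  179786453210, 122580613947, 158673924051, 95921640873, 58943710652, 58734901625, 122570613948,
  179876453210, 121580423967, 157683924051, 95912460873, 9876203154, 73140562897, 73140572896,
  73150462897, 73150472896, 45431809276, 73154098276, 73145089276, 139876542310, 69762830541,
  23640217598, 123024617859, 123024617958, 123016425879, 149875642130, 93640821975, 159875642130,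
  68541930762, 169875642130, 69672830541, 123024716958, 123024716859, 23740216598, 149865742130,
  159865742130, 93740821965, 123017425869, 68541930672, 169865742130, 57982630541, 56982730541,
  24513809276, 56728903514, 57628903514, 77682930541, 121460532987, 153410865297, 123460812957,
  179768542310, 88531940762, 151430568297, 153410875296, 179678542310, 123470812956, 121470532986,
  88531940672, 151430578296, 77652910843, 56725901834, 56952710843, 57625901834, 57952610843,
  24831509276, 157562918043, 156572918043, 124381905726, 177689235401, 94931850762, 157862935041,
  124381905627, 176789235401, 94913580762, 156872935041, 124153908726, 124153908627, 69762830451,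
  123016524978, 149874652130, 158974652130, 93650921874, 23650217498, 123025617849, 123025617948,
  68451930762, 169874652130, 69451830762, 168974652130, 69672830451, 149864752130, 93750921864,
  158964752130, 123017524968, 123025716948, 123025716849, 23750216498, 68451930672, 169864752130,
  69451830672, 168964752130, 57982630451, 56982730451, 25413809276, 56728903415, 57628903415,
  77682930451, 77642910853, 157462918053, 156472918053, 153510874296, 125381904726, 177689234501,
  121560432987, 179678452310, 123570812946, 56724901835, 56942710853, 95931840762, 157862934051,
  153510864297, 125381904627, 176789234501, 123560812947, 179768452310, 121570432986, 57624901835,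
  57942610853, 95913480762, 156872934051, 88431950762, 151530468297, 88431950672, 151530478296,
  25831409276, 125143908726, 125143908627, 47632908154, 73276098154, 73267098154, 73260741985,
  73270641985, 73260751984, 73260751894, 73270651984, 73270651894, 9854103276, 139854761320,
  138954761320, 88732960541, 96932870541, 56382097154, 126382907514, 96923780541, 56273098154,
  126273908514, 88732960451, 56382097145, 126382907415, 56273098145, 126273908415, 26723809154,
  26832709154, 122640731985, 123640821975, 179548761320, 153620847195, 152630748195, 179458761320,
  155741928063, 155841937062, 123650821974, 153620857194, 154751928063, 75471920863, 55981430762,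
  54971520863, 175489137602, 122650731984, 152630758194, 154851937062, 54981530762, 55971420863,
  174589137602, 75481930762, 97932860541, 127382906514, 57382096154, 88632970541, 97923680541,
  57263098154, 127263908514, 127382906415, 57382096145, 88632970451, 57263098145, 127263908415,
  27623809154, 27832609154, 122740631985, 155641928073, 179458671320, 155841936072, 154651928073,
  75461920873, 123750821964, 153720856194, 55981430672, 175489136702, 54961520873, 123740821965,
  179548671320, 153720846195, 152730648195, 122750631984, 154851936072, 54981530672, 174589136702,
  55961420873, 152730658194, 75481930672, 19873206154, 109832760541, 108932760541, 119732860541,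
  127932860541, 118732960541, 127832960541, 108932670541, 109832670541, 19863207154, 119632870541,
  126932870541, 118632970541, 126832970541, 117923680541, 129723680541, 116923780541,
  129623780541, 17692308154, 107623980541, 106723980541, 117823690541, 128723690541, 116823790541,
  128623790541, 106723890541, 107623890541, 17682309154, 124621750983, 126412570983, 124721650983,
  127412560983, 19853104276, 175319840762, 175318940762, 125621740983, 177329860541, 179237680541,
  109831540762, 109750321864, 189876543210, 125831940762, 126512470983, 177328960541,
  108931540762, 188976543210, 108750321964, 178237690541, 125931840762, 125721640983,
  179236780541, 108931450762, 189867543210, 109650321874, 176329870541, 128513490762,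
  127512460983, 109831450762, 108650321974, 188967543210, 178236790541, 176328970541,
  129513480762, 19843105276, 174319850762, 174318950762, 124831950762, 124931850762, 128413590762,
  129413580762]

/-- A list of branch sets; the first two need not touch. -/
structure BranchList where
  head : List ℕ
  second : List ℕ
  rest : List (List ℕ)

/-- A representative of an isomorphism class of connected cubic graphs on ten vertices: its
neighbourhood masks, the models in which `x` and `z` are singletons, and further models. -/
structure CubicRep where
  rows : List ℕ
  roots : List (List (List ℕ))
  models : List BranchList

/-- Representative number 0. -/
def rep0 : CubicRep where
  rows := [14,13,19,19,44,208,800,800,704,448]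
  roots := [
    [[0,6],[1,7],[2,8],[3],[4,9],[5]], [[0,5],[1,6],[2,7],[3,8],[4],[9]],
    [[0,5],[1,6],[2],[3,7],[4,9],[8]], [[0,5],[1],[2,8],[3,6],[4,9],[7]],
    [[0],[1,7],[2,8],[3,5],[4,9],[6]], [[0],[1,6],[2,7],[3,9],[4,8],[5]],
    [[0,8],[1,5],[2,6],[3,7],[4],[9]], [[0,7],[1],[2,5],[3,9],[4,8],[6]],
    [[0,7],[1,5],[2,9],[3,6],[4],[8]], [[0,6],[1,9],[2],[3,5],[4,7],[8]],
    [[0,9],[1],[2,7],[3,5],[4,8],[6]], [[0,9],[1,8],[2],[3,5],[4,6],[7]],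
    [[0],[1,9],[2,5],[3,8],[4,6],[7]], [[0,7],[1,9],[2],[3],[6,4,8],[5]],
    [[0,6],[1],[2,5],[3,8],[4,7],[9]], [[0],[1,8],[2,6],[3,7],[4,9],[5]],
    [[0,8],[1,6],[2],[3],[4,5,9],[7]], [[0,3,5],[1,9],[2,8],[4],[6],[7]],
    [[0,5],[1,7],[2,9],[3],[4,6],[8]], [[0,5],[1,8],[2,9],[3],[4,7],[6]],
    [[6,0,9],[1,7],[2],[3],[4,8],[5]], [[4,0,5],[1,8],[2],[3,9],[6],[7]]]
  models := []

/-- Representative number 1. -/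
def rep1 : CubicRep where
  rows := [14,13,19,35,100,152,784,800,704,448]
  roots := [
    [[0,6],[1,7],[2,8],[3],[4],[5,9]], [[0,5],[1,6],[2],[3,7],[4,9],[8]],
    [[0,5],[1],[2,8],[3,6],[4,9],[7]], [[0,4],[1,6],[2,7],[3,8],[5],[9]],
    [[0],[1,7],[2,8],[3,4],[5,9],[6]], [[0,6],[1,7],[2],[3,4],[5,9],[8]],
    [[0,6],[1,7],[2,3],[4,8],[5],[9]], [[0,8],[1,9],[2],[3],[4,7],[5,6]],
    [[0],[1,4],[2,7],[3,9],[5,8],[6]], [[0,7],[1,5],[2,9],[3,6],[4],[8]],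
    [[0,6],[1],[2,5],[3,9],[4,8],[7]], [[0,7],[1,4],[2,6],[3],[5,8],[9]],
    [[0,5],[1],[2,9],[3,8],[4,7],[6]], [[0],[1,9],[2,7],[4,3,6],[5],[8]],
    [[0,9],[1,8],[2,5],[3],[4,7],[6]], [[0,8],[1],[5,2,7],[3,6],[4],[9]],
    [[0,6],[1,7],[2],[3],[4,9],[5,8]], [[0],[1,6],[2,9],[3,5,8],[4],[7]],
    [[0,7],[1],[2,8],[3,5,6],[4],[9]], [[0],[1,7],[2,8],[3,6],[4,9],[5]],
    [[0],[1,5],[2,6],[3,7],[4,9],[8]], [[0,4],[1,8],[2,7],[3],[5,9],[6]],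
    [[0,4],[1],[2,6],[3,7],[5,9],[8]], [[0,4],[1],[2,8],[3,9],[5,6],[7]],
    [[0],[1,5],[2,4,9],[3,8],[6],[7]], [[0,8],[1],[2,7],[3,6],[4,9],[5]],
    [[0,4],[1],[2,8],[7,3,9],[5],[6]], [[4,0,6],[1,7],[2],[3,9],[5],[8]]]
  models := []

/-- Representative number 2. -/
def rep2 : CubicRep where
  rows := [14,13,19,35,196,328,560,784,672,448]
  roots := [
    [[0,6],[1,7],[2,8],[3,9],[4],[5]], [[0,5],[1,6],[2],[3,7],[4,9],[8]],
    [[0],[1,5],[2,7],[3,9],[4,8],[6]], [[0,6],[1,8],[2,9],[3],[4,5],[7]],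
    [[0,6],[1],[2,8],[3,7],[4,5],[9]], [[0,4],[1,9],[2,5],[3],[6,8],[7]],
    [[0],[1,9],[2,6],[3,7],[4,5],[8]], [[0,8],[1,6],[2,5],[3,7],[4],[9]],
    [[0,8],[1],[2,9],[3,4],[5,7],[6]], [[0,9],[1,6],[2,8],[3],[4,5],[7]],
    [[0],[1,4],[2,8],[3,6],[5,7],[9]], [[0,9],[1,5],[2],[3,4],[6,7],[8]],
    [[0,9],[1,6],[2,8],[3,7],[4],[5]], [[0,5],[1],[2,9],[3,7],[4,8],[6]],
    [[0,6],[1],[2,7],[3,9],[4,5],[8]], [[0,9],[1,8],[2],[3,4,5],[6],[7]],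
    [[0,8],[1],[2,6],[3,7],[4,9],[5]], [[0,7],[1],[2,8],[3,6],[4],[5,9]],
    [[0,7],[1,5],[2],[3,6],[4,9],[8]], [[0,8],[1,9],[2],[3],[4,5],[6,7]],
    [[0],[1,9],[2,7],[3,4,5],[6],[8]], [[0],[1,6],[2,9],[3,8],[4],[5,7]],
    [[0,8],[4,1,6],[2],[3,7],[5],[9]], [[0,6,7],[1,8],[2,3],[4],[5],[9]],
    [[0,6,8],[1,7],[2,3],[4],[5],[9]], [[0,6],[1],[7,2,8],[3,9],[4],[5]],
    [[5,0,6],[1,7],[2,8],[3],[4],[9]]]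
  models := [
    ⟨[0],[1],[[10],[6,9,11],[2,8],[3,7],[4],[5]]⟩]

/-- Representative number 3. -/
def rep3 : CubicRep where
  rows := [14,13,19,35,196,776,400,592,608,416]
  roots := [
    [[0,6],[1,8],[2,9],[3,7],[4],[5]], [[0,5],[1,6],[2],[3,9],[4,8],[7]],
    [[0,5],[1],[2,7],[3,6],[4,9],[8]], [[0,7],[1,8],[2,5],[3],[4,9],[6]],
    [[0],[1,6],[2,7],[3,8],[4,5],[9]], [[0,6],[1,9],[2],[3,7],[4,5],[8]],
    [[0,4],[1,7],[2,8],[3],[5,6],[9]], [[0,9],[1],[2,8],[3,4],[5,7],[6]],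
    [[0,9],[1,8],[2,6],[3],[4,5],[7]], [[0],[1,4],[2,9],[3,7,8],[5],[6]],
    [[0],[1,7],[2,8],[3,9],[4],[5,6]], [[0,6],[1,9],[2,5],[3],[4,8],[7]],
    [[0,9],[1,6],[2],[3,4],[5,7],[8]], [[0,8],[1,5],[2],[4,3,7],[6],[9]],
    [[0,6],[1,9],[2,8],[3],[4],[5,7]], [[0,7],[1,5,6],[2,9],[3],[4],[8]],
    [[0,4],[1],[2,9],[3,8],[5,6],[7]], [[0,8],[1],[2,6],[3,7],[4,5],[9]],
    [[0,9],[1,6],[2,8],[3,4],[5],[7]], [[0,7],[1,8],[2],[3,9],[4,5],[6]],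
    [[0],[1,3,9],[2,6],[4,8],[5],[7]], [[0],[1,7],[2,9],[3,6],[4,8],[5]],
    [[0,7],[1,8],[2],[3,4],[5],[6,9]], [[0,6],[1,8],[2],[3],[4,9],[5,7]],
    [[0,7],[1,9],[2],[3],[4,8],[5,6]], [[4,0,6],[1,9],[2],[3],[5,7],[8]]]
  models := []

/-- Representative number 4. -/
def rep4 : CubicRep where
  rows := [14,13,19,35,196,776,784,784,224,224]
  roots := [
    [[0,6],[1,8],[2,9],[3,7],[4],[5]], [[0,5],[1,6],[2],[3,7],[4,8],[9]],
    [[0,7],[1,8],[2,9],[3],[4,5],[6]], [[0,6],[1],[2,7],[3,9],[4,5],[8]],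
    [[0],[1,9],[2,6],[3,8],[4,5],[7]], [[0,7],[1,8],[2],[3,6],[4,5],[9]],
    [[0,7],[1],[2,5],[3,6],[4,9],[8]], [[0,8],[1,7],[2,9],[3,6],[4],[5]],
    [[0,9],[1,7],[2,8],[3],[4,5],[6]], [[0],[1,8],[2,9],[3,6],[4,5],[7]],
    [[0],[1,4],[2,9],[3,8],[5,7],[6]], [[0,7],[1],[2,9],[3,8],[4],[5,6]],
    [[0],[1,6],[2,8],[3,7],[4,9],[5]], [[0,7],[1,9],[2],[3],[4,8],[5,6]],
    [[0,4],[1,5,6],[2,7],[3],[8],[9]], [[0,6],[1,7],[2,5],[3],[4,9],[8]],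
    [[0,9],[1,4],[5,2,8],[3],[6],[7]], [[0,6,7],[1,5],[2,3],[4],[8],[9]],
    [[0],[1,9],[6,2,8],[3,7],[4],[5]], [[0,4],[1,8,9],[2,5],[3],[6],[7]],
    [[0,6],[1],[2,8],[7,3,9],[4],[5]], [[0,7],[1,9],[2],[3,6],[4,8],[5]],
    [[0,4,8],[1,5],[2],[3,9],[6],[7]], [[0,4],[1],[2,6],[3,5,7],[8],[9]],
    [[0,6],[1,8],[2],[3],[4,9],[5,7]], [[0,6],[1,9],[2],[3],[4,8],[5,7]],
    [[0,8],[1],[7,2,9],[3,6],[4],[5]], [[0,7],[1,8],[2],[3],[4,9],[5,6]]]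
  models := []

/-- Representative number 5. -/
def rep5 : CubicRep where
  rows := [14,21,35,81,138,324,552,784,672,448]
  roots := [
    [[0,6],[1,8],[2,7],[3,9],[4],[5]], [[0,5],[1,6],[2,7],[3],[4,8],[9]],
    [[0,5],[1],[2,8],[3,9],[4,6],[7]], [[0,9],[1,7],[2],[3,5],[4,6],[8]],
    [[0],[1,5],[2,7],[3,8],[4,9],[6]], [[0,8],[1],[2,9],[3,7],[4,5],[6]],
    [[0,4],[1,6],[2],[3,8],[5,9],[7]], [[0,7],[1,6],[2,9],[3],[4,5],[8]],
    [[0],[1,7],[2,6],[3,9],[4,5],[8]], [[0,8],[1,9],[2,3],[4],[5],[6,7]],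
    [[0,6],[1],[4,2,7],[3,8],[5],[9]], [[0,7],[1,5],[2,6],[3],[4,9],[8]],
    [[0],[1,9],[2,4],[3,5],[6,8],[7]], [[0,9],[1,6],[2],[3,8],[4,5],[7]],
    [[0,9],[1],[2,4,5],[3,8],[6],[7]], [[0,6],[7,1,8],[2],[3,5],[4],[9]],
    [[0],[1,8],[2,4],[3,6,7],[5],[9]], [[0,7],[5,1,6],[2],[3,8],[4],[9]],
    [[0,6],[1],[2,8],[3,9],[4,5],[7]], [[0,8],[1,6],[2],[3,9],[4],[5,7]],
    [[0,5],[1],[2,8],[3,7],[4,9],[6]], [[0],[1,5],[2,8],[7,3,9],[4],[6]],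
    [[0,6],[1,7],[2],[3,8],[4,5],[9]], [[0],[1,2,9],[3,8],[4],[5],[6,7]],
    [[0],[1,6],[7,2,8],[3,9],[4],[5]], [[0,8],[1],[2,9],[3,7],[4,6],[5]],
    [[0,8],[1,9],[2],[3,5],[4,6],[7]], [[0,8],[1,4,6],[2,7],[3],[5],[9]],
    [[0,6],[1,3],[2,7],[4,8],[5],[9]]]
  models := []

/-- Representative number 6. -/
def rep6 : CubicRep where
  rows := [14,21,35,81,138,772,392,592,608,416]
  roots := [
    [[0,6],[1,8],[2,7],[3,9],[4],[5]], [[0,5],[1,6],[2,9],[3],[4,8],[7]],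
    [[0,5],[1],[2,6],[3,7],[4,9],[8]], [[0,7],[1,8],[2],[3,5],[4,9],[6]],
    [[0],[1,6],[2,8],[3,7],[4,5],[9]], [[0,9],[1],[2,7],[3,5],[4,6],[8]],
    [[0,9],[1,8],[2,6],[3],[4,5],[7]], [[0,6],[1,9],[2],[3,7],[4,5],[8]],
    [[0],[1,7],[2,4],[3,8],[5],[6,9]], [[0,3,7],[1,5],[2,8],[4],[6],[9]],
    [[0,4],[1,7],[2],[3,8],[5,6],[9]], [[0],[1,9],[2,6],[3,7],[4,8],[5]],
    [[0,8],[1],[2,3],[4,9],[5,7],[6]], [[0,7],[1,5,6],[2],[3,9],[4],[8]],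
    [[0,7],[1],[2,6],[3,5],[4,8],[9]], [[0,7],[1,8],[2,4],[3],[5],[6,9]],
    [[0,8],[1,6],[2,7],[3],[4,9],[5]], [[0,6],[1,9],[2,3],[4,5],[7],[8]],
    [[0,5,6],[1,9],[2],[3],[4,8],[7]], [[0,9],[1,6],[2,4],[3],[5],[7,8]],
    [[0,3,8],[1],[2,7],[4,5],[6],[9]], [[0],[7,1,9],[2,6],[3,8],[4],[5]],
    [[0,5],[1],[2,6],[3],[4,7,8],[9]], [[0,4],[1,9],[2],[3,8],[5,6],[7]],
    [[0,9],[3,1,6],[2],[4],[5,7],[8]], [[0,7],[1,9],[2],[3,8],[4],[5,6]],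
    [[0],[1,5],[2,8],[7,3,9],[4],[6]], [[4,0,7],[1],[2,8],[3,5],[6],[9]],
    [[0],[1,8],[2,4],[7,3,9],[5],[6]]]
  models := []

/-- Representative number 7. -/
def rep7 : CubicRep where
  rows := [14,21,35,81,138,772,776,784,224,224]
  roots := [
    [[0,6],[1,8],[2,7],[3,9],[4],[5]], [[0,5],[1,6],[2,7],[3],[4,8],[9]],
    [[0,5],[1],[2,8],[3,9],[4,6],[7]], [[0,8],[1,7],[2],[3,5],[4,9],[6]],
    [[0],[1,7],[2,6],[3,9],[4,5],[8]], [[0,9],[1],[2,6],[3,8],[4,5],[7]],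
    [[0],[1,8],[2,9],[3,7],[4,5],[6]], [[0],[1,6],[2,7],[3,8],[4,9],[5]],
    [[0,7],[1],[2,9],[3,5],[4,6],[8]], [[0,7],[1,9],[2,8],[3,5],[4],[6]],
    [[0,8],[1,9],[2,4],[3],[5],[6,7]], [[0,4],[1,7],[2],[3,5,6],[8],[9]],
    [[0,6],[1,8],[2],[3,7],[4,5],[9]], [[0],[7,1,8],[2,6],[3,9],[4],[5]],
    [[0,8],[1],[2,6],[3],[4,9],[5,7]], [[0,7],[1,9],[2],[3,8],[4],[5,6]],
    [[0,9],[1,3],[2],[5,4,8],[6],[7]], [[0,6],[1,7],[2,3],[4,5],[8],[9]],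
    [[0],[1,8],[2,6],[7,3,9],[4],[5]], [[0],[1,6],[2,8],[3,9],[4],[5,7]],
    [[0,9],[1],[2,6,7],[3],[4,8],[5]], [[0,7],[1,8],[2],[3,9],[4],[5,6]],
    [[0,5],[1],[2,9],[3],[4,6,7],[8]], [[0,8],[6,1,9],[2],[3],[4,5],[7]],
    [[0,4],[1,5,6],[2],[3,7],[8],[9]], [[0],[1,6],[7,2,9],[3,8],[4],[5]],
    [[0,7],[1,8],[2],[3],[4,9],[5,6]], [[0],[1,5],[2,9],[3,6,7],[4],[8]],
    [[4,0,7],[1],[2,6],[3,5],[8],[9]]]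
  models := [
    ⟨[2],[5],[[10],[6,11],[0,7],[1,8],[3,9],[4]]⟩]

/-- Representative number 8. -/
def rep8 : CubicRep where
  rows := [14,21,35,193,194,772,280,536,608,416]
  roots := [
    [[0,6],[1,8],[2,7],[3,9],[4],[5]], [[0,5],[1,6],[2,7],[3],[4,8],[9]],
    [[0,7],[1],[2,8],[3,5],[4,9],[6]], [[0,9],[1,6],[2],[3,5],[4,8],[7]],
    [[0],[1,6],[2,7],[3,9],[4,5],[8]], [[0,8],[1,7],[2,4],[3],[5],[6,9]],
    [[0,9],[1],[2,3],[4,5],[6],[7,8]], [[0,6],[1,3],[2,9],[4],[5,7],[8]],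
    [[0,4],[1,9],[2],[3,8],[5,6],[7]], [[0],[1,5],[2,4],[3,7,8],[6],[9]],
    [[0,4],[1,9],[2],[3],[5,6,7],[8]], [[0],[1,8],[3,2,7],[4,9],[5],[6]],
    [[0,8],[1],[2,3],[4,5],[6,9],[7]], [[0],[1,7,8],[2,6],[3,5],[4],[9]],
    [[0,8],[1],[2,7],[3,4],[5,6],[9]], [[6,0,8],[1,7],[2],[3],[4,5],[9]],
    [[0],[1,9],[2,6],[3,8],[4,5],[7]], [[0,6],[1],[2,3],[4,9],[5,7],[8]],
    [[0,8],[1,6,9],[2,7],[3],[4],[5]], [[0,9],[1,7],[2,6],[3],[4,8],[5]],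
    [[0,6],[1,4,9],[2],[3,5],[7],[8]], [[0,5],[1],[2,6],[3],[4,9],[7,8]],
    [[0,6],[1,9],[2,4],[3,8],[5],[7]], [[0],[1,7],[2,8],[3,4],[5,6],[9]],
    [[0,3,9],[1,6],[2],[4,5],[7],[8]], [[0],[6,1,8],[2,7],[3,9],[4],[5]],
    [[7,0,9],[1,8],[2,6],[3],[4],[5]], [[0,9],[1],[2,6],[3],[4,8],[5,7]]]
  models := [
    ⟨[1],[4],[[10],[6,9,11],[0,8],[2,7],[3],[5]]⟩, ⟨[1],[4],[[10],[6,8,11],[0,9],[2,7],[3],[5]]⟩,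
    ⟨[2],[5],[[10],[6,7,11],[0,8],[1,9],[3],[4]]⟩]

/-- Representative number 9. -/
def rep9 : CubicRep where
  rows := [14,21,35,193,322,388,536,552,560,448]
  roots := [
    [[0,6],[1,7],[2,9],[3,8],[4],[5]], [[0,5],[1,6],[2,9],[3],[4,7],[8]],
    [[0,5],[1],[2,6],[3,8],[4,9],[7]], [[0,7],[1,9],[2],[3,8],[4,5],[6]],
    [[0],[1,7],[2,6],[3,8],[4,5],[9]], [[0,4],[1,9],[2,7],[3],[5,6],[8]],
    [[0],[1,8],[2,6],[3,9],[4,7],[5]], [[0,9],[1],[2,8],[3,5],[4,7],[6]],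
    [[0,8],[1,7],[2],[3,4],[5,6],[9]], [[0,9],[1,3],[2,8],[4],[5,6],[7]],
    [[0],[1,5],[2,4],[8,3,9],[6],[7]], [[0,6],[1],[2,7],[3,8],[4,5],[9]],
    [[0,4],[1,7],[2],[3],[6,5,9],[8]], [[0,8],[1,9],[2,3],[4,7],[5],[6]],
    [[0,9],[1],[2,3],[4,5,6],[7],[8]], [[0],[1,8],[2,9],[3,4],[5],[6,7]],
    [[0,9],[1],[2,6],[3],[4,7,8],[5]], [[0,6],[1,9],[2],[3,5],[4],[7,8]],
    [[0,4,7],[1],[2,9],[3],[5,6],[8]], [[0],[1,7],[2,4],[3,9],[5,6],[8]],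
    [[0,7],[1,3],[2,6,8],[4],[5],[9]], [[0,8],[1,6],[2],[3],[4,7],[5,9]],
    [[0,5],[1,6,7],[2,8],[3],[4],[9]], [[0,9],[1,5,6],[2],[3,8],[4],[7]],
    [[0,7,8],[1,6],[2,4],[3],[5],[9]], [[0,8],[1],[2,3],[4,9],[5],[6,7]],
    [[8,0,9],[1,7],[2,6],[3],[4],[5]], [[0],[1,9],[2,6],[3,7,8],[4],[5]],
    [[0],[1,7],[2,9],[3,6,8],[4],[5]], [[0,8],[1],[2,9],[3],[4,6,7],[5]],
    [[0,9],[1,7],[2],[3],[4],[5,6,8]], [[0,8],[1,9],[2],[3],[4],[5,6,7]],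
    [[0],[1,5],[2,6],[8,3,9],[4],[7]]]
  models := []

/-- Representative number 10. -/
def rep10 : CubicRep where
  rows := [14,21,35,193,322,580,56,776,656,416]
  roots := [
    [[0,6],[1,7],[2,8],[3,9],[4],[5]], [[0,5],[1,6],[2,8],[3],[4,7],[9]],
    [[0],[1,5],[2,7],[3,8],[4,9],[6]], [[0,6],[1,7],[2],[3,9],[4,5],[8]],
    [[0,6],[1],[2,9],[3,4],[5,8],[7]], [[0],[1,7],[2,4],[3,9],[5,8],[6]],
    [[0,8],[1,7],[2,6],[3],[4,5],[9]], [[0,8],[1],[2,3],[4,5],[6,9],[7]],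
    [[0,4],[1,9],[2,3],[5],[6,7],[8]], [[0,6],[1,9],[2,7],[3,8],[4],[5]],
    [[0,8],[1,6],[2],[3],[4,9],[5,7]], [[0],[1,5],[2,8],[3,9],[4,7],[6]],
    [[0,4],[1,8],[2],[3],[5,6,7],[9]], [[0,6],[1],[2,8],[3,5],[4,9],[7]],
    [[0,9],[1],[2,7],[3,4],[5],[6,8]], [[0,7],[1,3],[2],[4],[5,6,8],[9]],
    [[0,7],[1,6],[2],[3,9],[4,5],[8]], [[0],[1,7],[2,4],[3,5],[6,9],[8]],
    [[0,9],[1,3,4],[2],[5,8],[6],[7]], [[0,5],[1],[2,6],[3,8],[4,7],[9]],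
    [[0],[1,5],[2,9],[3,8],[4],[6,7]], [[0,7],[1],[2,6],[3,8],[4,5],[9]],
    [[0,5],[1],[2,9],[3],[4,6,7],[8]], [[0],[1,5],[2,9],[3,6,8],[4],[7]],
    [[0,8],[1,7],[2],[3,5],[4],[6,9]], [[0,8],[1],[2,6],[3,5],[4,9],[7]],
    [[4,0,6],[1],[7,2,9],[3],[5],[8]]]
  models := [
    ⟨[2],[5],[[10],[6,9,11],[0,8],[1,7],[3],[4]]⟩, ⟨[2],[5],[[10],[9,6,11],[0,8],[1,7],[3],[4]]⟩,
    ⟨[2],[5],[[10],[6,8,11],[0,9],[1,7],[3],[4]]⟩, ⟨[2],[5],[[10],[8,6,11],[0,9],[1,7],[3],[4]]⟩,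
    ⟨[2],[5],[[10],[6,7,11],[0,8],[1,9],[3],[4]]⟩, ⟨[2],[5],[[10],[7,6,11],[0,8],[1,9],[3],[4]]⟩]

/-- Representative number 11. -/
def rep11 : CubicRep where
  rows := [14,21,35,193,322,644,280,552,592,416]
  roots := [
    [[0,6],[1,7],[2,8],[3,9],[4],[5]], [[0,5],[1,6],[2,9],[3],[4,7],[8]],
    [[0,5],[1],[2,6],[3,8],[4,9],[7]], [[0,8],[1,7],[2],[3,5],[4,9],[6]],
    [[0],[1,6],[2,7],[3,8],[4,5],[9]], [[0,9],[1,7],[2,6],[3],[4,5],[8]],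
    [[0],[1,9],[2,6],[3,8],[4,7],[5]], [[0,9],[1,3],[2],[4,5],[6],[7,8]],
    [[0,9],[1,3],[2,6],[4],[5],[7,8]], [[0,4],[1,9],[2,3],[5,6],[7],[8]],
    [[0,7],[1],[2,8],[3,9],[4,5],[6]], [[0,8],[1],[2,9],[3,5],[4,7],[6]],
    [[0,6],[1,8],[2],[3,5],[4,7],[9]], [[0,6],[1,9],[2,3],[4],[5,8],[7]],
    [[0,9],[1,5],[2,6],[3,8],[4],[7]], [[0],[1,5],[2,4],[3,9],[6],[7,8]],
    [[0,9],[1,6],[2],[3],[4,7],[5,8]], [[0,5],[1],[2,8],[3,4],[6,7],[9]],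
    [[0,8],[1,9],[2],[3,5],[4],[6,7]], [[0,4],[7,1,9],[2,6],[3],[5],[8]],
    [[0,9],[1,8],[2,3],[4,7],[5],[6]], [[0],[1,7],[2,9],[3,8],[4],[5,6]],
    [[0],[1,9],[2,8],[3,5,6],[4],[7]], [[0,8],[1],[2,7],[3],[4,5],[6,9]],
    [[0,4],[1,8],[2,7],[3],[5,6],[9]], [[0,7],[1],[2,3],[4,9],[5,8],[6]],
    [[0,5],[1],[2,6],[3],[4,9],[7,8]], [[0,4,7],[1],[2,8],[3],[5],[6,9]],
    [[0],[1,8],[2,4],[3,9],[5],[6,7]], [[0,7],[1,3],[2,8],[4],[5],[6,9]]]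
  models := []

/-- Representative number 12. -/
def rep12 : CubicRep where
  rows := [14,21,35,193,322,644,536,296,656,352]
  roots := [
    [[0,6],[1,7],[2,8],[3,9],[4],[5]], [[0,5],[1,6],[2,8],[3],[4,7],[9]],
    [[0],[1,5],[2,9],[3,8],[4,7],[6]], [[0,6],[1,8],[2],[3,9],[4,5],[7]],
    [[0,6],[1],[2,7],[3,9],[4,5],[8]], [[0,4],[1,9],[2],[3,5],[6,7],[8]],
    [[0,8],[1,3],[2,9],[4],[5,6],[7]], [[0,7],[1],[2,6],[3,8],[4,9],[5]],
    [[0,8],[1],[2,7],[3],[4,9],[5,6]], [[0],[1,9],[2,8],[3,4,7],[5],[6]],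
    [[0,9],[1,7],[2,6],[3],[4],[5,8]], [[0,9],[1,8],[2],[3],[4,7],[5,6]],
    [[0],[1,9],[2,7],[3,4],[5,6],[8]], [[0],[1,8],[2,4],[3,7,9],[5],[6]],
    [[0],[1,5],[2,9],[3,6,8],[4],[7]], [[0,5],[1],[2,8],[3,4],[6,7],[9]],
    [[0,6],[1,3],[2],[4,5,8],[7],[9]], [[0,8],[1],[2,6],[3,9],[4,7],[5]],
    [[0,7],[1,5],[2,6],[3,8],[4],[9]], [[0,4],[1,8],[2],[5,3,9],[6],[7]],
    [[0,9],[1,6],[2,7],[3],[4,5],[8]], [[0,8],[1,9],[2],[3,4,5],[6],[7]],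
    [[0],[1,7],[2,9],[3,8],[4],[5,6]], [[0,5,8],[1],[2,6],[3,4],[7],[9]],
    [[0,5,6],[7,1,8],[2],[3],[4],[9]], [[0,5,6],[1,7],[2,8],[3],[4],[9]],
    [[0,4,7],[1],[6,2,9],[3],[5],[8]], [[0,4],[1,7],[2],[3,9],[5,6],[8]]]
  models := [
    ⟨[0,6],[3],[[10],[9,11],[1,7],[2],[4],[5,8]]⟩, ⟨[2],[5],[[10],[6,8,11],[0,9],[1,7],[3],[4]]⟩,
    ⟨[2],[5],[[10],[6,7,11],[0,8],[1,9],[3],[4]]⟩, ⟨[2],[5],[[10],[7,6,11],[0,8],[1,9],[3],[4]]⟩]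

/-- Representative number 13. -/
def rep13 : CubicRep where
  rows := [14,49,49,193,262,518,776,776,208,224]
  roots := [
    [[0,6],[1],[2],[3,9],[4,7],[5,8]], [[0,5],[1,6],[2,8],[3],[4,7],[9]],
    [[0,8],[1,6],[2,9],[3,5],[4],[7]], [[0],[1,6],[2,7],[3,8],[4,9],[5]],
    [[0,7],[1],[2,8],[3,5],[4,9],[6]], [[0,9],[1,7],[2],[3,4],[5,6],[8]],
    [[0,8],[1],[2,9],[3,4],[5,7],[6]], [[0,9],[1,3],[2,6],[4],[5,8],[7]],
    [[0,9],[1,8],[2,7],[3],[4,6],[5]], [[0],[1,9],[2,6],[3,8],[4],[5,7]],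
    [[0,5],[1,6],[2,7],[3],[4,9],[8]], [[0,8],[1,6],[2],[3,5],[4,7],[9]],
    [[0],[1,9],[2,8],[3,4],[5,6],[7]], [[0,4],[1,3],[2,9],[5,8],[6],[7]],
    [[0,6],[1,7],[2,3],[4],[5],[8,9]], [[0],[1,6],[2,5,7],[3,4],[8],[9]],
    [[0,6],[1,8],[2],[3,5],[4,7],[9]], [[0,8],[1],[2],[3,9],[4,6],[5,7]],
    [[0,8],[1,7],[2,9],[3],[4],[5,6]], [[0,7],[1],[2],[3,5],[4,6],[8,9]],
    [[0,7],[1],[2],[3,4],[5,6],[8,9]], [[0,7],[1],[2],[3,9],[4,6],[5,8]],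
    [[0],[1,8],[2,9],[3,5],[4,6],[7]], [[0],[1,7],[2,6],[3,9],[4,5],[8]],
    [[0,4],[1,9],[2,8],[3,5],[6],[7]], [[0,7],[1,3],[2,6],[4,9],[5],[8]],
    [[0,5],[1,8],[2,3],[4,9],[6],[7]], [[0,9],[1],[2],[3,8],[4,7],[5,6]],
    [[4,0,8],[1],[2,9],[3,5],[6],[7]], [[5,0,9],[1,8],[2],[3,4],[6],[7]],
    [[5,0,9],[1],[2,8],[3,4],[6],[7]]]
  models := [
    ⟨[0,6],[3],[[10],[9,11],[1],[2],[4,7],[5,8]]⟩]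

/-- Representative number 14. -/
def rep14 : CubicRep where
  rows := [14,49,81,161,262,522,388,584,592,416]
  roots := [
    [[0,6],[1,7],[2,9],[3,8],[4],[5]], [[0,5],[1,6],[2],[3,9],[4,7],[8]],
    [[0,7],[1],[2,5],[3,8],[4,9],[6]], [[0,6],[1,7],[2,8],[3],[4,5],[9]],
    [[0],[1,6],[2,9],[3,8],[4,5],[7]], [[0,9],[1],[2,8],[3,4],[5,6],[7]],
    [[0],[1,8],[2,7],[3,4],[5],[6,9]], [[0,9],[1,6],[2,7],[3],[4],[5,8]],
    [[0,8],[1,7],[2],[3,4],[5,6],[9]], [[0,4],[1,7],[2,9],[3],[5,6],[8]],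
    [[0,6],[1,9],[2,5],[3],[4,7],[8]], [[0,7],[1],[2],[3,6],[4,9],[5,8]],
    [[0,8],[1],[2,3],[4,9],[5,6],[7]], [[0],[1,2,5],[3,7,8],[4],[6],[9]],
    [[0,7],[1,6],[2],[3,8],[4,5],[9]], [[0],[8,1,9],[2,7],[3,6],[4],[5]],
    [[0,9],[1,7],[2],[3,6],[4,5],[8]], [[0,7],[1,8],[2,9],[3,4],[5],[6]],
    [[8,0,9],[1,7],[2,3],[4],[5],[6]], [[0,5],[1,9],[2],[3,6],[4,7],[8]],
    [[0,8],[1],[2],[3,4],[5,7],[6,9]], [[0],[1,8],[2,3,9],[4,7],[5],[6]],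
    [[0],[1,9],[2,3,6],[4,5],[7],[8]], [[0,2,7],[1,8],[3],[4,5],[6],[9]],
    [[0,6],[1],[2,7],[3],[4,9],[5,8]], [[0,8],[1,7],[2],[3,6],[4,9],[5]],
    [[0,9],[1],[2,8],[3],[4,7],[5,6]], [[0,9],[1],[2,5],[3],[4,7,8],[6]],
    [[0,4,7],[1,9],[2],[3],[5,6],[8]], [[4,0,8],[1,7],[2],[3],[5,6],[9]],
    [[0,3,4],[1],[2,9],[5,6],[7],[8]]]
  models := []

/-- Representative number 15. -/
def rep15 : CubicRep where
  rows := [14,49,81,161,262,522,644,328,656,352]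
  roots := [
    [[0,6],[1,7],[2,9],[3,8],[4],[5]], [[0,5],[1,6],[2],[3,8],[4,7],[9]],
    [[0,7],[1],[2,5],[3,8],[4,9],[6]], [[0,9],[1,7],[2,5],[3],[4,6],[8]],
    [[0,8],[1,6],[2,5],[3,9],[4],[7]], [[0],[1,8],[2,9],[3,6],[4,7],[5]],
    [[0,6],[1,9],[2,7],[3],[4,5],[8]], [[0,6],[1],[2,9],[3,4],[5,8],[7]],
    [[0,8],[1,7],[2],[3,6],[4,9],[5]], [[0],[1,9],[2,8],[3,4],[5,7],[6]],
    [[0,5],[1,8],[2,3],[4,6],[7],[9]], [[0],[1,6],[2,7],[3,8],[4,9],[5]],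
    [[0,9],[1,7],[2,8],[3],[4,5],[6]], [[0,7],[1,6],[2,9],[3,4],[5],[8]],
    [[0,8],[1,9],[2,5,7],[3],[4],[6]], [[0,8],[1],[2],[3,5,6],[4,7],[9]],
    [[0],[1,7],[2,9],[3,6],[4,5],[8]], [[0,6],[1,5,8],[2,3],[4],[7],[9]],
    [[0,5],[1,8],[2],[3,6],[4,7],[9]], [[0,9],[1,8],[2,5],[3],[4,7],[6]],
    [[0],[1,9],[2,5],[3,4,7],[6],[8]], [[0],[2,1,6],[3,8],[4],[5,7],[9]],
    [[6,0,7],[1],[2],[3],[4,9],[5,8]], [[0,3,6],[1,8],[2],[4,5],[7],[9]],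
    [[0],[1,9],[3,2,7],[4],[5,8],[6]], [[0,7],[1],[2,3],[5,4,9],[6],[8]],
    [[0,9],[1,6],[2,7],[3],[4],[5,8]], [[0,9],[1,6],[2],[3,8],[4,7],[5]],
    [[0,8],[1,7],[2,9],[3],[4],[5,6]], [[0],[1,5,8],[2,7],[3,6],[4],[9]]]
  models := [
    ⟨[3],[5],[[10],[6,11],[0,8],[1,7],[2,9],[4]]⟩, ⟨[1],[5],[[10],[6,11],[0,7],[2],[3,8],[4,9]]⟩,
    ⟨[1],[4],[[10],[7,11],[0,6],[2,9],[3],[5,8]]⟩]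

/-- Representative number 16. -/
def rep16 : CubicRep where
  rows := [14,49,81,161,262,522,772,776,208,224]
  roots := [
    [[0,6],[1,7],[2,9],[3,8],[4],[5]], [[0,5],[1,6],[2],[3,8],[4,7],[9]],
    [[0,7],[1],[2,5],[3,8],[4,9],[6]], [[0,6],[1,7],[2,5],[3],[4,9],[8]],
    [[0],[1,6],[2,9],[3,4],[5,8],[7]], [[0,9],[1,6],[2,7],[3],[4,5],[8]],
    [[0,8],[1,9],[2],[3,6],[4,5],[7]], [[0,9],[1],[2,7],[3,4],[5,8],[6]],
    [[0],[1,6],[2,7],[3,8],[4,9],[5]], [[0,7],[1,6],[2,3],[4],[5],[8,9]],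
    [[0,8],[1,7],[2,9],[3],[4],[5,6]], [[0],[1,8],[2,7],[3,6],[4,5],[9]],
    [[0],[1,8],[2,9],[3,6],[4,7],[5]], [[0,5,8],[1],[2,3],[4,9],[6],[7]],
    [[0,9],[1],[2],[3,4,6],[5,7],[8]], [[0,8],[1,9],[2],[3],[4,7],[5,6]],
    [[0],[1,7],[2,3,6],[4],[5,8],[9]], [[0,9],[7,1,8],[2,5],[3],[4],[6]],
    [[6,0,9],[1,8],[2],[3,4],[5],[7]], [[0,7],[1,6],[2,5],[3,4],[8],[9]],
    [[0,3,6],[1,8],[2],[4,9],[5],[7]], [[0,8],[1,9],[2,7],[3],[4,5],[6]],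
    [[0,9],[1,8],[2],[3,6],[4,5],[7]], [[0,7],[1,9],[2,3],[4],[5,8],[6]],
    [[0],[6,1,9],[2,7],[3,8],[4],[5]], [[0,9],[1,6],[2],[3,8],[4,7],[5]],
    [[0,9],[1,5,8],[2,7],[3],[4],[6]], [[0,9],[1],[2,5],[3,8],[4,7],[6]],
    [[0,4,7],[1],[2,9],[3],[5,6],[8]]]
  models := [
    ⟨[1],[4],[[10],[9,11],[0,6],[2,7],[3],[5,8]]⟩, ⟨[6,11],[2,9],[[10],[0],[1,7],[3,8],[4],[5]]⟩,
    ⟨[3],[5],[[10],[6,11],[0,8],[1,7],[2,9],[4]]⟩, ⟨[1],[5],[[10],[6,11],[0,7],[2],[3,8],[4,9]]⟩,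
    ⟨[1],[4],[[10],[7,11],[0,6],[2,9],[3],[5,8]]⟩]

/-- Representative number 17. -/
def rep17 : CubicRep where
  rows := [14,49,81,385,134,770,772,536,104,224]
  roots := [
    [[0,6],[1,7],[2,8],[3],[4,9],[5]], [[0,5],[1,9],[2],[3,6],[4,8],[7]],
    [[0,7],[1],[2,5],[3,9],[4,8],[6]], [[0],[1,6],[2,7],[3,5],[4,8],[9]],
    [[0,6],[1,3],[2,9],[4],[5,7],[8]], [[0,9],[1,6],[2,7],[3],[4,8],[5]],
    [[0,9],[1],[2,8],[3,5],[4,6],[7]], [[0,8],[1],[2,7],[3,5],[4,9],[6]],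
    [[0,7],[1,6],[2,5],[3,9],[4],[8]], [[0,9],[1,6],[2],[3,5],[4,8],[7]],
    [[0,5],[1,9],[2,3],[4],[6,7],[8]], [[0,9],[1,8],[2,7],[3],[4,5],[6]],
    [[0,6],[1,7],[2,9],[3],[4,8],[5]], [[0],[1,7],[2,8],[3,5],[4,6],[9]],
    [[0],[1,6],[2,9],[3,4],[5],[7,8]], [[0,5,6],[1],[2],[3,4],[7,8],[9]],
    [[0],[1,9],[2,8],[3,6],[4],[5,7]], [[0,8],[1,7],[2],[3,6],[4,9],[5]],
    [[0,5],[1,8],[2,6,7],[3],[4],[9]], [[0,3,6],[1,7],[2],[4,5],[8],[9]],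
    [[0,9],[1,7],[2],[3,6],[4,8],[5]], [[0],[1,8],[2,9],[3,6],[4],[5,7]],
    [[0,7],[1,5,6],[2],[3,4],[8],[9]], [[0],[3,1,8],[7,2,9],[4],[5],[6]],
    [[0,8],[1,3],[2],[4,9],[5],[6,7]], [[0],[1,3,5],[2,9],[4],[6,7],[8]],
    [[0,8],[1],[2,3],[4,9],[5,7],[6]], [[0,6],[1],[2,3],[4,5,7],[8],[9]],
    [[7,0,9],[1,6],[2,8],[3],[4],[5]], [[0,3,5],[1],[2,9],[4,6],[7],[8]]]
  models := [
    ⟨[1],[5],[[10],[6,7,11],[0,9],[2],[3],[4,8]]⟩]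

/-- Representative number 18. -/
def rep18 : CubicRep where
  rows := [14,49,193,769,322,642,532,292,152,104]
  roots := [
    [[0,6],[1,7],[2,9],[3],[4],[5,8]], [[0],[1,9],[2,8],[3,5],[4,7],[6]],
    [[0,6],[1],[2,4],[3,5],[7],[8,9]], [[0,4],[1,3],[2,5],[6,7],[8],[9]],
    [[0,7],[1,6],[2,3],[4,9],[5],[8]], [[0,5],[1,7],[2],[3,4],[6,8],[9]],
    [[0],[1,8],[2,9],[3,4],[5,6],[7]], [[0,4],[1,6],[2],[3],[5],[7,8,9]],
    [[0,7],[1],[2,5],[3,4],[6],[8,9]], [[0,7],[1,2],[3],[4],[5],[6,8,9]],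
    [[0],[1,9],[2,6,8],[3,5],[4],[7]], [[0,9],[1,7],[2,3],[4,5],[6],[8]],
    [[0,8],[1],[2],[3,7],[4,5,6],[9]], [[0,7],[1],[2,8],[3],[5,4,9],[6]],
    [[0,3,5],[1],[2,4],[6,7],[8],[9]], [[6,0,9],[1,8],[2],[3],[4,7],[5]],
    [[0],[6,1,9],[2,8],[3,7],[4],[5]], [[0],[1,9],[3,2,8],[4,5],[6],[7]],
    [[5,0,9],[1],[2,8],[3],[4,7],[6]], [[0,5],[1,9],[2],[3],[4,7],[6,8]],
    [[5,0,7],[1],[2],[3,6],[4,9],[8]], [[0],[1,7],[2,5],[3,6],[4,9],[8]],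
    [[0,6],[1],[2,4],[5,3,7],[8],[9]], [[0,3,7],[1,6],[2],[4,5],[8],[9]],
    [[0,8],[1,3],[2],[4],[5,6],[7,9]], [[0,4],[1,3],[2],[5,6],[7,9],[8]],
    [[0],[1,8],[2,3,6],[4,5],[7],[9]], [[0,2,8],[1,9],[3],[4],[5,6],[7]],
    [[0,6],[1],[2,9],[3],[4,7],[5,8]], [[0,9],[7,1,8],[2],[3,6],[4],[5]],
    [[0,7],[1],[2,5],[3,6],[4,9],[8]], [[4,0,6],[1],[2],[3,7],[5,8],[9]],
    [[0],[1,6],[2,4],[3,7],[5],[8,9]]]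
  models := [
    ⟨[1],[4],[[10],[7,11],[6,0,9],[2],[3],[5,8]]⟩, ⟨[1],[5],[[10],[6,11],[7,0,8],[2],[3],[4,9]]⟩,
    ⟨[1,8],[4],[[10],[6,11],[0,7],[2,9],[3],[5]]⟩, ⟨[1,8],[4],[[10],[7,11],[0,6],[2,9],[3],[5]]⟩,
    ⟨[1],[5],[[10],[6,11],[0,7],[2,8],[3],[4,9]]⟩, ⟨[1,9],[5],[[10],[6,11],[7,0,8],[2],[3],[4]]⟩,
    ⟨[1,9],[5],[[10],[7,11],[0,6,8],[2],[3],[4]]⟩, ⟨[1,6],[4],[[10],[9,11],[0,8],[2],[3,7],[5]]⟩,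
    ⟨[1,9],[5],[[10],[6,11],[0,7],[2,8],[3],[4]]⟩, ⟨[0,6],[2],[[10],[9,11],[1,7],[3],[4],[5,8]]⟩,
    ⟨[0,9],[3],[[10],[6,11],[1,8],[2],[4,7],[5]]⟩, ⟨[1,7],[5],[[10],[8,11],[6,0,9],[2],[3],[4]]⟩]

/-- All nineteen representatives. -/
def reps : List CubicRep := [
  rep0, rep1, rep2, rep3, rep4, rep5, rep6, rep7, rep8, rep9, rep10, rep11, rep12, rep13, rep14,
  rep15, rep16, rep17, rep18]

/-- Evaluate the argument before passing it on (this only matters for kernel computation). -/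
noncomputable def force {α : Type} (n : ℕ) (f : ℕ → α) : α :=
  Nat.rec (f 0) (fun k _ => f (Nat.succ k)) n

/-- Conjunction, directly through the recursor. -/
noncomputable def andB (a b : Bool) : Bool := Bool.rec false b a

/-- Disjunction, directly through the recursor. -/
noncomputable def orB (a b : Bool) : Bool := Bool.rec b true a

/-- Does `p` hold throughout the list? -/
noncomputable def allL {α : Type} (p : α → Bool) (l : List α) : Bool :=
  List.rec true (fun a _ ih => Bool.rec false ih (p a)) l

/-- Does `p` hold somewhere in the list? -/
noncomputable def anyL {α : Type} (p : α → Bool) (l : List α) : Bool :=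
  List.rec false (fun a _ ih => Bool.rec ih true (p a)) l

/-- Bit test, in terms of operations the kernel evaluates quickly. -/
noncomputable def tb (m n : ℕ) : Bool := Nat.beq (Nat.land (Nat.shiftRight m n) 1) 1

/-- Union of the masks, together with the bit `0`. -/
noncomputable def seenMask (l : List ℕ) : ℕ := List.rec 1 (fun r _ ih => Nat.lor r ih) l

/-- The backward part of row `i`, as prescribed by the previous rows (in reverse order). -/
noncomputable def backMask (i : ℕ) (l : List ℕ) : ℕ :=
  List.rec 0 (fun q l ih =>
    Nat.lor (Nat.shiftLeft (Nat.land (Nat.shiftRight q i) 1) l.length) ih) l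

/-- May the mask `r` be the next row? Here `low` is the mask of the rows up to this one, `b`
is the prescribed backward part, `s` is the set of vertices seen before and `m` is a lower bound
for the set of vertices seen after this row. -/
noncomputable def rowOk (low b s m r : ℕ) : Bool :=
  andB (Nat.beq (Nat.land r low) b) (andB (Nat.ble m (Nat.lor r s))
    (Nat.beq (Nat.land (Nat.lor r s) (Nat.succ (Nat.lor r s))) 0))

/-- Lower bound for the set of vertices seen after row `i`. -/
def lowBound (i : ℕ) : ℕ := if i = 9 then 0 else 2 ^ (i + 1)

/-- The possible tables that extend a given one by row number `i`, put before `tail`. -/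
noncomputable def extend (i : ℕ) (rows : List ℕ) (tail : List (List ℕ)) : List (List ℕ) :=
  force (2 ^ (i + 1) - 1) fun low => force (backMask i rows) fun b =>
    force (seenMask rows) fun s => force (lowBound i) fun m =>
      List.rec tail (fun r _ ih => Bool.rec ih ((r :: rows) :: ih) (rowOk low b s m r)) tripleMasks

/-- Breadth-first enumeration of tables of neighbourhood masks (last row first). -/
noncomputable def tables : ℕ → List (List ℕ)
  | 0 => [[]]
  | i + 1 => List.rec [] (fun rows _ ih => extend i rows ih) (tables i)

/-- Digit `i` of `n`. -/
noncomputable def digit (n i : ℕ) : ℕ := Nat.mod (Nat.div n (Nat.pow 10 i)) 10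

/-- Entry number `i` of a list. -/
noncomputable def entry (l : List ℕ) : ℕ → ℕ :=
  List.rec (fun _ => 0) (fun a _ ih i => Nat.rec a (fun k _ => ih k) i) l

/-- Equality of booleans. -/
noncomputable def same (a b : Bool) : Bool := Bool.rec (Bool.rec true false b) b a

/-- The numbers below ten. -/
def tens : List ℕ := [0, 1, 2, 3, 4, 5, 6, 7, 8, 9]

/-- Is `rows` the table `t` relabelled along the digits of `n`? -/
noncomputable def relabelOk (t : List ℕ) (n : ℕ) (rows : List ℕ) : Bool :=
  allL (fun i => force (entry rows i) fun a => force (entry t (Nat.sub 9 (digit n i))) fun b =>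
    allL (fun j => same (tb a j) (tb b (digit n j))) tens) tens

/-- Are the ten lowest digits of `n` distinct? -/
noncomputable def digitsOk (n : ℕ) : Bool :=
  allL (fun i => force (digit n i) fun d =>
    allL (fun j => orB (Nat.beq i j) (Bool.rec true false (Nat.beq d (digit n j)))) tens) tens

/-- The rows of representative number `k`. -/
noncomputable def repRows (k : ℕ) : List ℕ := (reps.getD k rep0).rows

/-- Check the relabellings. -/
noncomputable def allTwo (l : List (List ℕ)) : List ℕ → Bool :=
  List.rec (fun _ => true) (fun t _ ih m => List.rec false (fun n k _ =>
    andB (digitsOk n) (andB (relabelOk t n (repRows (Nat.div n 10000000000))) (ih k))) m) l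

/-- Adjacency on the twelve vertices: `10` stands for `x` and `11` for `z`. -/
noncomputable def adjTest (rows : List ℕ) (S i j : ℕ) : Bool :=
  Bool.rec (Bool.rec (Bool.rec (Bool.rec (Bool.rec true false (tb (entry rows i) j))
    true (Nat.beq j 10)) true (Nat.beq i 10)) (tb S i) (Nat.beq j 11)) (tb S j) (Nat.beq i 11)

/-- Connectivity of a branch set. -/
noncomputable def connTest (rows : List ℕ) (S : ℕ) (b : List ℕ) : Bool :=
  List.rec false (fun v l ih =>
    List.rec true (fun _ _ _ => andB (anyL (adjTest rows S v) l) ih) l) b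

/-- Adjacency of two branch sets. -/
noncomputable def touchTest (rows : List ℕ) (S : ℕ) (b c : List ℕ) : Bool :=
  anyL (fun v => anyL (fun w => adjTest rows S v w) c) b

/-- All branch sets of the list touch each other. -/
noncomputable def pairTest (rows : List ℕ) (S : ℕ) (l : List (List ℕ)) : Bool :=
  List.rec true (fun b l ih => andB (allL (touchTest rows S b) l) ih) l

/-- No repetitions, and all entries are at most `m`. -/
noncomputable def nodupTest (m : ℕ) (l : List ℕ) : Bool :=
  List.rec true (fun v l ih => andB (Nat.ble v m)
    (andB (allL (fun w => Bool.rec true false (Nat.beq v w)) l) ih)) l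

/-- The list of branch sets `b :: c :: l` is a model of `K₈⁻` (`b` and `c` need not touch). -/
noncomputable def modelTest (rows : List ℕ) (S : ℕ) (b c : List ℕ) (l : List (List ℕ)) : Bool :=
  andB (allL (touchTest rows S b) l) (andB (allL (touchTest rows S c) l)
    (andB (pairTest rows S l) (andB (allL (connTest rows S) (b :: c :: l))
      (andB (Nat.beq l.length 6) (nodupTest 11 (b ++ (c ++ l.flatten)))))))

/-- The list of branch sets is a model of `K₆` in the neighbourhood. -/
noncomputable def rootTest (rows : List ℕ) (l : List (List ℕ)) : Bool :=
  andB (pairTest rows 0 l) (andB (allL (connTest rows 0) l)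
    (andB (Nat.beq l.length 6) (nodupTest 9 l.flatten)))

/-- Every branch set meets `S`. -/
noncomputable def hitTest (S : ℕ) (l : List (List ℕ)) : Bool := allL (fun b => anyL (tb S) b) l

/-- Some stored model works for each `S`. -/
noncomputable def repTest (R : CubicRep) : Bool :=
  andB (allL (rootTest R.rows) R.roots) (allL (fun S => orB (anyL (hitTest S) R.roots)
    (anyL (fun M => modelTest R.rows S M.head M.second M.rest) R.models)) sixMasks)

theorem tables_relabel : allTwo (tables 10) relabels = true := by decide +kernel

theorem reps_check : reps.all repTest = true := by decide +kernel


theorem natBeq_false {a b : ℕ} (h : a ≠ b) : Nat.beq a b = false := by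
  cases hb : Nat.beq a b
  · rfl
  · exact absurd (Nat.eq_of_beq_eq_true hb) h

theorem force_eq {α : Type} (n : ℕ) (f : ℕ → α) : force n f = f n := by cases n <;> rfl

theorem andB_iff {a b : Bool} : andB a b = true ↔ a = true ∧ b = true := by
  cases a <;> cases b <;> simp [andB]

theorem orB_iff {a b : Bool} : orB a b = true ↔ a = true ∨ b = true := by
  cases a <;> cases b <;> simp [orB]

theorem notB_iff {a : Bool} : (Bool.rec true false a : Bool) = true ↔ a = false := by
  cases a <;> simp

theorem allL_cons {α : Type} (p : α → Bool) (a : α) (l : List α) :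
    allL p (a :: l) = andB (p a) (allL p l) := rfl

theorem anyL_cons {α : Type} (p : α → Bool) (a : α) (l : List α) :
    anyL p (a :: l) = orB (p a) (anyL p l) := rfl

theorem allL_iff {α : Type} (p : α → Bool) (l : List α) :
    allL p l = true ↔ ∀ a ∈ l, p a = true := by
  induction l with
  | nil => simp [allL]
  | cons a l ih => rw [allL_cons, andB_iff, ih]; simp

theorem anyL_iff {α : Type} (p : α → Bool) (l : List α) :
    anyL p l = true ↔ ∃ a ∈ l, p a = true := by
  induction l with
  | nil => simp [anyL]
  | cons a l ih => rw [anyL_cons, orB_iff, ih]; simp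

theorem tb_eq (m n : ℕ) : tb m n = m.testBit n := by
  have h : tb m n = Nat.beq ((m >>> n) &&& 1) 1 := rfl
  rw [h, Nat.testBit_eq_decide_div_mod_eq, Nat.shiftRight_eq_div_pow, Nat.and_one_is_mod]
  rcases Nat.mod_two_eq_zero_or_one (m / 2 ^ n) with h | h <;> rw [h] <;> rfl

theorem same_iff {a b : Bool} : same a b = true ↔ a = b := by
  cases a <;> cases b <;> simp [same]

theorem mem_extend (i : ℕ) (rows : List ℕ) (tail : List (List ℕ)) (t : List ℕ)
    (h : t ∈ tail ∨ ∃ r ∈ tripleMasks,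
      rowOk (2 ^ (i + 1) - 1) (backMask i rows) (seenMask rows) (lowBound i) r = true ∧
        t = r :: rows) :
    t ∈ extend i rows tail := by
  simp only [extend, force_eq]
  generalize tripleMasks = T at h
  generalize rowOk (2 ^ (i + 1) - 1) (backMask i rows) (seenMask rows) (lowBound i) = p at h
  induction T with
  | nil => simpa using h
  | cons r T ih =>
    rcases h with h | ⟨s, hs, hp, rfl⟩
    · have := ih (Or.inl h)
      show t ∈ (Bool.rec _ _ (p r) : List (List ℕ))
      cases p r
      · exact this
      · exact List.mem_cons_of_mem _ this
    · show s :: rows ∈ (Bool.rec _ _ (p r) : List (List ℕ))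
      rcases List.mem_cons.1 hs with rfl | hs
      · rw [hp]; exact List.mem_cons_self
      · have := ih (Or.inr ⟨s, hs, hp, rfl⟩)
        cases p r
        · exact this
        · exact List.mem_cons_of_mem _ this

theorem mem_tables_succ (i : ℕ) (rows : List ℕ) (hrows : rows ∈ tables i) (r : ℕ)
    (hr : r ∈ tripleMasks)
    (h : rowOk (2 ^ (i + 1) - 1) (backMask i rows) (seenMask rows) (lowBound i) r = true) :
    r :: rows ∈ tables (i + 1) := by
  rw [tables]
  generalize tables i = T at hrows
  induction T with
  | nil => simp at hrows
  | cons t T ih =>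
    rcases List.mem_cons.1 hrows with rfl | hrows
    · exact mem_extend _ _ _ _ (Or.inr ⟨r, hr, h, rfl⟩)
    · exact mem_extend _ _ _ _ (Or.inl (ih hrows))

/-- The first `n` rows of a table, last row first. -/
def revRows (f : ℕ → ℕ) : ℕ → List ℕ
  | 0 => []
  | n + 1 => f n :: revRows f n

theorem length_revRows (f : ℕ → ℕ) (n : ℕ) : (revRows f n).length = n := by
  induction n with
  | zero => rfl
  | succ n ih => simp [revRows, ih]

theorem testBit_backMask (f : ℕ → ℕ) (i n t : ℕ) :
    (backMask i (revRows f n)).testBit t = (decide (t < n) && (f t).testBit i) := by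
  induction n with
  | zero => simp [revRows, backMask]
  | succ n ih =>
    have : backMask i (revRows f (n + 1)) =
        (((f n >>> i) &&& 1) <<< (revRows f n).length) ||| backMask i (revRows f n) := rfl
    rw [this, Nat.testBit_or, ih, length_revRows, Nat.testBit_shiftLeft, Nat.testBit_and,
      Nat.testBit_shiftRight]
    rcases lt_trichotomy t n with h | rfl | h
    · simp [h, show t < n + 1 by omega, show ¬ n ≤ t by omega]
    · simp
    · obtain ⟨d, hd⟩ : ∃ d, t - n = d + 1 := ⟨t - n - 1, by omega⟩
      simp [hd, show ¬ t < n + 1 by omega, show ¬ t < n by omega, Nat.testBit_succ]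

theorem testBit_seenMask (f : ℕ → ℕ) (n t : ℕ) :
    (seenMask (revRows f n)).testBit t = true ↔ t = 0 ∨ ∃ i < n, (f i).testBit t = true := by
  induction n with
  | zero => simp [revRows, seenMask, Nat.testBit_one_eq_true_iff_self_eq_zero]
  | succ n ih =>
    have : seenMask (revRows f (n + 1)) = f n ||| seenMask (revRows f n) := rfl
    rw [this, Nat.testBit_or, Bool.or_eq_true, ih]
    simp only [Nat.lt_succ_iff_lt_or_eq]
    grind

theorem mem_tables (f : ℕ → ℕ) (h3 : ∀ i < 10, f i ∈ tripleMasks)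
    (hirr : ∀ i < 10, (f i).testBit i = false)
    (hsym : ∀ i < 10, ∀ j < 10, (f i).testBit j = (f j).testBit i)
    (hseen : ∀ k ≤ 10, ∃ m, (k < 10 → k < m) ∧ seenMask (revRows f k) = 2 ^ m - 1)
    (k : ℕ) (hk : k ≤ 10) : revRows f k ∈ tables k := by
  induction k with
  | zero => simp [revRows, tables]
  | succ i ih =>
    refine mem_tables_succ i _ (ih (by omega)) _ (h3 i (by omega)) ?_
    obtain ⟨m, hm, hs⟩ := hseen (i + 1) hk
    have hs' : Nat.lor (f i) (seenMask (revRows f i)) = 2 ^ m - 1 := hs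
    simp only [rowOk, andB_iff, hs', Nat.beq_eq, Nat.ble_eq]
    refine ⟨?_, ?_, ?_⟩
    · apply Nat.eq_of_testBit_eq
      intro t
      have : (Nat.land (f i) (2 ^ (i + 1) - 1)).testBit t =
        (f i &&& (2 ^ (i + 1) - 1)).testBit t := rfl
      rw [this, testBit_backMask, Nat.testBit_and, Nat.testBit_two_pow_sub_one]
      rcases lt_trichotomy t i with h | rfl | h
      · simp [h, show t < i + 1 by omega, hsym i (by omega) t (by omega)]
      · simp [hirr t (by omega)]
      · simp [show ¬ t < i + 1 by omega, show ¬ t < i by omega]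
    · unfold lowBound
      split_ifs with h
      · exact Nat.zero_le _
      · have := Nat.pow_lt_pow_right (a := 2) (by norm_num) (hm (by omega))
        omega
    · have h1 : Nat.succ (2 ^ m - 1) = 2 ^ m := by
        have := Nat.two_pow_pos m
        omega
      rw [h1]
      apply Nat.eq_of_testBit_eq
      intro t
      have : (Nat.land (2 ^ m - 1) (2 ^ m)).testBit t = ((2 ^ m - 1) &&& 2 ^ m).testBit t := rfl
      rw [this, Nat.testBit_and, Nat.testBit_two_pow_sub_one, Nat.testBit_two_pow]
      by_cases h : t < m <;> simp [h]
      omega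

theorem allTwo_spec (l : List (List ℕ)) (m : List ℕ) (h : allTwo l m = true) (t : List ℕ)
    (ht : t ∈ l) : ∃ n, digitsOk n = true ∧ ∃ k, relabelOk t n (repRows k) = true := by
  induction l generalizing m with
  | nil => simp at ht
  | cons s l ih =>
    cases m with
    | nil => exact absurd h (by simp [allTwo])
    | cons n m =>
      have h' : andB (digitsOk n) (andB (relabelOk s n (repRows (Nat.div n 10000000000)))
        (allTwo l m)) = true := h
      rw [andB_iff, andB_iff] at h'
      rcases List.mem_cons.1 ht with rfl | ht
      · exact ⟨n, h'.1, _, h'.2.1⟩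
      · exact ih m h'.2.2 ht

theorem mem_tens {i : ℕ} (h : i < 10) : i ∈ tens := by
  unfold tens; interval_cases i <;> simp

theorem entry_revRows (f : ℕ → ℕ) {d : ℕ} (hd : d < 10) :
    entry (revRows f 10) (Nat.sub 9 d) = f d := by
  interval_cases d <;> rfl

theorem repRows_mem (k : ℕ) : ∃ R ∈ reps, R.rows = repRows k := by
  by_cases h : k < reps.length
  · exact ⟨reps[k], List.getElem_mem h, by simp [repRows, List.getD_eq_getElem?_getD, h]⟩
  · exact ⟨rep0, by simp [reps], by
      simp [repRows, List.getD_eq_getElem?_getD, List.getElem?_eq_none (not_lt.1 h)]⟩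

theorem digit_lt (n i : ℕ) : digit n i < 10 := Nat.mod_lt _ (by norm_num)

theorem table_relabel (f : ℕ → ℕ) (hf : revRows f 10 ∈ tables 10) :
    ∃ R ∈ reps, ∃ o : Fin 10 → Fin 10, Function.Injective o ∧
      ∀ i j : Fin 10, (entry R.rows i).testBit j = (f (o i)).testBit (o j) := by
  obtain ⟨n, hn, k, hk⟩ := allTwo_spec _ _ tables_relabel _ hf
  obtain ⟨R, hR, hRk⟩ := repRows_mem k
  refine ⟨R, hR, fun i => ⟨digit n i, digit_lt n i⟩, ?_, ?_⟩
  · intro i j hij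
    by_contra hne
    simp only [digitsOk, allL_iff, force_eq, orB_iff, notB_iff] at hn
    have := hn i (mem_tens i.2) j (mem_tens j.2)
    simp only [Fin.mk.injEq] at hij
    rw [hij] at this
    rcases this with h | h
    · exact hne (Fin.ext (by simpa using h))
    · simp at h
  · intro i j
    rw [hRk]
    simp only [relabelOk, allL_iff, force_eq, same_iff, tb_eq] at hk
    have := hk i (mem_tens i.2) j (mem_tens j.2)
    rw [entry_revRows f (digit_lt n i)] at this
    exact this

/-- Number of bits of a ten-bit mask. -/
def bitCount (r : ℕ) : ℕ := ((Finset.univ : Finset (Fin 10)).filter fun j : Fin 10 => r.testBit j.val = true).card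

theorem triple_mem : ∀ r : Fin 1024, bitCount r = 3 → (r : ℕ) ∈ tripleMasks := by
  decide +kernel

theorem six_mem : ∀ r : Fin 1024, bitCount r = 6 → (r : ℕ) ∈ sixMasks := by
  decide +kernel

theorem exists_bfs {α : Type*} [Fintype α] [DecidableEq α] (C : SimpleGraph α)
    (hc : C.Connected) (hcard : Fintype.card α = 10) :
    ∃ a₀ : α, ∃ L : List α, L.Nodup ∧ L.length = 10 ∧
      ∀ k ≤ 10, ∃ m ≤ L.length, (k < 10 → k < m) ∧ ∀ a, a ∈ L.take m ↔
        (a = a₀ ∨ ∃ i < k, ∃ b, L[i]? = some b ∧ C.Adj b a) := by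
  classical
  obtain ⟨a₀⟩ := hc.nonempty
  refine ⟨a₀, ?_⟩
  have key : ∀ k ≤ 10, ∃ L : List α, L.Nodup ∧ (k < 10 → k < L.length) ∧
      (∀ a, a ∈ L ↔ (a = a₀ ∨ ∃ i < k, ∃ b, L[i]? = some b ∧ C.Adj b a)) ∧
      ∀ k' ≤ k, ∃ m ≤ L.length, (k' < 10 → k' < m) ∧ ∀ a, a ∈ L.take m ↔
        (a = a₀ ∨ ∃ i < k', ∃ b, L[i]? = some b ∧ C.Adj b a) := by
    intro k
    induction k with
    | zero =>
      intro _
      refine ⟨[a₀], by simp, by simp, by simp, ?_⟩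
      intro k' hk'
      obtain rfl : k' = 0 := by omega
      exact ⟨1, by simp, by simp, by simp⟩
    | succ k ih =>
      intro hk
      obtain ⟨L, hnd, hlen, hmem, hpre⟩ := ih (by omega)
      have hkl : k < L.length := hlen (by omega)
      set v := L[k] with hv
      set N := (Finset.univ.filter fun a => C.Adj v a ∧ a ∉ L).toList with hN
      have hNm : ∀ a, a ∈ N ↔ C.Adj v a ∧ a ∉ L := by intro a; simp [hN]
      have hget : ∀ i, i < L.length → (L ++ N)[i]? = L[i]? := fun i hi =>
        List.getElem?_append_left hi
      have hnd' : (L ++ N).Nodup := by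
        rw [List.nodup_append']
        refine ⟨hnd, Finset.nodup_toList _, ?_⟩
        intro a ha ha'
        exact ((hNm a).1 ha').2 ha
      have hmem' : ∀ a, a ∈ L ++ N ↔
          (a = a₀ ∨ ∃ i < k + 1, ∃ b, (L ++ N)[i]? = some b ∧ C.Adj b a) := by
        intro a
        rw [List.mem_append, hNm, hmem]
        constructor
        · rintro ((h | ⟨i, hi, b, hb, hab⟩) | ⟨h, _⟩)
          · exact Or.inl h
          · exact Or.inr ⟨i, by omega, b, by rw [hget i (by omega)]; exact hb, hab⟩
          · exact Or.inr ⟨k, by omega, v, by rw [hget k hkl]; simp [hv, hkl], h⟩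
        · rintro (h | ⟨i, hi, b, hb, hab⟩)
          · exact Or.inl (Or.inl h)
          · rw [hget i (by omega)] at hb
            rcases Nat.lt_succ_iff_lt_or_eq.1 hi with hi | rfl
            · exact Or.inl (Or.inr ⟨i, hi, b, hb, hab⟩)
            · rw [List.getElem?_eq_getElem hkl] at hb
              have hbv : v = b := by simpa using hb
              subst hbv
              by_cases haL : a ∈ L
              · exact Or.inl ((hmem a).1 haL)
              · refine Or.inr ⟨hab, ?_⟩
                rwa [hmem] at haL
      have hlen' : k + 1 < 10 → k + 1 < (L ++ N).length := by
        intro hk1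
        by_contra hcon
        have hclosed : ∀ a ∈ L ++ N, ∀ b, C.Adj a b → b ∈ L ++ N := by
          intro a ha b hab
          obtain ⟨i, hi, rfl⟩ := List.mem_iff_getElem.1 ha
          exact (hmem' b).2 (Or.inr ⟨i, by omega, _, List.getElem?_eq_getElem hi, hab⟩)
        have hall : ∀ b, b ∈ L ++ N := by
          intro b
          obtain ⟨p⟩ := hc.preconnected a₀ b
          have : ∀ (u w : α) (p : C.Walk u w), u ∈ L ++ N → w ∈ L ++ N := by
            intro u w p
            induction p with
            | nil => exact id
            | cons h _ ih => exact fun hu => ih (hclosed _ hu _ h)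
          exact this _ _ p ((hmem' a₀).2 (Or.inl rfl))
        have h1 : (Finset.univ : Finset α) ⊆ (L ++ N).toFinset := fun b _ =>
          List.mem_toFinset.2 (hall b)
        have h2 := (Finset.card_le_card h1).trans (List.toFinset_card_le _)
        rw [Finset.card_univ, hcard] at h2
        omega
      refine ⟨L ++ N, hnd', hlen', hmem', ?_⟩
      intro k' hk'
      rcases Nat.le_succ_iff.1 hk' with hk' | rfl
      · obtain ⟨m, hm, hkm, hs⟩ := hpre k' hk'
        refine ⟨m, by rw [List.length_append]; omega, hkm, ?_⟩
        intro a
        rw [List.take_append_of_le_length hm, hs]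
        constructor
        · rintro (h | ⟨i, hi, b, hb, hab⟩)
          · exact Or.inl h
          · exact Or.inr ⟨i, hi, b, by rw [hget i (by omega)]; exact hb, hab⟩
        · rintro (h | ⟨i, hi, b, hb, hab⟩)
          · exact Or.inl h
          · exact Or.inr ⟨i, hi, b, by rw [← hget i (by omega)]; exact hb, hab⟩
      · exact ⟨(L ++ N).length, le_rfl, hlen', by rw [List.take_length]; exact hmem'⟩
  obtain ⟨L, hnd, -, -, hpre⟩ := key 10 le_rfl
  refine ⟨L, hnd, ?_, hpre⟩
  obtain ⟨m, hm, h9, -⟩ := hpre 9 (by norm_num)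
  have h1 := h9 (by norm_num)
  have h2 := List.Nodup.length_le_card hnd
  omega

theorem exists_labelling {α : Type*} [Fintype α] [DecidableEq α] (C : SimpleGraph α)
    [DecidableRel C.Adj] (hc : C.Connected) (hcard : Fintype.card α = 10)
    (hcub : ∀ v, C.degree v = 3) :
    ∃ R ∈ reps, ∃ e : Fin 10 → α, Function.Bijective e ∧
      ∀ i j : Fin 10, (entry R.rows i).testBit j = decide (C.Adj (e i) (e j)) := by
  obtain ⟨a₀, L, hnd, hlen, hpre⟩ := exists_bfs C hc hcard
  let e : Fin 10 → α := fun i => L[i.val]'(by omega)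
  have he : Function.Injective e := by
    intro i j hij
    exact Fin.ext ((List.Nodup.getElem_inj_iff hnd).1 hij)
  have hbij : Function.Bijective e :=
    (Fintype.bijective_iff_injective_and_card e).2 ⟨he, by simp [hcard]⟩
  let f : ℕ → ℕ := fun i => if h : i < 10 then
    Nat.ofBits (fun j : Fin 10 => decide (C.Adj (e ⟨i, h⟩) (e j))) else 0
  have hfi : ∀ i : Fin 10, f i = Nat.ofBits (fun j : Fin 10 => decide (C.Adj (e i) (e j))) := by
    intro i; simp [f]
  have hf : ∀ i j : Fin 10, (f i).testBit j = decide (C.Adj (e i) (e j)) := by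
    intro i j
    rw [hfi, Nat.testBit_ofBits_lt _ _ j.2]
  have hf' : ∀ i : Fin 10, ∀ j, 10 ≤ j → (f i).testBit j = false := by
    intro i j hj
    rw [hfi]
    apply Nat.testBit_lt_two_pow
    exact (Nat.ofBits_lt_two_pow _).trans_le (Nat.pow_le_pow_right (by norm_num) hj)
  have hmem : revRows f 10 ∈ tables 10 := by
    refine mem_tables f ?_ ?_ ?_ ?_ 10 le_rfl
    · intro i hi
      have hlt : f i < 1024 := by
        rw [hfi ⟨i, hi⟩]; exact Nat.ofBits_lt_two_pow _
      refine triple_mem ⟨f i, hlt⟩ ?_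
      rw [← hcub (e ⟨i, hi⟩), ← C.card_neighborFinset_eq_degree, bitCount]
      refine Finset.card_bij (fun j _ => e j) ?_ ?_ ?_
      · intro j hj
        have := hf ⟨i, hi⟩ j
        simp_all
      · intro j _ k _ h; exact he h
      · intro b hb
        obtain ⟨j, rfl⟩ := hbij.2 b
        refine ⟨j, ?_, rfl⟩
        have := hf ⟨i, hi⟩ j
        simp_all
    · intro i hi
      have := hf ⟨i, hi⟩ ⟨i, hi⟩
      simpa using this
    · intro i hi j hj
      have h1 := hf ⟨i, hi⟩ ⟨j, hj⟩
      have h2 := hf ⟨j, hj⟩ ⟨i, hi⟩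
      simp only at h1 h2
      rw [h1, h2]
      simp [C.adj_comm]
    · intro k hk
      obtain ⟨m, hm, hkm, hs⟩ := hpre k hk
      refine ⟨m, hkm, ?_⟩
      have h0 : e 0 = a₀ := by
        obtain ⟨m0, hm0, h0, hs0⟩ := hpre 0 (by norm_num)
        have : e 0 ∈ L.take m0 := by
          rw [List.mem_take_iff_getElem]
          exact ⟨0, by have := h0 (by norm_num); omega, rfl⟩
        simpa using (hs0 _).1 this
      apply Nat.eq_of_testBit_eq
      intro j
      rw [Bool.eq_iff_iff, testBit_seenMask, Nat.testBit_two_pow_sub_one, decide_eq_true_iff]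
      by_cases hj : j < 10
      · have h1 : e ⟨j, hj⟩ ∈ L.take m ↔ j < m := by
          rw [List.mem_take_iff_getElem]
          constructor
          · rintro ⟨i, hi, h⟩
            have hij : i = j := (List.Nodup.getElem_inj_iff hnd).1 h
            omega
          · intro h
            exact ⟨j, by omega, rfl⟩
        rw [← h1, hs]
        refine or_congr ?_ ?_
        · rw [← h0, he.eq_iff, Fin.ext_iff]; rfl
        · refine exists_congr fun i => and_congr_right fun hi => ?_
          have h2 := hf ⟨i, by omega⟩ ⟨j, hj⟩
          simp only at h2
          rw [h2, decide_eq_true_iff]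
          have h3 : L[i]? = some (e ⟨i, by omega⟩) := List.getElem?_eq_getElem (by omega)
          rw [h3]
          simp
      · constructor
        · rintro (h | ⟨i, hi, h⟩)
          · omega
          · rw [hf' ⟨i, by omega⟩ j (by omega)] at h
            simp at h
        · intro h; omega
  obtain ⟨R, hR, o, ho, h⟩ := table_relabel f hmem
  refine ⟨R, hR, e ∘ o, hbij.comp (Finite.injective_iff_bijective.1 ho), ?_⟩
  intro i j
  rw [h, hf]
  rfl

section Model

variable {V : Type*} (G : SimpleGraph V)

/-- There is an edge between the two sets. -/
def Touch (s t : Set V) : Prop := ∃ u ∈ s, ∃ v ∈ t, G.Adj u v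

/-- Union of the sets with index in the list. -/
def unionOf (F : ℕ → Set V) (b : List ℕ) : Set V := {y | ∃ v ∈ b, y ∈ F v}

variable {G}

theorem adjTest_mono {rows : List ℕ} {S i j : ℕ} (h : adjTest rows 0 i j = true) :
    adjTest rows S i j = true := by
  unfold adjTest at h ⊢
  have h0 : ∀ i, tb 0 i = false := by intro i; simp [tb_eq]
  rw [h0, h0] at h
  revert h
  cases Nat.beq i 11 <;> cases Nat.beq j 11 <;> simp

theorem nodupTest_spec (m : ℕ) (l : List ℕ) (h : nodupTest m l = true) :
    l.Nodup ∧ ∀ v ∈ l, v ≤ m := by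
  induction l with
  | nil => simp
  | cons v l ih =>
    have h' : andB (Nat.ble v m) (andB (allL (fun w => Bool.rec true false (Nat.beq v w)) l)
      (nodupTest m l)) = true := h
    rw [andB_iff, andB_iff, allL_iff] at h'
    obtain ⟨h1, h2, h3⟩ := h'
    obtain ⟨h4, h5⟩ := ih h3
    refine ⟨List.nodup_cons.2 ⟨?_, h4⟩, ?_⟩
    · intro hv
      have := notB_iff.1 (h2 v hv)
      simp at this
    · intro w hw
      rcases List.mem_cons.1 hw with rfl | hw
      · exact Nat.le_of_ble_eq_true h1
      · exact h5 w hw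

theorem touchTest_spec {F : ℕ → Set V} {rows : List ℕ} {S : ℕ} {b c : List ℕ}
    (hadj : ∀ i ∈ b, ∀ j ∈ c, adjTest rows S i j = true → Touch G (F i) (F j))
    (h : touchTest rows S b c = true) : Touch G (unionOf F b) (unionOf F c) := by
  simp only [touchTest, anyL_iff] at h
  obtain ⟨v, hv, w, hw, h⟩ := h
  obtain ⟨p, hp, q, hq, hpq⟩ := hadj v hv w hw h
  exact ⟨p, ⟨v, hv, hp⟩, q, ⟨w, hw, hq⟩, hpq⟩

theorem unionOf_cons (F : ℕ → Set V) (v : ℕ) (l : List ℕ) :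
    unionOf F (v :: l) = F v ∪ unionOf F l := by
  ext y; simp [unionOf]

theorem connTest_spec {F : ℕ → Set V} {rows : List ℕ} {S : ℕ} {b : List ℕ} (hnd : b.Nodup)
    (hF : ∀ v ∈ b, (G.induce (F v)).Connected)
    (hadj : ∀ i ∈ b, ∀ j ∈ b, i ≠ j → adjTest rows S i j = true → Touch G (F i) (F j))
    (h : connTest rows S b = true) : (G.induce (unionOf F b)).Connected := by
  induction b with
  | nil => simp [connTest] at h
  | cons v l ih =>
    cases l with
    | nil =>
      have : unionOf F [v] = F v := by ext y; simp [unionOf]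
      rw [this]
      exact hF v (by simp)
    | cons w k =>
      have h' : andB (anyL (adjTest rows S v) (w :: k)) (connTest rows S (w :: k)) = true := h
      rw [andB_iff, anyL_iff] at h'
      obtain ⟨⟨u, hu, hvu⟩, h2⟩ := h'
      have hnd' := List.nodup_cons.1 hnd
      have hc := ih hnd'.2 (fun v hv => hF v (List.mem_cons_of_mem _ hv))
        (fun i hi j hj => hadj i (List.mem_cons_of_mem _ hi) j (List.mem_cons_of_mem _ hj)) h2
      obtain ⟨p, hp, q, hq, hpq⟩ := hadj v (by simp) u (List.mem_cons_of_mem _ hu)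
        (fun h => hnd'.1 (h ▸ hu)) hvu
      rw [unionOf_cons]
      exact SimpleGraph.connected_induce_union (hF v (by simp)).preconnected hc.preconnected
        hp ⟨u, hu, hq⟩ hpq

theorem pairTest_spec {rows : List ℕ} {S : ℕ} {l : List (List ℕ)} (h : pairTest rows S l = true) :
    l.Pairwise fun b c => touchTest rows S b c = true := by
  induction l with
  | nil => simp
  | cons b l ih =>
    have h' : andB (allL (touchTest rows S b) l) (pairTest rows S l) = true := h
    rw [andB_iff, allL_iff] at h'
    exact List.pairwise_cons.2 ⟨h'.1, ih h'.2⟩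

theorem model_hasMinor {F : ℕ → Set V} {b c : List ℕ} {l : List (List ℕ)}
    (hFd : ∀ i ≤ 11, ∀ j ≤ 11, i ≠ j → Disjoint (F i) (F j))
    (hlen : l.length = 6) (hnd : (b ++ (c ++ l.flatten)).Nodup)
    (hle : ∀ v ∈ b ++ (c ++ l.flatten), v ≤ 11)
    (hconn : ∀ d ∈ b :: c :: l, (G.induce (unionOf F d)).Connected)
    (hb : ∀ d ∈ l, Touch G (unionOf F b) (unionOf F d))
    (hc : ∀ d ∈ l, Touch G (unionOf F c) (unionOf F d))
    (hl : l.Pairwise fun d d' => Touch G (unionOf F d) (unionOf F d')) :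
    G.HasMinor K8minus := by
  have hlen8 : (b :: c :: l).length = 8 := by simp [hlen]
  have hnd' : (b :: c :: l).flatten.Nodup := by simpa using hnd
  have hle' : ∀ v ∈ (b :: c :: l).flatten, v ≤ 11 := by simpa using hle
  have hdis : (b :: c :: l).Pairwise fun d d' => Disjoint (unionOf F d) (unionOf F d') := by
    refine ((List.nodup_flatten.1 hnd').2).imp_of_mem ?_
    intro d d' hd hd' hdd
    rw [Set.disjoint_left]
    rintro y ⟨v, hv, hy⟩ ⟨w, hw, hy'⟩
    have hvw : v ≠ w := fun h => hdd hv (h ▸ hw)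
    exact Set.disjoint_left.1 (hFd v (hle' v (List.mem_flatten.2 ⟨d, hd, hv⟩)) w
      (hle' w (List.mem_flatten.2 ⟨d', hd', hw⟩)) hvw) hy hy'
  have htouch : ∀ i j : ℕ, ∀ (hi : i < 8) (hj : j < 8), i < j → ¬ (i = 0 ∧ j = 1) →
      Touch G (unionOf F ((b :: c :: l)[i]'(by omega)))
        (unionOf F ((b :: c :: l)[j]'(by omega))) := by
    intro i j hi hj hij hne
    obtain ⟨j, rfl⟩ : ∃ k, j = k + 2 := ⟨j - 2, by omega⟩
    have hjl : j < l.length := by omega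
    match i, hi, hij with
    | 0, _, _ => exact hb _ (List.getElem_mem hjl)
    | 1, _, _ => exact hc _ (List.getElem_mem hjl)
    | i + 2, _, hij => exact List.pairwise_iff_getElem.1 hl i j (by omega) hjl (by omega)
  refine ⟨fun w => unionOf F ((b :: c :: l)[w.val]'(by omega)), ?_, ?_, ?_, ?_⟩
  · intro w
    obtain ⟨⟨y, hy⟩⟩ := (hconn _ (List.getElem_mem (by omega : w.val < (b :: c :: l).length))).nonempty
    exact ⟨y, hy⟩
  · intro w₁ w₂ hne
    rcases lt_or_gt_of_ne hne with h | h
    · exact List.pairwise_iff_getElem.1 hdis _ _ (by omega) (by omega) h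
    · exact (List.pairwise_iff_getElem.1 hdis _ _ (by omega) (by omega) h).symm
  · intro w
    exact hconn _ (List.getElem_mem _)
  · intro w₁ w₂ h
    have h' : w₁ ≠ w₂ ∧ ¬ ((w₁ = 0 ∧ w₂ = 1) ∨ (w₁ = 1 ∧ w₂ = 0)) := by
      simpa [K8minus, SimpleGraph.deleteEdges_adj] using h
    obtain ⟨hne, h01⟩ := h'
    rcases lt_or_gt_of_ne hne with h | h
    · exact htouch w₁ w₂ w₁.2 w₂.2 h (fun hh => h01 (Or.inl ⟨Fin.ext hh.1, Fin.ext hh.2⟩))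
    · obtain ⟨u, hu, v, hv, huv⟩ := htouch w₂ w₁ w₂.2 w₁.2 h
        (fun hh => h01 (Or.inr ⟨Fin.ext hh.2, Fin.ext hh.1⟩))
      exact ⟨v, hv, u, hu, huv.symm⟩

theorem rep_hasMinor {F : ℕ → Set V} {R : CubicRep} (hR : R ∈ reps) {S : ℕ} (hS : S ∈ sixMasks)
    (hFc : ∀ i ≤ 11, (G.induce (F i)).Connected)
    (hFd : ∀ i ≤ 11, ∀ j ≤ 11, i ≠ j → Disjoint (F i) (F j))
    (hadj : ∀ i ≤ 11, ∀ j ≤ 11, i ≠ j → adjTest R.rows S i j = true → Touch G (F i) (F j)) :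
    G.HasMinor K8minus := by
  have hchk := List.all_eq_true.1 reps_check R hR
  simp only [repTest, andB_iff, allL_iff, orB_iff, anyL_iff] at hchk
  obtain ⟨hroots, hsix⟩ := hchk
  rcases hsix S hS with ⟨l, hl, hit⟩ | ⟨M, -, hM⟩
  · have hroot := hroots l hl
    simp only [rootTest, andB_iff, allL_iff] at hroot
    obtain ⟨hp, hcn, hlen, hnd⟩ := hroot
    obtain ⟨hnd, hle⟩ := nodupTest_spec _ _ hnd
    simp only [hitTest, allL_iff, anyL_iff] at hit
    have hle1 : ∀ d ∈ l, ∀ v ∈ d, v ≤ 9 := fun d hd v hv => hle v (List.mem_flatten.2 ⟨d, hd, hv⟩)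
    have hndd := List.nodup_flatten.1 hnd
    have hone : ∀ v, unionOf F [v] = F v := by intro v; ext y; simp [unionOf]
    have hconn : ∀ d ∈ l, (G.induce (unionOf F d)).Connected := fun d hd =>
      connTest_spec (hndd.1 d hd) (fun v hv => hFc v (by have := hle1 d hd v hv; omega))
        (fun i hi j hj hne h => hadj i (by have := hle1 d hd i hi; omega) j
          (by have := hle1 d hd j hj; omega) hne (adjTest_mono h)) (hcn d hd)
    have hhit : ∀ d ∈ l, ∃ v ∈ d, v ≤ 9 ∧ S.testBit v = true := by
      intro d hd
      obtain ⟨v, hv, h⟩ := hit d hd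
      exact ⟨v, hv, hle1 d hd v hv, by rw [← tb_eq]; exact h⟩
    refine model_hasMinor (F := F) (b := [10]) (c := [11]) (l := l) hFd (Nat.eq_of_beq_eq_true hlen)
      ?_ ?_ ?_ ?_ ?_ ?_
    · simp only [List.cons_append, List.nil_append, List.nodup_cons, List.mem_cons]
      refine ⟨?_, ?_, hnd⟩
      · rintro (h | h)
        · omega
        · have := hle _ h; omega
      · intro h
        have := hle _ h; omega
    · intro v hv
      simp only [List.cons_append, List.nil_append, List.mem_cons] at hv
      rcases hv with rfl | rfl | h
      · omega
      · omega
      · have := hle _ h; omega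
    · intro d hd
      rcases List.mem_cons.1 hd with rfl | hd
      · rw [hone]; exact hFc _ (by omega)
      rcases List.mem_cons.1 hd with rfl | hd
      · rw [hone]; exact hFc _ (by omega)
      exact hconn d hd
    · intro d hd
      obtain ⟨v, hv, hv9, -⟩ := hhit d hd
      obtain ⟨p, hp, q, hq, hpq⟩ := hadj 10 (by omega) v (by omega) (by omega) (by
        have h1 : Nat.beq v 11 = false := K8Proof.natBeq_false (by omega)
        simp [adjTest, h1]
        rfl)
      exact ⟨p, ⟨10, by simp, hp⟩, q, ⟨v, hv, hq⟩, hpq⟩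
    · intro d hd
      obtain ⟨v, hv, hv9, hvS⟩ := hhit d hd
      obtain ⟨p, hp, q, hq, hpq⟩ := hadj 11 (by omega) v (by omega) (by omega) (by
        simp [adjTest, tb_eq, hvS])
      exact ⟨p, ⟨11, by simp, hp⟩, q, ⟨v, hv, hq⟩, hpq⟩
    · refine ((pairTest_spec hp).and hndd.2).imp_of_mem ?_
      intro d d' hd hd' h
      refine touchTest_spec (fun i hi j hj ht => hadj i ?_ j ?_ ?_ (adjTest_mono ht)) h.1
      · have := hle1 d hd i hi; omega
      · have := hle1 d' hd' j hj; omega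
      · exact fun hij => h.2 hi (hij ▸ hj)
  · simp only [modelTest, andB_iff, allL_iff] at hM
    obtain ⟨hb, hc, hp, hcn, hlen, hnd⟩ := hM
    obtain ⟨hnd, hle⟩ := nodupTest_spec _ _ hnd
    have hnd' : (M.head :: M.second :: M.rest).flatten.Nodup := by simpa using hnd
    have hle' : ∀ d ∈ M.head :: M.second :: M.rest, ∀ v ∈ d, v ≤ 11 := by
      intro d hd v hv
      have : ∀ v ∈ (M.head :: M.second :: M.rest).flatten, v ≤ 11 := by simpa using hle
      exact this v (List.mem_flatten.2 ⟨d, hd, hv⟩)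
    have hndd := List.nodup_flatten.1 hnd'
    have htt : ∀ d ∈ M.head :: M.second :: M.rest, ∀ d' ∈ M.head :: M.second :: M.rest,
        List.Disjoint d d' → touchTest R.rows S d d' = true →
          Touch G (unionOf F d) (unionOf F d') := by
      intro d hd d' hd' hdis h
      exact touchTest_spec (fun i hi j hj ht => hadj i (hle' d hd i hi) j (hle' d' hd' j hj)
        (fun hij => hdis hi (hij ▸ hj)) ht) h
    have hdis := hndd.2
    rw [List.pairwise_cons, List.pairwise_cons] at hdis
    refine model_hasMinor (F := F) (b := M.head) (c := M.second) (l := M.rest) hFd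
      (Nat.eq_of_beq_eq_true hlen) hnd hle ?_ ?_ ?_ ?_
    · intro d hd
      exact connTest_spec (hndd.1 d hd) (fun v hv => hFc v (hle' d hd v hv))
        (fun i hi j hj hne h => hadj i (hle' d hd i hi) j (hle' d hd j hj) hne h) (hcn d hd)
    · intro d hd
      exact htt _ (by simp) d (by simp [hd]) (hdis.1 d (by simp [hd])) (hb d hd)
    · intro d hd
      exact htt _ (by simp) d (by simp [hd]) (hdis.2.1 d hd) (hc d hd)
    · refine ((pairTest_spec hp).and hdis.2.2).imp_of_mem ?_
      intro d d' hd hd' h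
      exact htt d (by simp [hd]) d' (by simp [hd']) h.2 h.1

/-- A walk that ends outside `D` and meets `D` has a last vertex in `D`. -/
theorem exists_exit (D : Set V) {u z : V} (p : G.Walk u z) (hz : z ∉ D) :
    (∀ v ∈ p.support, v ∉ D) ∨ ∃ s w : V, ∃ q : G.Walk w z, s ∈ p.support ∧ s ∈ D ∧ G.Adj s w ∧
      (∀ v ∈ q.support, v ∉ D) ∧ ∀ v ∈ q.support, v ∈ p.support := by
  induction p with
  | nil => left; simpa using hz
  | @cons a b c h p ih =>
    rcases ih hz with ih | ⟨s, w, q, h1, h2, h3, h4, h5⟩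
    · by_cases ha : a ∈ D
      · exact Or.inr ⟨a, b, p, by simp, ha, h, ih, fun v hv => by simp [hv]⟩
      · left
        intro v hv
        rw [SimpleGraph.Walk.support_cons, List.mem_cons] at hv
        rcases hv with rfl | hv
        · exact ha
        · exact ih v hv
    · exact Or.inr ⟨s, w, q, by simp [h1], h2, h3, h4, fun v hv => by simp [h5 v hv]⟩

end Model

end K8Proof


/-- Suppose `G` has a vertex `x` of degree 10 whose neighbourhood graph has a connected
cubic complement, and there is a vertex `z` outside the closed neighbourhood of `x`
together with six pairwise internally vertex-disjoint `x`–`z` paths.  Then `G` has a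
`K₈⁻` minor. -/
theorem cubic_complement_neighborhood_six_paths_hasMinor_K8minus
    {V : Type*} [Fintype V] [DecidableEq V] (G : SimpleGraph V) [DecidableRel G.Adj]
    (x : V) (hx : G.degree x = 10)
    (hconn : ((G.induce (G.neighborSet x))ᶜ).Connected)
    (hcubic : ∀ v : G.neighborSet x, ((G.induce (G.neighborSet x))ᶜ).degree v = 3)
    (z : V) (hz : z ∉ insert x (G.neighborSet x))
    (P : Fin 6 → G.Walk x z) (hP : ∀ i, (P i).IsPath)
    (hdisj : ∀ i j, i ≠ j →
      ∀ v, v ∈ (P i).support → v ∈ (P j).support → v = x ∨ v = z) :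
    G.HasMinor K8minus := by
  classical
  have hcard : Fintype.card (G.neighborSet x) = 10 := by
    rw [SimpleGraph.card_neighborSet_eq_degree, hx]
  obtain ⟨R, hR, e, he, hrows⟩ := K8Proof.exists_labelling ((G.induce (G.neighborSet x))ᶜ) hconn hcard
    (fun v => by convert hcubic v)
  have hexit : ∀ i, ∃ s w : V, ∃ q : G.Walk w z, s ∈ (P i).support ∧
      s ∈ insert x (G.neighborSet x) ∧ G.Adj s w ∧
      (∀ v ∈ q.support, v ∉ insert x (G.neighborSet x)) ∧ ∀ v ∈ q.support, v ∈ (P i).support := by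
    intro i
    rcases K8Proof.exists_exit (insert x (G.neighborSet x)) (P i) hz with h | h
    · exact absurd (Set.mem_insert x _) (h x (SimpleGraph.Walk.start_mem_support _))
    · exact h
  choose s w q hsP hsD hsw hqD hqP using hexit
  have hsN : ∀ i, s i ∈ G.neighborSet x := by
    intro i
    rcases hsD i with h | h
    · exfalso
      refine hqD i (w i) (SimpleGraph.Walk.start_mem_support _) (Or.inr ?_)
      have := hsw i
      rw [h] at this
      exact this
    · exact h
  have hsinj : Function.Injective s := by
    intro i j hij
    by_contra hne
    rcases hdisj i j hne (s i) (hsP i) (hij ▸ hsP j) with h | h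
    · have := hsN i
      rw [h] at this
      exact G.irrefl this
    · exact hz (h ▸ Or.inr (hsN i))
  let Z : Set V := {v | ∃ i, v ∈ (q i).support}
  have hZD : ∀ v ∈ Z, v ∉ insert x (G.neighborSet x) := by
    rintro v ⟨i, hv⟩
    exact hqD i v hv
  have hZconn : (G.induce Z).Connected := by
    refine SimpleGraph.induce_connected_of_patches z ⟨0, SimpleGraph.Walk.end_mem_support _⟩ ?_
    rintro v ⟨i, hv⟩
    exact ⟨{v | v ∈ (q i).support}, fun y hy => ⟨i, hy⟩, SimpleGraph.Walk.end_mem_support _, hv,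
      (SimpleGraph.Walk.connected_induce_support (q i)).preconnected _ _⟩
  let S : ℕ := Nat.ofBits (fun j : Fin 10 => decide (∃ i, s i = (e j : V)))
  have hSbit : ∀ j : Fin 10, S.testBit j = decide (∃ i, s i = (e j : V)) := fun j =>
    Nat.testBit_ofBits_lt _ _ j.2
  have hSlt : S < 2 ^ 10 := Nat.ofBits_lt_two_pow _
  have hS : S ∈ K8Proof.sixMasks := by
    refine K8Proof.six_mem ⟨S, hSlt⟩ ?_
    have h6 : (Finset.univ : Finset (Fin 6)).card = 6 := by simp
    rw [← h6, K8Proof.bitCount]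
    symm
    choose g hg using fun i => he.2 ⟨s i, hsN i⟩
    refine Finset.card_bij (fun i _ => g i) ?_ ?_ ?_
    · intro i _
      simp only [Finset.mem_filter, Finset.mem_univ, true_and]
      rw [hSbit, decide_eq_true_iff]
      exact ⟨i, by rw [hg]⟩
    · intro i _ j _ h
      apply hsinj
      have := hg i
      rw [h, hg] at this
      exact (congrArg Subtype.val this).symm
    · intro j hj
      simp only [Finset.mem_filter, Finset.mem_univ, true_and] at hj
      rw [hSbit, decide_eq_true_iff] at hj
      obtain ⟨i, hi⟩ := hj
      refine ⟨i, Finset.mem_univ _, ?_⟩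
      apply he.1
      rw [hg]
      exact Subtype.ext hi
  let F : ℕ → Set V := fun i => if h : i < 10 then {(e ⟨i, h⟩ : V)} else if i = 10 then {x} else Z
  have hF1 : ∀ i (h : i < 10), F i = {(e ⟨i, h⟩ : V)} := by intro i h; simp [F, h]
  have hF10 : F 10 = {x} := by simp [F]
  have hF11 : F 11 = Z := by simp [F]
  have hcases : ∀ i ≤ 11, i < 10 ∨ i = 10 ∨ i = 11 := by intro i hi; omega
  have hsing : ∀ v : V, (G.induce ({v} : Set V)).Connected := by
    intro v
    have : Nonempty ({v} : Set V) := ⟨⟨v, rfl⟩⟩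
    have : Subsingleton ({v} : Set V) := by
      constructor
      rintro ⟨a, rfl⟩ ⟨b, rfl⟩
      rfl
    exact ⟨SimpleGraph.Preconnected.of_subsingleton⟩
  have hxe : ∀ j, G.Adj x (e j : V) := fun j => (e j).2
  have hSZ : ∀ j (h : j < 10), S.testBit j = true → K8Proof.Touch G Z (F j) := by
    intro j h hj
    have h1 := hSbit ⟨j, h⟩
    simp only at h1
    rw [h1, decide_eq_true_iff] at hj
    obtain ⟨i, hi⟩ := hj
    refine ⟨w i, ⟨i, SimpleGraph.Walk.start_mem_support _⟩, _, by rw [hF1 j h]; rfl, ?_⟩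
    rw [← hi]
    exact (hsw i).symm
  have hSbig : ∀ j, 10 ≤ j → S.testBit j = false := fun j hj =>
    Nat.testBit_lt_two_pow (hSlt.trans_le (Nat.pow_le_pow_right (by norm_num) hj))
  have hsymm : ∀ A B : Set V, K8Proof.Touch G A B → K8Proof.Touch G B A := by
    rintro A B ⟨u, hu, v, hv, h⟩
    exact ⟨v, hv, u, hu, h.symm⟩
  have hxT : ∀ j, j < 10 → K8Proof.Touch G (F 10) (F j) := by
    intro j h
    rw [hF10, hF1 j h]
    exact ⟨x, rfl, _, rfl, hxe _⟩
  refine K8Proof.rep_hasMinor (F := F) hR hS ?_ ?_ ?_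
  · intro i hi
    rcases hcases i hi with h | rfl | rfl
    · rw [hF1 i h]; exact hsing _
    · rw [hF10]; exact hsing _
    · rw [hF11]; exact hZconn
  · have hd : ∀ i ≤ 11, ∀ j ≤ 11, i < j → Disjoint (F i) (F j) := by
      intro i hi j hj hij
      rcases hcases i hi with h | rfl | rfl
      · rw [hF1 i h, Set.disjoint_singleton_left]
        rcases hcases j hj with h' | rfl | rfl
        · rw [hF1 j h', Set.mem_singleton_iff]
          intro hh
          have := congrArg Fin.val (he.1 (Subtype.ext hh))
          simp only at this
          omega
        · rw [hF10, Set.mem_singleton_iff]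
          exact (hxe _).ne'
        · rw [hF11]
          exact fun hh => hZD _ hh (Or.inr (hxe _))
      · obtain rfl : j = 11 := by omega
        rw [hF10, hF11, Set.disjoint_singleton_left]
        exact fun hh => hZD _ hh (Set.mem_insert x _)
      · omega
    intro i hi j hj hne
    rcases lt_or_gt_of_ne hne with h | h
    · exact hd i hi j hj h
    · exact (hd j hj i hi h).symm
  · intro i hi j hj hne h
    rcases hcases i hi with h1 | rfl | rfl
    · have e1 : Nat.beq i 11 = false := K8Proof.natBeq_false (by omega)
      have e2 : Nat.beq i 10 = false := K8Proof.natBeq_false (by omega)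
      rcases hcases j hj with h2 | rfl | rfl
      · have e3 : Nat.beq j 11 = false := K8Proof.natBeq_false (by omega)
        have e4 : Nat.beq j 10 = false := K8Proof.natBeq_false (by omega)
        simp only [K8Proof.adjTest, e1, e2, e3, e4, K8Proof.notB_iff, K8Proof.tb_eq] at h
        have h3 := hrows ⟨i, h1⟩ ⟨j, h2⟩
        simp only at h3
        rw [h3, decide_eq_false_iff_not, SimpleGraph.compl_adj] at h
        have hne' : e ⟨i, h1⟩ ≠ e ⟨j, h2⟩ := fun hh => hne (congrArg Fin.val (he.1 hh))
        have h4 : G.Adj (e ⟨i, h1⟩ : V) (e ⟨j, h2⟩ : V) := by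
          by_contra h5
          exact h ⟨hne', h5⟩
        rw [hF1 i h1, hF1 j h2]
        exact ⟨_, rfl, _, rfl, h4⟩
      · exact hsymm _ _ (hxT i h1)
      · simp only [K8Proof.adjTest, e1, K8Proof.tb_eq] at h
        rw [hF11]
        exact hsymm _ _ (hSZ i h1 (by simpa using h))
    · rcases hcases j hj with h2 | rfl | rfl
      · exact hxT j h2
      · exact absurd rfl hne
      · simp [K8Proof.adjTest, K8Proof.tb_eq, hSbig] at h
    · rcases hcases j hj with h2 | rfl | rfl
      · rw [hF11]
        exact hSZ j h2 (by simpa [K8Proof.adjTest, K8Proof.tb_eq] using h)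
      · simp [K8Proof.adjTest, K8Proof.tb_eq, hSbig] at h
      · exact absurd rfl hne
end

section
/- Suppose G is a double-critical 8-chromatic graph with minimum degree 10 that contains a vertex x of degree 10 such that the subgraph G_x induced by the neighbourhood of x contains no vertex whose degree in G_x equals 9. Then G contains a minor isomorphic to the complete graph on 8 vertices with one edge removed. -/
/-- A connected graph `G` with chromatic number `k` is *double-critical* if for every
edge `uv` of `G`, deleting both `u` and `v` yields a graph that is `(k-2)`-colourable. -/
def SimpleGraph.DoubleCritical {V : Type*} (G : SimpleGraph V) (k : ℕ) : Prop :=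
  G.Connected ∧ G.chromaticNumber = k ∧
    ∀ u v : V, G.Adj u v →
      (G.induce ({u, v}ᶜ : Set V)).chromaticNumber ≤ (k - 2 : ℕ)

namespace DC

/-- Index pairs of the seven branch sets of a template. -/
def idxPairs : List (ℕ × ℕ) :=
  [(3, 4), (3, 5), (3, 6), (4, 5), (4, 6), (5, 6), (0, 3), (0, 4), (0, 5), (0, 6), (1, 3), (1, 4), (1, 5), (1, 6), (2, 3), (2, 4), (2, 5), (2, 6), (0, 1), (0, 2), (1, 2)]

/-- A template: seven branch sets, each a pair of labels (a singleton if the labels agree).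
Those in `libA` are used during the search. -/
def libA : List (List (ℕ × ℕ)) := [
  [(0, 9), (3, 5), (4, 6), (1, 1), (2, 2), (7, 7), (8, 8)],
  [(0, 9), (3, 4), (5, 6), (1, 1), (2, 2), (7, 7), (8, 8)],
  [(1, 7), (2, 8), (3, 6), (0, 0), (4, 4), (5, 5), (9, 9)],
  [(1, 8), (2, 4), (3, 9), (0, 0), (5, 5), (6, 6), (7, 7)],
  [(0, 9), (2, 3), (4, 5), (1, 1), (6, 6), (7, 7), (8, 8)],
  [(1, 8), (2, 9), (3, 4), (0, 0), (5, 5), (6, 6), (7, 7)],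
  [(1, 6), (2, 8), (3, 7), (0, 0), (4, 4), (5, 5), (9, 9)],
  [(1, 7), (2, 8), (3, 9), (0, 0), (4, 4), (5, 5), (6, 6)],
  [(1, 7), (2, 9), (3, 5), (0, 0), (4, 4), (6, 6), (8, 8)],
  [(0, 8), (2, 3), (4, 9), (1, 1), (5, 5), (6, 6), (7, 7)],
  [(0, 9), (4, 8), (5, 7), (1, 1), (2, 2), (3, 3), (6, 6)],
  [(0, 9), (4, 7), (5, 8), (1, 1), (2, 2), (3, 3), (6, 6)],
  [(1, 8), (2, 7), (4, 5), (0, 0), (3, 3), (6, 6), (9, 9)],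
  [(1, 8), (2, 4), (3, 5), (0, 0), (6, 6), (7, 7), (9, 9)],
  [(2, 5), (3, 4), (6, 7), (0, 0), (1, 1), (8, 8), (9, 9)],
  [(1, 6), (2, 8), (3, 4), (0, 0), (5, 5), (7, 7), (9, 9)],
  [(0, 9), (1, 6), (7, 8), (2, 2), (3, 3), (4, 4), (5, 5)],
  [(0, 9), (1, 2), (3, 8), (4, 4), (5, 5), (6, 6), (7, 7)],
  [(0, 4), (1, 7), (6, 8), (2, 2), (3, 3), (5, 5), (9, 9)],
  [(1, 6), (2, 7), (3, 8), (0, 0), (4, 4), (5, 5), (9, 9)],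
  [(1, 8), (2, 9), (3, 6), (0, 0), (4, 4), (5, 5), (7, 7)],
  [(1, 6), (3, 7), (4, 5), (0, 0), (2, 2), (8, 8), (9, 9)],
  [(0, 8), (1, 2), (7, 9), (3, 3), (4, 4), (5, 5), (6, 6)],
  [(1, 9), (2, 8), (5, 6), (0, 0), (3, 3), (4, 4), (7, 7)],
  [(1, 9), (2, 8), (4, 6), (0, 0), (3, 3), (5, 5), (7, 7)],
  [(0, 8), (1, 3), (6, 9), (2, 2), (4, 4), (5, 5), (7, 7)],
  [(1, 9), (2, 7), (3, 5), (0, 0), (4, 4), (6, 6), (8, 8)],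
  [(1, 9), (2, 8), (5, 7), (0, 0), (3, 3), (4, 4), (6, 6)],
  [(1, 9), (2, 8), (4, 7), (0, 0), (3, 3), (5, 5), (6, 6)],
  [(0, 9), (3, 4), (5, 7), (1, 1), (2, 2), (6, 6), (8, 8)],
  [(0, 9), (3, 5), (4, 7), (1, 1), (2, 2), (6, 6), (8, 8)],
  [(0, 7), (2, 8), (5, 9), (1, 1), (3, 3), (4, 4), (6, 6)],
  [(0, 7), (2, 9), (5, 8), (1, 1), (3, 3), (4, 4), (6, 6)],
  [(0, 7), (2, 8), (4, 9), (1, 1), (3, 3), (5, 5), (6, 6)],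
  [(0, 7), (2, 9), (4, 8), (1, 1), (3, 3), (5, 5), (6, 6)]]

/-- Templates used for the Petersen graph minus an edge. -/
def libB : List (List (ℕ × ℕ)) := [
  [(1, 6), (3, 7), (8, 9), (0, 0), (2, 2), (4, 4), (5, 5)],
  [(0, 6), (1, 2), (8, 9), (3, 3), (4, 4), (5, 5), (7, 7)],
  [(1, 8), (2, 9), (4, 5), (0, 0), (3, 3), (6, 6), (7, 7)],
  [(1, 9), (2, 8), (4, 5), (0, 0), (3, 3), (6, 6), (7, 7)],
  [(1, 3), (2, 9), (6, 7), (0, 0), (4, 4), (5, 5), (8, 8)],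
  [(1, 9), (2, 8), (6, 7), (0, 0), (3, 3), (4, 4), (5, 5)],
  [(1, 7), (3, 6), (8, 9), (0, 0), (2, 2), (4, 4), (5, 5)]]

/-- The bit of the ordered pair `(i, k)` in a 10 by 10 bit matrix. -/
def bitM (i k : ℕ) : ℕ := Nat.shiftLeft 1 (Nat.add (Nat.mul 10 i) k)

/-- The `i`-th pair of a template. -/
def part (t : List (ℕ × ℕ)) (i : ℕ) : ℕ × ℕ := t.getD i (0, 0)

/-- All bits between two pairs. -/
def badMask (p q : ℕ × ℕ) : ℕ :=
  bitM p.1 q.1 ||| bitM p.1 q.2 ||| bitM p.2 q.1 ||| bitM p.2 q.2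

/-- The bits inside the proper pairs of a template. -/
def connMask : List (ℕ × ℕ) → ℕ
  | [] => 0
  | p :: t => (if p.1 = p.2 then 0 else bitM p.1 p.2) ||| connMask t

/-- The mask data of a template. -/
def masks (t : List (ℕ × ℕ)) : ℕ × List ℕ :=
  (connMask t, idxPairs.map fun q => badMask (part t q.1) (part t q.2))

/-- Precomputed masks of `libA`. -/
def maskA : List (ℕ × List ℕ) := [
  (70403103916544, [4096, 131072, 262144, 134217728, 268435456, 302231454903657293676544, 2475880078570760549798248450, 4951760157141521099596496900, 158456325028528675187087900800, 316912650057057350374175801600, 2251801961168896, 4503603922337792, 144115325514809344, 288230651029618688, 2305845208236949504, 4611690416473899008, 147574093327164768256, 295148186654329536512, 49517601571415210995964969000, 99035203142830421991929938000, 90072078446755840]),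
  (72057611217797632, [4096, 131072, 262144, 134217728, 268435456, 302231454903657293676544, 2475880078570760549798248450, 4951760157141521099596496900, 158456325028528675187087900800, 316912650057057350374175801600, 2201170739200, 4402341478400, 140874927308800, 281749854617600, 2308094809027379200, 4616189618054758400, 147718067777752268800, 295436135555504537600, 29710560942849126597578981400, 118842243771396506390315925600, 105656195481600]),
  (68988043264, [16, 32, 512, 35184372088832, 562949953421312, 576460752303423488, 1180591620717411304448, 18889465931478580871168, 37778931862957161742336, 604462909807314587877376, 1208925819614629175754752, 19342813113834066812076032, 38685626227668133624152064, 618970019642690137986433024, 1152921505680588800, 18446744090889420800, 36893488181778841600, 590295810908461465600, 306953821386526939156480, 85002596691653613920256, 87042659012253300654342144]),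
  (549772853248, [32, 64, 128, 72057594037927936, 144115188075855872, 147573952589676412928, 1208925819614629174707200, 38685626227668133590630400, 77371252455336267181260800, 154742504910672534362521600, 1099512676352, 35184405643264, 70368811286528, 140737622573056, 1237940039285380275972866048, 39614081257132168831131713536, 79228162514264337662263427072, 158456325028528675324526854144, 24178516392292583494144000, 628641426199607170847744000, 571746591703040]),
  (35184380477952, [65536, 131072, 262144, 147573952589676412928, 295147905179352825856, 302231454903657293676544, 2475880078570760549798248450, 79228162514264337593543950400, 158456325028528675187087900800, 316912650057057350374175801600, 2149580800, 68786585600, 137573171200, 275146342400, 2253998836940800, 72127962782105600, 144255925564211200, 288511851128422400, 14855280471424563298789490700, 59421121885698253195157962800, 51589939200]),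
  (17717002240, [32, 64, 128, 72057594037927936, 144115188075855872, 147573952589676412928, 1208925819614629174707200, 38685626227668133590630400, 77371252455336267181260800, 154742504910672534362521600, 1237940039285380274900172800, 39614081257132168796805529600, 79228162514264337593611059200, 158456325028528675187222118400, 1100585369600, 35218731827200, 70437463654400, 140874927308800, 623805722921148654148915200, 29014219670751100192972800, 29710560942849126597604147200]),
  (137707454464, [16, 32, 512, 35184372088832, 562949953421312, 576460752303423488, 1152921504606848000, 18446744073709568000, 36893488147419136000, 590295810358706176000, 1208925819614629175754752, 19342813113834066812076032, 38685626227668133624152064, 618970019642690137986433024, 1180591620718485045248, 18889465931495760723968, 37778931862991521447936, 604462909807864343166976, 299759591197780480000, 156797324626531328000, 164413911467589567902646272]),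
  (550024380416, [16, 32, 64, 35184372088832, 70368744177664, 72057594037927936, 1180591620717411304448, 18889465931478580871168, 37778931862957161742336, 75557863725914323484672, 1208925819614629175754752, 19342813113834066812076032, 38685626227668133624152064, 77371252455336267248304128, 1237940039285380275972866048, 19807040628566084415565856768, 39614081257132168831131713536, 79228162514264337662263427072, 306953821386526939156480, 613907642773053878312960, 628641426199607171392471040]),
  (34896740352, [16, 64, 256, 70368744177664, 281474976710656, 295147905179352825856, 1180591620717411304448, 18889465931478580871168, 75557863725914323484672, 302231454903657293938688, 1237940039285380274900172800, 19807040628566084398402764800, 79228162514264337593611059200, 316912650057057350374444236800, 1125900980584448, 18014415689351168, 72057662757404672, 288230651029618688, 609185276290184233095168, 47223664828696452177920, 49517601571415210996006912000]),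
  (562949961810176, [32768, 65536, 131072, 72057594037927936, 144115188075855872, 147573952589676412928, 2417851639229258349412354, 38685626227668133590597664, 77371252455336267181195328, 154742504910672534362390656, 2149580800, 34393292800, 68786585600, 137573171200, 2475880078570762748821504000, 39614081257132203981144064000, 79228162514264407962288128000, 158456325028528815924576256000, 14507109835375550096474124, 638312832756524204244861456, 567489331200]),
  (144396663052567040, [4096, 8192, 65536, 8388608, 67108864, 68719476736, 2475880078570760549798248450, 4951760157141521099596496900, 9903520314283042199192993800, 79228162514264337593543950400, 2417851639231457372667904, 4835703278462914745335808, 9671406556925829490671616, 77371252455406635925372928, 2361185493234636292096, 4722370986469272584192, 9444741972938545168384, 75557935783508361347072, 336719690685623434772561789200, 198070406285660843983859876000, 193428131138516589813432320]),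
  (288371113640067584, [4096, 8192, 65536, 8388608, 67108864, 68719476736, 2475880078570760549798248450, 4951760157141521099596496900, 9903520314283042199192993800, 79228162514264337593543950400, 2361183243633845862400, 4722366487267691724800, 9444732974535383449600, 75557863796283067596800, 2417851641481058163097600, 4835703282962116326195200, 9671406565924232652390400, 77371252527393861219123200, 178263365657094759585473888400, 356526731314189519170947776800, 340010387083273804185600]),
  (35184506568704, [8, 64, 512, 68719476736, 549755813888, 590295810358705651712, 1208925819614629174707200, 9671406556917033397657600, 77371252455336267181260800, 618970019642690137450086400, 1180591620717412352000, 9444732965739298816000, 75557863725914390528000, 604462909807315124224000, 1126999418470400, 9015995347763200, 72127962782105600, 577023702256844800, 159578208189131051061350400, 58028439341502200385945600, 56668397794435792896000]),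
  (34376777728, [64, 128, 512, 147573952589676412928, 590295810358705651712, 604462909807314587353088, 1208925819614629174707200, 77371252455336267181260800, 154742504910672534362521600, 618970019642690137450086400, 1099512676352, 70368811286528, 140737622573056, 562950490292224, 1125900980584448, 72057662757404672, 144115325514809344, 576461302059237376, 24178516392292583494144000, 48357032784585166988288000, 43980507054080]),
  (147573952606889836544, [2, 256, 512, 262144, 524288, 618970019642690137449562112, 1125899907891200, 2251799815782400, 288230376420147200, 576460752840294400, 1100585369600, 2201170739200, 281749854617600, 563499709235200, 1181744542222018150400, 2363489084444036300800, 302526602808836646502400, 605053205617673293004800, 27021597789388800, 216172782315110400, 211312390963200]),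
  (17448370176, [32, 128, 512, 144115188075855872, 576460752303423488, 604462909807314587353088, 1152921504606848000, 36893488147419136000, 147573952589676544000, 590295810358706176000, 1208925819614629175754752, 38685626227668133624152064, 154742504910672534496608256, 618970019642690137986433024, 1100585369600, 35218731827200, 140874927308800, 563499709235200, 299759591197780480000, 27670116110564352000, 29014219670751100218114048]),
  (302231454903657293742592, [8388608, 16777216, 33554432, 17179869184, 34359738368, 35184372088832, 4951760157141521099596496900, 9903520314283042199192993800, 19807040628566084398385987600, 39614081257132168796771975200, 4611686018427392000, 9223372036854784000, 18446744073709568000, 36893488147419136000, 4840425644941386344038400, 9680851289882772688076800, 19361702579765545376153600, 38723405159531090752307200, 81704042592835098143342198850, 475368975085586025561263702400, 442721857769029632000]),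
  (274877911552, [35184372088832, 70368744177664, 140737488355328, 72057594037927936, 144115188075855872, 147573952589676412928, 19807040628566084398385987600, 39614081257132168796771975200, 79228162514264337593543950400, 158456325028528675187087900800, 16793600, 33587200, 67174400, 134348800, 19342813113834083975168000, 38685626227668167950336000, 77371252455336335900672000, 154742504910672671801344000, 7427640235712281649394745350, 326816170371340392573368795400, 277094400]),
  (295147905179352956944, [8388608, 33554432, 536870912, 34359738368, 549755813888, 576460752303423488, 4398046511108, 8796093022216, 35184372088864, 562949953421824, 4722366482869645217792, 9444732965739290435584, 37778931862957161742336, 604462909807314587877376, 4835707890144535126212608, 9671415780289070252425216, 38685663121156281009700864, 618970609938500496155213824, 142936511611010, 351843720888640, 377789318629571617423360]),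
  (275012190208, [16, 32, 512, 35184372088832, 562949953421312, 576460752303423488, 1152921504606848000, 18446744073709568000, 36893488147419136000, 590295810358706176000, 1180591620717412352000, 18889465931478597632000, 37778931862957195264000, 604462909807315124224000, 1208925819614630248448000, 19342813113834083975168000, 38685626227668167950336000, 618970019642690687205376000, 152185638608103936000, 304371277216207872000, 311676187869396860928000]),
  (69256609792, [16, 32, 128, 35184372088832, 140737488355328, 144115188075855872, 1208925819614629174707200, 19342813113834066795315200, 38685626227668133590630400, 154742504910672534362521600, 1237940039285380274900172800, 19807040628566084398402764800, 39614081257132168796805529600, 158456325028528675187222118400, 1152921505680588800, 18446744090889420800, 36893488181778841600, 147573952727115366400, 623805722921148654148915200, 87042659012253300578918400, 89131682828547379792812441600]),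
  (35321811107840, [4, 256, 512, 268435456, 536870912, 618970019642690137449562112, 1152921504606848000, 4611686018427392000, 295147905179353088000, 590295810358706176000, 1180591620718485045248, 4722366482873940180992, 302231454903932171583488, 604462909807864343166976, 1126999418470400, 4507997673881600, 288511851128422400, 577023702256844800, 156797324626531328000, 55340232221128704000, 56668397794487282171904]),
  (604462909807314587357440, [17179869184, 34359738368, 68719476736, 35184372088832, 70368744177664, 72057594037927936, 9671406556917033397649416, 19342813113834066795298832, 38685626227668133590597664, 77371252455336267181195328, 8396800, 16793600, 33587200, 67174400, 9903529759016007938483421184, 19807059518032015876966842368, 39614119036064031753933684736, 79228238072128063507867369472, 7253554917687775048237062, 773712524553362671811953280, 671744000]),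
  (72057594306887680, [8, 16, 128, 17179869184, 137438953472, 140737488355328, 1237940039285380274899125248, 9903520314283042199193001984, 19807040628566084398386003968, 158456325028528675187088031744, 1208925819614629175754752, 9671406556917033406038016, 19342813113834066812076032, 154742504910672534496608256, 1154047404513689600, 9232379236109516800, 18464758472219033600, 147718067777752268800, 321864410214198871473772564480, 118842243771396506390316023808, 116056878683004400872456192]),
  (70369013137408, [8, 32, 128, 34359738368, 137438953472, 144115188075855872, 1237940039285380274899125248, 9903520314283042199193001984, 39614081257132168796772007936, 158456325028528675187088031744, 1208925819614629175754752, 9671406556917033406038016, 38685626227668133624152064, 154742504910672534496608256, 1152922604118474752, 9223380832947798016, 36893523331791192064, 147574093327164768256, 321864410214198871473772564480, 99035203142830421991930019840, 96714065569170334060380160]),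
  (590295810358705660160, [16777216, 33554432, 134217728, 35184372088832, 140737488355328, 144115188075855872, 4835703278458516698824708, 19342813113834066795298832, 38685626227668133590597664, 154742504910672534362390656, 4294971392, 17179885568, 34359771136, 137439084544, 4951760161753207118023884800, 19807040647012828472095539200, 39614081294025656944191078400, 158456325176102627776764313600, 12089258196146291747061770, 696341272098026404630757952, 618475880448]),
  (34494480384, [16, 64, 256, 70368744177664, 281474976710656, 295147905179352825856, 1237940039285380274899125248, 19807040628566084398386003968, 79228162514264337593544015872, 316912650057057350374176063488, 1180591620717412352000, 18889465931478597632000, 75557863725914390528000, 302231454903657562112000, 1125900980584448, 18014415689351168, 72057662757404672, 288230651029618688, 163408085185670196286684532736, 49517601571415210995965009920, 47223664828696494080000]),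
  (144115188344815616, [8, 16, 64, 17179869184, 68719476736, 70368744177664, 1237940039285380274899125248, 9903520314283042199193001984, 19807040628566084398386003968, 79228162514264337593544015872, 1208925819614629175754752, 9671406556917033406038016, 19342813113834066812076032, 77371252455336267248304128, 1180592746617318146048, 9444741972938545168384, 18889483945877090336768, 75557935783508361347072, 321864410214198871473772564480, 198070406285660843983860039680, 193428131138340668120760320]),
  (140737757315072, [8, 32, 64, 34359738368, 68719476736, 72057594037927936, 1237940039285380274899125248, 9903520314283042199193001984, 39614081257132168796772007936, 79228162514264337593544015872, 1208925819614629175754752, 9671406556917033406038016, 38685626227668133624152064, 77371252455336267248304128, 1180591621816922931200, 9444732974535383449600, 37778931898141533798400, 75557863796283067596800, 321864410214198871473772564480, 178263365657094759585474035712, 174085318024506601308684288]),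
  (144115205255725568, [4096, 65536, 262144, 67108864, 268435456, 295147905179352825856, 2475880078570760549798248450, 4951760157141521099596496900, 79228162514264337593543950400, 316912650057057350374175801600, 2201170739200, 4402341478400, 70437463654400, 281749854617600, 2361185493234636292096, 4722370986469272584192, 75557935783508361347072, 302231743134033445388288, 29710560942849126597578981400, 198070406285660843983859876000, 176093659136000]),
  (140771848094208, [4096, 65536, 262144, 67108864, 268435456, 295147905179352825856, 2475880078570760549798248450, 4951760157141521099596496900, 79228162514264337593543950400, 316912650057057350374175801600, 2251801961168896, 4503603922337792, 72057662757404672, 288230651029618688, 2361183243633845862400, 4722366487267691724800, 75557863796283067596800, 302231455185132270387200, 49517601571415210995964969000, 178263365657094759585473888400, 162129741204160512]),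
  (576460752571859072, [8192, 16384, 65536, 17179869184, 68719476736, 70368744177664, 2361183241434822606850, 9444732965739290427400, 18889465931478580854800, 75557863725914323419200, 2417851639229258351509504, 9671406556917033406038016, 19342813113834066812076032, 77371252455336267248304128, 2475880078573012349611933696, 9903520314292049398447734784, 19807040628584098796895469568, 79228162514336395187581878272, 306953821386526938890500, 642241841670271749063200, 657655645870358271610585088]),
  (288230376688582784, [8192, 16384, 65536, 17179869184, 68719476736, 70368744177664, 2361183241434822606850, 9444732965739290427400, 18889465931478580854800, 75557863725914323419200, 2475880078570760549800345600, 9903520314283042199201382400, 19807040628566084398402764800, 79228162514264337593611059200, 2417851641481058163097600, 9671406565924232652390400, 19342813131848465304780800, 77371252527393861219123200, 609185276290184232567300, 340010386766614455386400, 356526731314189519171249766400]),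
  (562950221856896, [8192, 32768, 65536, 34359738368, 68719476736, 72057594037927936, 2361183241434822606850, 9444732965739290427400, 37778931862957161709600, 75557863725914323419200, 2417851639229258351509504, 9671406556917033406038016, 38685626227668133624152064, 77371252455336267248304128, 2475880078570762748821504000, 9903520314283050995286016000, 39614081257132203981144064000, 79228162514264407962288128000, 306953821386526938890500, 623352375738793168208400, 638312832756524204798509056]),
  (281475513581696, [8192, 32768, 65536, 34359738368, 68719476736, 72057594037927936, 2361183241434822606850, 9444732965739290427400, 37778931862957161709600, 75557863725914323419200, 2475880078570760549800345600, 9903520314283042199201382400, 39614081257132168796805529600, 79228162514264337593611059200, 2417851639231457372667904, 9671406556925829490671616, 38685626227703317962686464, 77371252455406635925372928, 609185276290184232567300, 321120920835135874531600, 336719690685623434772847001600])]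

/-- Precomputed masks of `libB`. -/
def maskB : List (ℕ × List ℕ) := [
  (618970019642690274888581120, [4, 16, 32, 16777216, 33554432, 35184372088832, 1152921504606848000, 4611686018427392000, 18446744073709568000, 36893488147419136000, 1180591620718485045248, 4722366482873940180992, 18889465931495760723968, 37778931862991521447936, 1239148965104994904073830400, 4956595860419979616295321600, 19826383441679918465181286400, 39652766883359836930362572800, 156797324626531328000, 885443715538059264000, 906694364711796514750464]),
  (618970019642690137449566272, [17179869184, 34359738368, 137438953472, 35184372088832, 140737488355328, 144115188075855872, 9223372036854775816, 18446744073709551632, 36893488147419103264, 147573952589676413056, 8396800, 16793600, 33587200, 134348800, 9913191720839959232590643200, 19826383441679918465181286400, 39652766883359836930362572800, 158611067533439347721450291200, 6917529027641081862, 885443715538058478336, 806092800]),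
  (35184909221888, [8, 64, 128, 68719476736, 137438953472, 147573952589676412928, 1208925819614629174707200, 9671406556917033397657600, 77371252455336267181260800, 154742504910672534362521600, 1237940039285380274900172800, 9903520314283042199201382400, 79228162514264337593611059200, 158456325028528675187222118400, 1126999418470400, 9015995347763200, 72127962782105600, 144255925564211200, 623805722921148654148915200, 58028439341502200385945600, 59421121885698253195208294400]),
  (35184641048576, [8, 64, 128, 68719476736, 137438953472, 147573952589676412928, 1237940039285380274899125248, 9903520314283042199193001984, 79228162514264337593544015872, 158456325028528675187088031744, 1208925819614629175754752, 9671406556917033406038016, 77371252455336267248304128, 154742504910672534496608256, 1126999418470400, 9015995347763200, 72127962782105600, 144255925564211200, 321864410214198871473772564480, 59421121885698253195158011904, 58028439341502200436228096]),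
  (147573952590213292032, [16, 32, 256, 35184372088832, 281474976710656, 288230376151711744, 1073742848, 17179885568, 34359771136, 274878169088, 1237940039285380274900172800, 19807040628566084398402764800, 39614081257132168796805529600, 316912650057057350374444236800, 1181744542222018150400, 18907912675552290406400, 37815825351104580812800, 302526602808836646502400, 554051309568, 206158626816, 237684487542793012780833177600]),
  (147573952589945372672, [8, 16, 32, 17179869184, 34359738368, 35184372088832, 1237940039285380274899125248, 9903520314283042199193001984, 19807040628566084398386003968, 39614081257132168796772007936, 1208925819614629175754752, 9671406556917033406038016, 19342813113834066812076032, 38685626227668133624152064, 1181744542222018150400, 9453956337776145203200, 18907912675552290406400, 37815825351104580812800, 321864410214198871473772564480, 237684487542793012780632047616, 232113757366008801744912384]),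
  (618970019642690206169169920, [4, 16, 32, 16777216, 33554432, 35184372088832, 1180591620717411304448, 4722366482869645217792, 18889465931478580871168, 37778931862957161742336, 1152921505680588800, 4611686022722355200, 18446744090889420800, 36893488181778841600, 1239148965104994904073830400, 4956595860419979616295321600, 19826383441679918465181286400, 39652766883359836930362572800, 85002596691653613920256, 906694364710971881816064, 885443716362692198400])]

theorem maskA_eq : maskA = libA.map masks := by decide +kernel

theorem maskB_eq : maskB = libB.map masks := by decide +kernel

/-- The initial matrix of possible edges: everything off the diagonal. -/
def F0 : ℕ := 633515663914742881158342637566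

/-- No mask of the list is contained in `F`. -/
noncomputable def noneBad (F : ℕ) (l : List ℕ) : Bool :=
  List.rec (motive := fun _ => Bool) true
    (fun m _ ih => cond (Nat.beq (Nat.land F m) m) false ih) l

/-- At most one mask of the list is contained in `F`. -/
noncomputable def atMostOneBad (F : ℕ) (l : List ℕ) : Bool :=
  List.rec (motive := fun _ => Bool) true
    (fun m l ih => cond (Nat.beq (Nat.land F m) m) (noneBad F l) ih) l

/-- Does the template with the given masks work when all edges lie in `F`? -/
noncomputable def testT (F : ℕ) (c : ℕ × List ℕ) : Bool :=
  cond (Nat.beq (Nat.land F c.1) 0) (atMostOneBad F c.2) false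

/-- Does some template of the list work? -/
noncomputable def testL (F : ℕ) (l : List (ℕ × List ℕ)) : Bool :=
  List.rec (motive := fun _ => Bool) false (fun c _ ih => cond (testT F c) true ih) l

/-- Row `i` of a bit matrix. -/
def row (E i : ℕ) : ℕ := Nat.land (Nat.shiftRight E (Nat.mul 10 i)) 1023

/-- Remove the lowest bit. -/
def drop1 (x : ℕ) : ℕ := Nat.land x (Nat.pred x)

/-- Row `i` has at least four bits. -/
def deg4 (E i : ℕ) : Bool := cond (Nat.beq (drop1 (drop1 (drop1 (row E i)))) 0) false true

/-- Row `i` has at most one bit. -/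
def degLow (F i : ℕ) : Bool := Nat.beq (drop1 (row F i)) 0

/-- The neighbourhood condition fails at `a` with respect to its neighbour `w`. -/
def viol (E F a w : ℕ) : Bool :=
  cond (Nat.testBit E (Nat.add (Nat.mul 10 a) w))
    (Nat.beq (Nat.land (row F a) (Nat.lor (row E w) (Nat.shiftLeft 1 w))) (row F a)) false

/-- The neighbourhood condition fails for some pair involving `v` and a smaller label. -/
noncomputable def violAny (E F v : ℕ) (n : ℕ) : Bool :=
  Nat.rec (motive := fun _ => Bool) false
    (fun w ih => cond (viol E F v w) true (cond (viol E F w v) true ih)) n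

/-- Both bits of an unordered pair. -/
def sbit (i k : ℕ) : ℕ := Nat.lor (bitM i k) (bitM k i)

/-- Add an edge. -/
def addE (E i k : ℕ) : ℕ := Nat.lor E (sbit i k)

/-- Delete an edge. -/
def delE (F i k : ℕ) : ℕ := Nat.xor F (Nat.land F (sbit i k))

/-- Delete all edges from `v` to labels `10 - n, ..., 9`. -/
noncomputable def clearFrom (F v n : ℕ) : ℕ :=
  Nat.rec (motive := fun _ => ℕ) F (fun m ih => delE ih v (Nat.sub 9 m)) n

/-- After deletion of any possible edge `(i, k)`, some template of `libB` works. -/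
def petersenCheck (F : ℕ) (is ks : List ℕ) (f : ℕ → Bool) : Bool :=
  is.all fun i => ks.all fun k =>
    !(Nat.testBit F (10 * i + k)) || f (delE F i k)

/-- Force evaluation of a number. -/
noncomputable def force (x : ℕ) (k : ℕ → Bool) : Bool :=
  Nat.rec (motive := fun _ => Bool) (k 0) (fun n _ => k (Nat.succ n)) x

/-- What happens when row `v` is complete. -/
noncomputable def done (rec : ℕ → ℕ → ℕ → ℕ → ℕ → Bool) (v nxt E F : ℕ) : Bool :=
  cond (degLow F v) true
  (cond (violAny E F v v) true
  (cond (cond (Nat.ble 5 v) (testL F maskA) false) true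
  (cond (Nat.ble 9 v)
    (petersenCheck F (List.range 10) (List.range 10) (fun F' => testL F' maskB))
    (cond (Nat.ble nxt (Nat.succ v))
      (rec (Nat.add v 1) (Nat.add v 2) (Nat.add v 2) E F)
      (rec (Nat.add v 1) (Nat.add v 2) nxt E F)))))

/-- The search. -/
noncomputable def search (fuel : ℕ) : ℕ → ℕ → ℕ → ℕ → ℕ → Bool :=
  Nat.rec (motive := fun _ => ℕ → ℕ → ℕ → ℕ → ℕ → Bool) (fun _ _ _ _ _ => false)
    (fun _ ih v j nxt E F =>
      cond (Nat.ble nxt j)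
        (cond (force (clearFrom F v (Nat.sub 10 nxt)) (fun F' => done ih v nxt E F'))
          (cond (Nat.ble 10 nxt) true
            (force (addE E v nxt) fun E' =>
              cond (deg4 E' v) true (ih v (Nat.add nxt 1) (Nat.add nxt 1) E' F))) false)
        (cond (force (delE F v j) fun F' => ih v (Nat.add j 1) nxt E F')
          (force (addE E v j) fun E' =>
            cond (deg4 E' v) true (cond (deg4 E' j) true (ih v (Nat.add j 1) nxt E' F))) false))
    fuel

theorem search_true : search 100 0 1 1 0 F0 = true := by decide +kernel

/-- A partition certificate for a `K₇⁻` minor in the complement of `H`. -/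
def HasPart {W : Type*} (N : Set W) (H : W → W → Prop) : Prop :=
  ∃ p : ℕ → W × W, ∃ q : ℕ × ℕ,
    (∀ i < 7, (p i).1 ∈ N ∧ (p i).2 ∈ N ∧ ((p i).1 ≠ (p i).2 → ¬ H (p i).1 (p i).2)) ∧
    (∀ i < 7, ∀ j < 7, i ≠ j → (p i).1 ≠ (p j).1 ∧ (p i).1 ≠ (p j).2 ∧
      (p i).2 ≠ (p j).1 ∧ (p i).2 ≠ (p j).2) ∧
    (∀ i j, i < j → j < 7 → (i, j) ≠ q →
      ¬ H (p i).1 (p j).1 ∨ ¬ H (p i).1 (p j).2 ∨ ¬ H (p i).2 (p j).1 ∨ ¬ H (p i).2 (p j).2)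

theorem noneBad_spec {α : Type*} (F : ℕ) (g : α → ℕ) (l : List α)
    (h : noneBad F (l.map g) = true) : ∀ a ∈ l, F &&& g a ≠ g a := by
  induction l with
  | nil => simp
  | cons b l ih =>
    have h' : cond (Nat.beq (Nat.land F (g b)) (g b)) false (noneBad F (l.map g)) = true := h
    rcases hb : Nat.beq (Nat.land F (g b)) (g b) with _ | _
    · rw [hb] at h'
      intro a ha
      rcases List.mem_cons.1 ha with rfl | ha
      · exact Nat.ne_of_beq_eq_false hb
      · exact ih h' a ha
    · rw [hb] at h'; simp at h'

theorem atMostOneBad_spec {α : Type*} [Inhabited α] (F : ℕ) (g : α → ℕ) (l : List α)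
    (h : atMostOneBad F (l.map g) = true) : ∃ q, ∀ a ∈ l, a ≠ q → F &&& g a ≠ g a := by
  induction l with
  | nil => exact ⟨default, by simp⟩
  | cons b l ih =>
    have h' : cond (Nat.beq (Nat.land F (g b)) (g b)) (noneBad F (l.map g))
      (atMostOneBad F (l.map g)) = true := h
    rcases hb : Nat.beq (Nat.land F (g b)) (g b) with _ | _
    · rw [hb] at h'
      obtain ⟨q, hq⟩ := ih h'
      refine ⟨q, fun a ha haq => ?_⟩
      rcases List.mem_cons.1 ha with rfl | ha
      · exact Nat.ne_of_beq_eq_false hb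
      · exact hq a ha haq
    · rw [hb] at h'
      refine ⟨b, fun a ha hab => ?_⟩
      rcases List.mem_cons.1 ha with rfl | ha
      · exact absurd rfl hab
      · exact noneBad_spec F g l h' a ha

theorem testL_spec (F : ℕ) (l : List (ℕ × List ℕ)) (h : testL F l = true) :
    ∃ c ∈ l, testT F c = true := by
  induction l with
  | nil => exact absurd h (by simp [testL])
  | cons b l ih =>
    have h' : cond (testT F b) true (testL F l) = true := h
    rcases hb : testT F b with _ | _
    · rw [hb] at h'
      obtain ⟨c, hc, h2⟩ := ih h'
      exact ⟨c, List.mem_cons_of_mem _ hc, h2⟩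
    · exact ⟨b, List.mem_cons_self, hb⟩

theorem bitM_eq (i k : ℕ) : bitM i k = 2 ^ (10 * i + k) := by
  change 1 <<< (10 * i + k) = _
  simp [Nat.shiftLeft_eq]

theorem testBit_bitM (i k n : ℕ) : (bitM i k).testBit n = decide (10 * i + k = n) := by
  rw [bitM_eq, Nat.testBit_two_pow]

theorem connMask_spec (F : ℕ) (t : List (ℕ × ℕ)) (h : F &&& connMask t = 0) :
    ∀ p ∈ t, p.1 ≠ p.2 → F.testBit (10 * p.1 + p.2) = false := by
  induction t with
  | nil => simp
  | cons b t ih =>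
    intro p hp hne
    have hb : ∀ n, (F &&& connMask (b :: t)).testBit n = false := by
      intro n; rw [h]; simp
    simp only [connMask, Nat.testBit_and, Nat.testBit_or] at hb
    rcases List.mem_cons.1 hp with rfl | hp
    · have := hb (10 * p.1 + p.2)
      simpa [hne, testBit_bitM] using this
    · refine ih ?_ p hp hne
      apply Nat.eq_of_testBit_eq
      intro n
      have := hb n
      simp only [Nat.testBit_and, Nat.zero_testBit]
      revert this
      cases F.testBit n <;> simp

theorem badMask_spec (F : ℕ) (p q : ℕ × ℕ) (h : F &&& badMask p q ≠ badMask p q) :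
    F.testBit (10 * p.1 + q.1) = false ∨ F.testBit (10 * p.1 + q.2) = false ∨
    F.testBit (10 * p.2 + q.1) = false ∨ F.testBit (10 * p.2 + q.2) = false := by
  by_contra hc
  push Not at hc
  simp only [ne_eq, Bool.not_eq_false] at hc
  apply h
  apply Nat.eq_of_testBit_eq
  intro n
  simp only [badMask, Nat.testBit_and, Nat.testBit_or, testBit_bitM]
  by_cases hn : F.testBit n = true
  · simp [hn]
  · have : ∀ m, F.testBit m = true → m ≠ n := fun m hm e => hn (e ▸ hm)
    simp [this _ hc.1, this _ hc.2.1, this _ hc.2.2.1, this _ hc.2.2.2]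

/-- Well-formedness of a template. -/
def goodT (t : List (ℕ × ℕ)) : Bool :=
  t.length == 7 && (t.all fun p => decide (p.1 < 10) && decide (p.2 < 10)) &&
  (List.range 7).all fun i => (List.range 7).all fun j =>
    i == j || ((part t i).1 != (part t j).1 && (part t i).1 != (part t j).2 &&
      (part t i).2 != (part t j).1 && (part t i).2 != (part t j).2)

theorem goodA : ∀ t ∈ libA, goodT t = true := by decide +kernel

theorem goodB : ∀ t ∈ libB, goodT t = true := by decide +kernel

theorem idx_mem : ∀ j < 7, ∀ i < j, (i, j) ∈ idxPairs := by decide +kernel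

theorem hasPart_of_test {W : Type*} (N : Set W) (H : W → W → Prop) (f : ℕ → W) (F : ℕ)
    (fN : ∀ i < 10, f i ∈ N) (finj : ∀ i < 10, ∀ k < 10, f i = f k → i = k)
    (hF : ∀ i < 10, ∀ k < 10, F.testBit (10 * i + k) = false → ¬ H (f i) (f k))
    (t : List (ℕ × ℕ)) (ht : goodT t = true) (h : testT F (masks t) = true) : HasPart N H := by
  have h1 : Nat.beq (Nat.land F (connMask t)) 0 = true ∧
      atMostOneBad F (idxPairs.map fun q => badMask (part t q.1) (part t q.2)) = true := by
    have h' : cond (Nat.beq (Nat.land F (connMask t)) 0)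
      (atMostOneBad F (idxPairs.map fun q => badMask (part t q.1) (part t q.2))) false = true := h
    rcases hb : Nat.beq (Nat.land F (connMask t)) 0 with _ | _
    · rw [hb] at h'; simp at h'
    · rw [hb] at h'; exact ⟨rfl, h'⟩
  obtain ⟨hc, hbad⟩ := h1
  have hc : F &&& connMask t = 0 := Nat.eq_of_beq_eq_true hc
  obtain ⟨q, hq⟩ := atMostOneBad_spec F _ _ hbad
  simp only [goodT, Bool.and_eq_true, beq_iff_eq, List.all_eq_true, decide_eq_true_eq,
    List.mem_range, Bool.or_eq_true, bne_iff_ne] at ht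
  obtain ⟨⟨hlen, hlt⟩, hdis⟩ := ht
  have hmem : ∀ i < 7, part t i ∈ t := by
    intro i hi
    have : i < t.length := by omega
    rw [part, List.getD_eq_getElem _ _ this]
    exact List.getElem_mem _
  have hl := fun i hi => hlt _ (hmem i hi)
  refine ⟨fun i => (f (part t i).1, f (part t i).2), q, ?_, ?_, ?_⟩
  · intro i hi
    refine ⟨fN _ (hl i hi).1, fN _ (hl i hi).2, fun hne => ?_⟩
    refine hF _ (hl i hi).1 _ (hl i hi).2 (connMask_spec F t hc _ (hmem i hi) ?_)
    intro e; exact hne (by simp [e])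
  · intro i hi j hj hij
    obtain ⟨⟨⟨a, b⟩, c⟩, d⟩ := (hdis i hi j hj).resolve_left hij
    have hi' := hl i hi
    have hj' := hl j hj
    exact ⟨fun e => a (finj _ hi'.1 _ hj'.1 e), fun e => b (finj _ hi'.1 _ hj'.2 e),
      fun e => c (finj _ hi'.2 _ hj'.1 e), fun e => d (finj _ hi'.2 _ hj'.2 e)⟩
  · intro i j hij hj hne
    have hi' := hl i (by omega)
    have hj' := hl j hj
    rcases badMask_spec F _ _ (hq (i, j) (idx_mem j hj i hij) hne) with h | h | h | h
    · exact Or.inl (hF _ hi'.1 _ hj'.1 h)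
    · exact Or.inr (Or.inl (hF _ hi'.1 _ hj'.2 h))
    · exact Or.inr (Or.inr (Or.inl (hF _ hi'.2 _ hj'.1 h)))
    · exact Or.inr (Or.inr (Or.inr (hF _ hi'.2 _ hj'.2 h)))

theorem hasPart_of_testL {W : Type*} (N : Set W) (H : W → W → Prop) (f : ℕ → W) (F : ℕ)
    (fN : ∀ i < 10, f i ∈ N) (finj : ∀ i < 10, ∀ k < 10, f i = f k → i = k)
    (hF : ∀ i < 10, ∀ k < 10, F.testBit (10 * i + k) = false → ¬ H (f i) (f k))
    (l : List (List (ℕ × ℕ))) (m : List (ℕ × List ℕ)) (hm : m = l.map masks)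
    (hl : ∀ t ∈ l, goodT t = true) (h : testL F m = true) : HasPart N H := by
  obtain ⟨c, hc, h2⟩ := testL_spec F m h
  rw [hm] at hc
  obtain ⟨t, ht, rfl⟩ := List.mem_map.1 hc
  exact hasPart_of_test N H f F fN finj hF t (hl t ht) h2

theorem testBit_row (E i k : ℕ) (hk : k < 10) : (row E i).testBit k = E.testBit (10 * i + k) := by
  change ((E >>> (10 * i)) &&& 1023).testBit k = _
  have : (1023 : ℕ).testBit k = true := by
    rw [show (1023 : ℕ) = 2 ^ 10 - 1 by norm_num, Nat.testBit_two_pow_sub_one]; simpa using hk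
  rw [Nat.testBit_and, this, Nat.testBit_shiftRight, Bool.and_true]

theorem row_lt (E i : ℕ) : row E i < 1024 := by
  change (E >>> (10 * i)) &&& 1023 < 1024
  exact lt_of_le_of_lt Nat.and_le_right (by norm_num)

theorem pop4 : ∀ x < 1024, drop1 (drop1 (drop1 x)) ≠ 0 →
    4 ≤ ((Finset.range 10).filter fun k => x.testBit k = true).card := by decide +kernel

theorem pop1 : ∀ x < 1024, drop1 x = 0 →
    ((Finset.range 10).filter fun k => x.testBit k = true).card ≤ 1 := by decide +kernel

theorem idx_inj {a b i k : ℕ} (hb : b < 10) (hk : k < 10) (h : 10 * a + b = 10 * i + k) :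
    a = i ∧ b = k := by omega

theorem testBit_addE (E a b i k : ℕ) (hb : b < 10) (ha : a < 10) (hk : k < 10) :
    (addE E a b).testBit (10 * i + k) = true ↔
      E.testBit (10 * i + k) = true ∨ (i = a ∧ k = b) ∨ (i = b ∧ k = a) := by
  change (E ||| (bitM a b ||| bitM b a)).testBit _ = true ↔ _
  simp only [Nat.testBit_or, testBit_bitM, Bool.or_eq_true, decide_eq_true_eq]
  constructor
  · rintro (h | h | h)
    · exact Or.inl h
    · right; left; omega
    · right; right; omega
  · rintro (h | ⟨rfl, rfl⟩ | ⟨rfl, rfl⟩) <;> simp_all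

theorem testBit_delE (F a b i k : ℕ) (hb : b < 10) (ha : a < 10) (hk : k < 10) :
    (delE F a b).testBit (10 * i + k) = false ↔
      F.testBit (10 * i + k) = false ∨ (i = a ∧ k = b) ∨ (i = b ∧ k = a) := by
  change (F ^^^ (F &&& (bitM a b ||| bitM b a))).testBit _ = false ↔ _
  have e1 : (10 * a + b = 10 * i + k) ↔ (i = a ∧ k = b) := by omega
  have e2 : (10 * b + a = 10 * i + k) ↔ (i = b ∧ k = a) := by omega
  simp only [Nat.testBit_or, Nat.testBit_and, Nat.testBit_xor, testBit_bitM, e1, e2]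
  cases F.testBit (10 * i + k) <;> simp [imp_iff_or_not]; tauto

theorem force_eq (x : ℕ) (k : ℕ → Bool) : force x k = k x := by
  cases x <;> rfl

theorem testBit_clearFrom (F v n i k : ℕ) (hn : n ≤ 10) (hv : v < 10) (hk : k < 10) :
    (clearFrom F v n).testBit (10 * i + k) = false ↔
      F.testBit (10 * i + k) = false ∨ (i = v ∧ 10 ≤ k + n) ∨
        (k = v ∧ 10 ≤ i + n ∧ i < 10) := by
  induction n with
  | zero =>
    change F.testBit _ = false ↔ _
    constructor
    · exact Or.inl
    · rintro (h | h | h)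
      · exact h
      · omega
      · omega
  | succ m ih =>
    change (delE (clearFrom F v m) v (9 - m)).testBit _ = false ↔ _
    rw [testBit_delE _ _ _ _ _ (by omega) hv hk, ih (by omega)]
    constructor
    · rintro ((h | h | h) | h | h)
      · exact Or.inl h
      · right; left; omega
      · right; right; omega
      · right; left; omega
      · right; right; omega
    · rintro (h | h | h)
      · exact Or.inl (Or.inl h)
      · by_cases k = 9 - m
        · right; left; omega
        · left; right; left; omega
      · by_cases i = 9 - m
        · right; right; omega
        · left; right; right; omega

section Sound

variable {W : Type*} (N : Finset W) (H : W → W → Prop)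

/-- The local hypotheses on the graph `H` on `N`. -/
structure Hyp : Prop where
  symm : ∀ a b, H a b → H b a
  irr : ∀ a, ¬ H a a
  deg_le : ∀ y ∈ N, ∀ S ⊆ N, (∀ z ∈ S, H y z) → S.card ≤ 3
  deg_ge : ∀ y ∈ N, ∃ z ∈ N, H y z
  nbh : ∀ a ∈ N, ∀ w ∈ N, H a w → ∃ c ∈ N, c ≠ w ∧ H a c ∧ ¬ H c w

/-- `f` labels `N` by `0, ..., 9`. -/
structure Lab (f : ℕ → W) : Prop where
  mem : ∀ i < 10, f i ∈ N
  inj : ∀ i < 10, ∀ k < 10, f i = f k → i = k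
  surj : ∀ y ∈ N, ∃ i < 10, f i = y

/-- The invariant of the search. -/
structure Inv (f : ℕ → W) (v nxt E F : ℕ) : Prop where
  lab : Lab N f
  v_le : v ≤ nxt
  nxt_le : nxt ≤ 10
  lower : ∀ i < 10, ∀ k < 10, E.testBit (10 * i + k) = true → i < nxt ∧ k < nxt ∧ H (f i) (f k)
  upper : ∀ i < 10, ∀ k < 10, i ≠ k → F.testBit (10 * i + k) = false →
    (i < nxt ∧ k < nxt ∧ ¬ H (f i) (f k)) ∨ (i < v ∧ nxt ≤ k) ∨ (k < v ∧ nxt ≤ i)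
  far : ∀ i < v, ∀ k < 10, nxt ≤ k → ¬ H (f i) (f k)

/-- The conclusion of the search. -/
def Goal : Prop :=
  HasPart (N : Set W) H ∨
    ∀ a ∈ N, ∀ b ∈ N, H a b →
      HasPart (N : Set W) fun c d => H c d ∧ ¬ (c = a ∧ d = b) ∧ ¬ (c = b ∧ d = a)

variable {N H}

theorem Inv.up (hH : Hyp N H) {f : ℕ → W} {v nxt E F : ℕ} (h : Inv N H f v nxt E F) :
    ∀ i < 10, ∀ k < 10, F.testBit (10 * i + k) = false → ¬ H (f i) (f k) := by
  intro i hi k hk hF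
  by_cases e : i = k
  · subst e; exact hH.irr _
  · rcases h.upper i hi k hk e hF with h1 | h1 | h1
    · exact h1.2.2
    · exact h.far i h1.1 k hk h1.2
    · exact fun h2 => h.far k h1.1 i hi h1.2 (hH.symm _ _ h2)

theorem Inv.not_deg4 (hH : Hyp N H) {f : ℕ → W} {v nxt E F : ℕ} (h : Inv N H f v nxt E F)
    {i : ℕ} (hi : i < 10) : deg4 E i = false := by
  classical
  rcases hd : deg4 E i with _ | _
  · rfl
  exfalso
  have h0 : drop1 (drop1 (drop1 (row E i))) ≠ 0 := by
    intro h0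
    simp [deg4, h0] at hd
  have h4 := pop4 _ (row_lt E i) h0
  set S := (Finset.range 10).filter fun k => (row E i).testBit k = true with hS
  have hS' : ∀ k ∈ S, k < 10 ∧ H (f i) (f k) := by
    intro k hk
    rw [hS, Finset.mem_filter, Finset.mem_range] at hk
    rw [testBit_row _ _ _ hk.1] at hk
    exact ⟨hk.1, (h.lower i hi k hk.1 hk.2).2.2⟩
  have := hH.deg_le (f i) (h.lab.mem i hi) (S.image f)
    (by
      intro y hy
      obtain ⟨k, hk, rfl⟩ := Finset.mem_image.1 hy
      exact h.lab.mem k (hS' k hk).1)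
    (by
      intro y hy
      obtain ⟨k, hk, rfl⟩ := Finset.mem_image.1 hy
      exact (hS' k hk).2)
  rw [Finset.card_image_of_injOn] at this
  · omega
  · intro a ha b hb e
    exact h.lab.inj a (hS' a ha).1 b (hS' b hb).1 e

theorem Inv.not_degLow (hH : Hyp N H) {f : ℕ → W} {v nxt E F : ℕ} (h : Inv N H f v nxt E F)
    {i : ℕ} (hi : i < 10) : degLow F i = false := by
  rcases hd : degLow F i with _ | _
  · rfl
  exfalso
  have h1 := pop1 _ (row_lt F i) (Nat.eq_of_beq_eq_true hd)
  obtain ⟨z, hz, hiz⟩ := hH.deg_ge (f i) (h.lab.mem i hi)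
  obtain ⟨c, hc, hcz, hic, -⟩ := hH.nbh (f i) (h.lab.mem i hi) z hz hiz
  obtain ⟨k, hk, rfl⟩ := h.lab.surj z hz
  obtain ⟨l, hl, rfl⟩ := h.lab.surj c hc
  have key : ∀ m < 10, H (f i) (f m) →
      m ∈ (Finset.range 10).filter fun k => (row F i).testBit k = true := by
    intro m hm him
    rw [Finset.mem_filter, Finset.mem_range, testBit_row _ _ _ hm]
    refine ⟨hm, ?_⟩
    by_contra hF
    exact h.up hH i hi m hm (by simpa using hF) him
  exact hcz (by rw [Finset.card_le_one.1 h1 k (key k hk hiz) l (key l hl hic)])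

theorem Inv.not_viol (hH : Hyp N H) {f : ℕ → W} {v nxt E F : ℕ} (h : Inv N H f v nxt E F)
    {a w : ℕ} (ha : a < 10) (hw : w < 10) : viol E F a w = false := by
  rcases hd : viol E F a w with _ | _
  · rfl
  exfalso
  have hd' : cond (Nat.testBit E (10 * a + w))
    (Nat.beq (row F a &&& (row E w ||| 1 <<< w)) (row F a)) false = true := hd
  rcases hE : Nat.testBit E (10 * a + w) with _ | _
  · rw [hE] at hd'; simp at hd'
  rw [hE] at hd'
  have heq : row F a &&& (row E w ||| 1 <<< w) = row F a := Nat.eq_of_beq_eq_true hd'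
  obtain ⟨c, hc, hcw, hac, hncw⟩ := hH.nbh (f a) (h.lab.mem a ha) (f w) (h.lab.mem w hw)
    (h.lower a ha w hw hE).2.2
  obtain ⟨k, hk, rfl⟩ := h.lab.surj c hc
  have hFk : (row F a).testBit k = true := by
    rw [testBit_row _ _ _ hk]
    by_contra hF
    exact h.up hH a ha k hk (by simpa using hF) hac
  rw [← heq, Nat.testBit_and, Nat.testBit_or, Nat.shiftLeft_eq, one_mul, Nat.testBit_two_pow,
    testBit_row _ _ _ hk, testBit_row _ _ _ hk] at hFk
  simp only [Bool.and_eq_true, Bool.or_eq_true, decide_eq_true_eq] at hFk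
  rcases hFk.2 with h1 | rfl
  · exact hncw (hH.symm _ _ (h.lower w hw k hk h1).2.2)
  · exact hcw rfl

theorem Inv.not_violAny (hH : Hyp N H) {f : ℕ → W} {v nxt E F : ℕ} (h : Inv N H f v nxt E F)
    {u : ℕ} (hu : u < 10) (n : ℕ) (hn : n ≤ 10) : violAny E F u n = false := by
  induction n with
  | zero => rfl
  | succ n ih =>
    change cond (viol E F u n) true (cond (viol E F n u) true (violAny E F u n)) = false
    rw [h.not_viol hH hu (by omega), h.not_viol hH (by omega) hu, ih (by omega)]
    rfl

theorem Inv.bump {f : ℕ → W} {v nxt E F : ℕ} (hH : Hyp N H) (h : Inv N H f v nxt E F)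
    (hn : nxt < 10) : Inv N H f v (nxt + 1) E F where
  lab := h.lab
  v_le := by have := h.v_le; omega
  nxt_le := hn
  lower i hi k hk hE := by
    obtain ⟨a, b, c⟩ := h.lower i hi k hk hE
    exact ⟨by omega, by omega, c⟩
  upper i hi k hk hne hF := by
    have hv := h.v_le
    have hH := h.up hH i hi k hk hF
    rcases h.upper i hi k hk hne hF with h1 | h1 | h1
    · exact Or.inl ⟨by omega, by omega, h1.2.2⟩
    · by_cases e : k = nxt
      · exact Or.inl ⟨by omega, by omega, hH⟩
      · exact Or.inr (Or.inl (by omega))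
    · by_cases e : i = nxt
      · exact Or.inl ⟨by omega, by omega, hH⟩
      · exact Or.inr (Or.inr (by omega))
  far i hi k hk hnk := h.far i hi k hk (by omega)

theorem Inv.addE {f : ℕ → W} {v nxt E F : ℕ} (hH : Hyp N H) (h : Inv N H f v nxt E F)
    {j : ℕ} (hv : v < nxt) (hj : j < nxt) (hvj : H (f v) (f j)) : Inv N H f v nxt (addE E v j) F where
  lab := h.lab
  v_le := h.v_le
  nxt_le := h.nxt_le
  lower i hi k hk hE := by
    have hn := h.nxt_le
    rcases (testBit_addE _ _ _ _ _ (by omega) (by omega) hk).1 hE with h1 | ⟨rfl, rfl⟩ | ⟨rfl, rfl⟩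
    · exact h.lower i hi k hk h1
    · exact ⟨by omega, by omega, hvj⟩
    · exact ⟨by omega, by omega, hH.symm _ _ hvj⟩
  upper := h.upper
  far := h.far

theorem Inv.delE {f : ℕ → W} {v nxt E F : ℕ} (hH : Hyp N H) (h : Inv N H f v nxt E F)
    {j : ℕ} (hv : v < nxt) (hj : j < nxt) (hvj : ¬ H (f v) (f j)) : Inv N H f v nxt E (delE F v j) where
  lab := h.lab
  v_le := h.v_le
  nxt_le := h.nxt_le
  lower := h.lower
  upper i hi k hk hne hF := by
    have hn := h.nxt_le
    rcases (testBit_delE _ _ _ _ _ (by omega) (by omega) hk).1 hF with h1 | ⟨rfl, rfl⟩ | ⟨rfl, rfl⟩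
    · exact h.upper i hi k hk hne h1
    · exact Or.inl ⟨by omega, by omega, hvj⟩
    · exact Or.inl ⟨by omega, by omega, fun h2 => hvj (hH.symm _ _ h2)⟩
  far := h.far

/-- The swapped labelling. -/
theorem Inv.swap {f : ℕ → W} {v nxt E F : ℕ} (h : Inv N H f v nxt E F) {k : ℕ}
    (hk : nxt ≤ k) (hk' : k < 10) : Inv N H (f ∘ Equiv.swap nxt k) v nxt E F := by
  have hlt : ∀ i < nxt, Equiv.swap nxt k i = i := fun i hi =>
    Equiv.swap_apply_of_ne_of_ne (by omega) (by omega)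
  have hge : ∀ i, nxt ≤ i → nxt ≤ Equiv.swap nxt k i := by
    intro i hi
    rw [Equiv.swap_apply_def]; split_ifs <;> omega
  have h10 : ∀ i < 10, Equiv.swap nxt k i < 10 := by
    intro i hi
    rw [Equiv.swap_apply_def]; split_ifs <;> omega
  refine ⟨⟨fun i hi => h.lab.mem _ (h10 i hi), ?_, ?_⟩, h.v_le, h.nxt_le, ?_, ?_, ?_⟩
  · intro i hi j hj e
    exact (Equiv.swap nxt k).injective (h.lab.inj _ (h10 i hi) _ (h10 j hj) e)
  · intro y hy
    obtain ⟨i, hi, rfl⟩ := h.lab.surj y hy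
    exact ⟨Equiv.swap nxt k i, h10 i hi, by simp⟩
  · intro i hi j hj hE
    obtain ⟨a, b, c⟩ := h.lower i hi j hj hE
    refine ⟨a, b, ?_⟩
    simpa [hlt i a, hlt j b] using c
  · intro i hi j hj hne hF
    rcases h.upper i hi j hj hne hF with ⟨a, b, c⟩ | h1 | h1
    · left
      refine ⟨a, b, ?_⟩
      simpa [hlt i a, hlt j b] using c
    · exact Or.inr (Or.inl h1)
    · exact Or.inr (Or.inr h1)
  · intro i hi j hj hnj
    have := h.v_le
    have h2 := h.far i hi _ (h10 j hj) (hge j hnj)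
    simpa [hlt i (by omega)] using h2

theorem Inv.clear {f : ℕ → W} {v nxt E F : ℕ} (h : Inv N H f v nxt E F)
    (hfar : ∀ k < 10, nxt ≤ k → ¬ H (f v) (f k)) (hv : v < nxt) :
    Inv N H f (v + 1) nxt E (clearFrom F v (10 - nxt)) where
  lab := h.lab
  v_le := hv
  nxt_le := h.nxt_le
  lower := h.lower
  upper i hi k hk hne hF := by
    have hn := h.nxt_le
    rcases (testBit_clearFrom _ _ _ _ _ (by omega) (by omega) hk).1 hF with h1 | ⟨rfl, h1⟩ | ⟨rfl, h1⟩
    · rcases h.upper i hi k hk hne h1 with h2 | h2 | h2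
      · exact Or.inl h2
      · exact Or.inr (Or.inl (by omega))
      · exact Or.inr (Or.inr (by omega))
    · exact Or.inr (Or.inl (by omega))
    · exact Or.inr (Or.inr (by omega))
  far i hi k hk hnk := by
    by_cases e : i = v
    · subst e; exact hfar k hk hnk
    · exact h.far i (by omega) k hk hnk

end Sound

section Sound2

variable {W : Type*} {N : Finset W} {H : W → W → Prop}

theorem condT {a b : Bool} (h : cond a true b = true) : a = true ∨ b = true := by
  cases a <;> simp_all

theorem condF {a b : Bool} (h : cond a b false = true) : a = true ∧ b = true := by
  cases a <;> simp_all

theorem done_sound (hH : Hyp N H) (rec : ℕ → ℕ → ℕ → ℕ → ℕ → Bool)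
    (hrec : ∀ f v j nxt E F, Inv N H f v nxt E F → v < nxt → rec v j nxt E F = true → Goal N H)
    {f : ℕ → W} {v nxt E F : ℕ} (hv : v < nxt) (h : Inv N H f (v + 1) nxt E F)
    (hd : done rec v nxt E F = true) : Goal N H := by
  have hn := h.nxt_le
  rw [done, h.not_degLow hH (by omega), h.not_violAny hH (by omega) _ (by omega)] at hd
  simp only [Bool.cond_false] at hd
  rcases condT hd with h1 | h1
  · obtain ⟨-, h2⟩ := condF h1
    exact Or.inl (hasPart_of_testL _ H f F h.lab.mem h.lab.inj (h.up hH) libA maskA maskA_eq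
      goodA h2)
  · clear hd
    rcases h9 : Nat.ble 9 v with _ | _
    · rw [h9] at h1
      have h9' : ¬ 9 ≤ v := fun h' => by
        rw [Nat.ble_eq_true_of_le h'] at h9; cases h9
      rcases hb : Nat.ble nxt (Nat.succ v) with _ | _
      · rw [hb] at h1
        have hb' : ¬ nxt ≤ v + 1 := fun h' => by
          rw [Nat.ble_eq_true_of_le h'] at hb; cases hb
        exact hrec f _ _ _ _ _ h (by omega) h1
      · rw [hb] at h1
        have hb' : nxt ≤ v + 1 := Nat.le_of_ble_eq_true hb
        have e : nxt = v + 1 := by omega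
        subst e
        exact hrec f _ _ _ _ _ (h.bump hH (by omega)) (by omega) h1
    · rw [h9] at h1
      right
      intro a ha b hb hab
      obtain ⟨i, hi, rfl⟩ := h.lab.surj a ha
      obtain ⟨k, hk, rfl⟩ := h.lab.surj b hb
      have h2 : petersenCheck F (List.range 10) (List.range 10)
        (fun F' => testL F' maskB) = true := h1
      simp only [petersenCheck, List.all_eq_true, List.mem_range, Bool.or_eq_true,
        Bool.not_eq_true'] at h2
      have h3 := (h2 i hi k hk).resolve_left (fun hF => h.up hH i hi k hk hF hab)
      refine hasPart_of_testL _ _ f (delE F i k) h.lab.mem h.lab.inj ?_ libB maskB maskB_eq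
        goodB h3
      intro p hp q hq hF hc
      rcases (testBit_delE _ _ _ _ _ hk hi hq).1 hF with h4 | ⟨rfl, rfl⟩ | ⟨rfl, rfl⟩
      · exact h.up hH p hp q hq h4 hc.1
      · exact hc.2.1 ⟨rfl, rfl⟩
      · exact hc.2.2 ⟨rfl, rfl⟩

theorem search_sound (hH : Hyp N H) (fuel : ℕ) :
    ∀ f v j nxt E F, Inv N H f v nxt E F → v < nxt →
      search fuel v j nxt E F = true → Goal N H := by
  induction fuel with
  | zero => intro f v j nxt E F _ _ h; exact absurd h (by simp [search])
  | succ n ih =>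
    intro f v j nxt E F h hv hs
    have hn := h.nxt_le
    have hs' : cond (Nat.ble nxt j)
        (cond (force (clearFrom F v (10 - nxt)) (fun F' => done (search n) v nxt E F'))
          (cond (Nat.ble 10 nxt) true
            (force (addE E v nxt) fun E' =>
              cond (deg4 E' v) true (search n v (nxt + 1) (nxt + 1) E' F))) false)
        (cond (force (delE F v j) fun F' => search n v (j + 1) nxt E F')
          (force (addE E v j) fun E' =>
            cond (deg4 E' v) true (cond (deg4 E' j) true (search n v (j + 1) nxt E' F))) false)
          = true := hs
    simp only [force_eq] at hs'
    clear hs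
    rcases hb : Nat.ble nxt j with _ | _
    · rw [hb] at hs'
      have hj : j < nxt := by
        by_contra h'
        rw [Nat.ble_eq_true_of_le (by omega)] at hb; cases hb
      obtain ⟨h1, h2⟩ := condF hs'
      by_cases hvj : H (f v) (f j)
      · have h3 := h.addE hH hv hj hvj
        rw [h3.not_deg4 hH (by omega), h3.not_deg4 hH (by omega)] at h2
        exact ih f _ _ _ _ _ h3 hv h2
      · exact ih f _ _ _ _ _ (h.delE hH hv hj hvj) hv h1
    · rw [hb] at hs'
      obtain ⟨h1, h2⟩ := condF hs'
      by_cases hfar : ∀ k < 10, nxt ≤ k → ¬ H (f v) (f k)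
      · exact done_sound hH (search n) ih hv (h.clear hfar hv) h1
      · push Not at hfar
        obtain ⟨k, hk, hnk, hvk⟩ := hfar
        have h10 : Nat.ble 10 nxt = false := by
          rcases h' : Nat.ble 10 nxt with _ | _
          · rfl
          · have := Nat.le_of_ble_eq_true h'; omega
        rw [h10] at h2
        have h3 := (h.swap hnk hk).bump hH (by omega)
        have h4 := h3.addE hH (j := nxt) (by omega) (by omega) (by
          simpa [Equiv.swap_apply_of_ne_of_ne (show v ≠ nxt by omega) (show v ≠ k by omega)]
            using hvk)
        have h2' : cond (deg4 (addE E v nxt) v) true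
          (search n v (nxt + 1) (nxt + 1) (addE E v nxt) F) = true := h2
        rw [h4.not_deg4 hH (by omega)] at h2'
        exact ih _ _ _ _ _ _ h4 (by omega) h2'

theorem F0_spec : ∀ i < 10, ∀ k < 10, i ≠ k → F0.testBit (10 * i + k) = true := by
  decide +kernel

theorem combinatorial (hH : Hyp N H) (hN : N.card = 10) : Goal N H := by
  have e : Fin 10 ≃ N := (Finset.equivFinOfCardEq hN).symm
  let f : ℕ → W := fun i => if h : i < 10 then (e ⟨i, h⟩ : W) else (e 0 : W)
  have hf : ∀ i (h : i < 10), f i = (e ⟨i, h⟩ : W) := fun i h => by simp [f, h]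
  refine search_sound hH 100 f 0 1 1 0 F0 ⟨⟨?_, ?_, ?_⟩, ?_, ?_, ?_, ?_, ?_⟩ (by omega) search_true
  · intro i hi; rw [hf i hi]; exact (e _).2
  · intro i hi k hk h
    rw [hf i hi, hf k hk] at h
    simpa using e.injective (Subtype.ext h)
  · intro y hy
    refine ⟨e.symm ⟨y, hy⟩, Fin.is_lt _, ?_⟩
    rw [hf _ (Fin.is_lt _)]; simp
  · omega
  · omega
  · intro i _ k _ h; simp at h
  · intro i hi k hk hne h
    rw [F0_spec i hi k hk hne] at h; cases h
  · intro i hi; omega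

end Sound2

section Graph

open SimpleGraph

variable {V : Type*} {G : SimpleGraph V}

theorem conn_single (G : SimpleGraph V) (v : V) : (G.induce ({v} : Set V)).Connected := by
  haveI : Nonempty ({v} : Set V) := ⟨⟨v, rfl⟩⟩
  refine ⟨fun a b => ?_⟩
  rw [Subsingleton.elim a b]

theorem conn_union {s t : Set V} (hs : (G.induce s).Connected) (ht : (G.induce t).Connected)
    {u v : V} (hu : u ∈ s) (hv : v ∈ t) (huv : G.Adj u v) : (G.induce (s ∪ t)).Connected :=
  connected_induce_union hs.preconnected ht.preconnected hu hv huv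

theorem no7 (hG : G.DoubleCritical 8) (c : V → Fin 7) (hc : ∀ a b, G.Adj a b → c a ≠ c b) :
    False := by
  have h7 : G.Colorable 7 := ⟨Coloring.mk c fun {a b} h => hc a b h⟩
  have h := h7.chromaticNumber_le
  rw [hG.2.1] at h
  have : (8 : ℕ) ≤ 7 := by exact_mod_cast h
  omega

theorem col6 (hG : G.DoubleCritical 8) {u v : V} (huv : G.Adj u v) :
    ∃ c : V → Fin 6, ∀ a b, a ≠ u → a ≠ v → b ≠ u → b ≠ v → G.Adj a b → c a ≠ c b := by
  classical
  have h := hG.2.2 u v huv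
  rw [chromaticNumber_le_iff_colorable] at h
  obtain ⟨C⟩ := h
  refine ⟨fun a => if h : a ∈ ({u, v}ᶜ : Set V) then C ⟨a, h⟩ else 0, ?_⟩
  intro a b h1 h2 h3 h4 hab
  have ha : a ∈ ({u, v}ᶜ : Set V) := by simp [h1, h2]
  have hb : b ∈ ({u, v}ᶜ : Set V) := by simp [h3, h4]
  simp only [ha, hb, dite_true]
  exact C.valid (v := ⟨a, ha⟩) (w := ⟨b, hb⟩) hab

theorem col7 (hG : G.DoubleCritical 8) {u v : V} (huv : G.Adj u v) :
    ∃ c : V → Fin 7, ∀ a b, a ≠ u → b ≠ u → G.Adj a b → c a ≠ c b := by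
  classical
  obtain ⟨c, hc⟩ := col6 hG huv
  refine ⟨fun a => if a = v then Fin.last 6 else (c a).castSucc, ?_⟩
  intro a b ha hb hab
  by_cases h1 : a = v <;> by_cases h2 : b = v
  · subst h1; subst h2; exact absurd hab (G.irrefl)
  · simpa [h1, h2] using (Fin.castSucc_lt_last (c b)).ne'
  · simpa [h1, h2] using (Fin.castSucc_lt_last (c a)).ne
  · simpa [h1, h2] using hc a b ha h1 hb h2 hab

theorem common (hG : G.DoubleCritical 8) {u v : V} (huv : G.Adj u v) (c : V → Fin 6)
    (hc : ∀ a b, a ≠ u → a ≠ v → b ≠ u → b ≠ v → G.Adj a b → c a ≠ c b) (i : Fin 6) :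
    ∃ w, w ≠ u ∧ w ≠ v ∧ c w = i ∧ G.Adj u w ∧ G.Adj v w := by
  classical
  by_contra hno
  push Not at hno
  have hl : ∀ k : Fin 6, k.castSucc ≠ Fin.last 6 := fun k => (Fin.castSucc_lt_last k).ne
  let d : V → Fin 7 := fun w => if w = u then i.castSucc else if w = v then Fin.last 6 else
    if c w = i ∧ G.Adj u w then Fin.last 6 else (c w).castSucc
  have du : d u = i.castSucc := by simp [d]
  have dv : d v = Fin.last 6 := by simp [d, huv.ne']
  have dw : ∀ w, w ≠ u → w ≠ v → d w =
    if c w = i ∧ G.Adj u w then Fin.last 6 else (c w).castSucc := by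
    intro w h1 h2; simp [d, h1, h2]
  have key1 : ∀ w, w ≠ u → w ≠ v → G.Adj u w → d u ≠ d w := by
    intro w h1 h2 h3
    rw [du, dw w h1 h2]
    by_cases e : c w = i
    · simp only [e, h3, and_self, if_true]; exact hl i
    · simp only [e, false_and, if_false]
      intro h; exact e (Fin.castSucc_injective _ h).symm
  have key2 : ∀ w, w ≠ u → w ≠ v → G.Adj v w → d v ≠ d w := by
    intro w h1 h2 h3
    rw [dv, dw w h1 h2, if_neg]
    · exact (hl _).symm
    · rintro ⟨e, h4⟩
      exact hno w h1 h2 e h4 h3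
  refine no7 hG d ?_
  intro a b hab
  by_cases a1 : a = u
  · subst a1
    by_cases b1 : b = v
    · subst b1; rw [du, dv]; exact hl i
    · exact key1 b hab.ne' b1 hab
  by_cases b1 : b = u
  · subst b1
    by_cases a2 : a = v
    · subst a2; rw [du, dv]; exact (hl i).symm
    · exact (key1 a a1 a2 hab.symm).symm
  by_cases a2 : a = v
  · subst a2; exact key2 b b1 hab.ne' hab
  by_cases b2 : b = v
  · subst b2; exact (key2 a a1 a2 hab.symm).symm
  rw [dw a a1 a2, dw b b1 b2]
  have hne := hc a b a1 a2 b1 b2 hab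
  split_ifs with h1 h2 h2
  · exact absurd (h1.1.trans h2.1.symm) hne
  · exact (hl _).symm
  · exact hl _
  · intro h; exact hne (Fin.castSucc_injective _ h)

/-- Nonadjacency of distinct vertices. -/
def NA (G : SimpleGraph V) (a b : V) : Prop := a ≠ b ∧ ¬ G.Adj a b

theorem nbh_cond (hG : G.DoubleCritical 8) {x y z : V} (hy : G.Adj x y) (hz : G.Adj x z)
    (hyz : NA G y z) : ∃ w, G.Adj x w ∧ w ≠ z ∧ NA G y w ∧ ¬ NA G w z := by
  obtain ⟨c, hc⟩ := col6 hG hz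
  obtain ⟨w, h1, h2, h3, h4, h5⟩ := common hG hz c hc (c y)
  have hwy : w ≠ y := by rintro rfl; exact hyz.2 h5.symm
  refine ⟨w, h4, h2, ⟨hwy.symm, fun h => ?_⟩, fun h => h.2 h5.symm⟩
  exact hc y w hy.ne' hyz.1 h1 h2 h h3.symm

theorem deg_cond [Fintype V] [DecidableEq V] [DecidableRel G.Adj]
    (hG : G.DoubleCritical 8) {x y : V} (hx : G.degree x = 10) (hy : G.Adj x y)
    (S : Finset V) (hS : S ⊆ G.neighborFinset x) (hS' : ∀ z ∈ S, NA G y z) : S.card ≤ 3 := by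
  obtain ⟨c, hc⟩ := col6 hG hy
  choose w h1 h2 h3 h4 h5 using fun i => common hG hy c hc i
  have hinj : Function.Injective w := fun i j h => by rw [← h3 i, ← h3 j, h]
  have hcard : (Finset.univ.image w).card = 6 := by
    rw [Finset.card_image_of_injective _ hinj]; simp
  have hd : Disjoint S (Finset.univ.image w) := by
    rw [Finset.disjoint_left]
    intro z hz hz'
    obtain ⟨i, -, rfl⟩ := Finset.mem_image.1 hz'
    exact (hS' _ hz).2 (h5 i)
  have hy' : y ∉ S ∪ Finset.univ.image w := by
    rw [Finset.mem_union, Finset.mem_image]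
    rintro (h | ⟨i, -, h⟩)
    · exact (hS' y h).1 rfl
    · exact h2 i h
  have hsub : insert y (S ∪ Finset.univ.image w) ⊆ G.neighborFinset x := by
    intro z hz
    rw [Finset.mem_insert, Finset.mem_union, Finset.mem_image] at hz
    rcases hz with rfl | hz | ⟨i, -, rfl⟩
    · simpa using hy
    · exact hS hz
    · simpa using h4 i
  have := Finset.card_le_card hsub
  rw [Finset.card_insert_of_notMem hy', Finset.card_union_of_disjoint hd, hcard,
    card_neighborFinset_eq_degree, hx] at this
  omega

theorem exists_NA [Fintype V] [DecidableEq V] [DecidableRel G.Adj] {x y : V}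
    (hx : G.degree x = 10) (hy : G.Adj x y)
    (hv : ∀ v : G.neighborSet x, (G.induce (G.neighborSet x)).degree v ≠ 9) :
    ∃ z, G.Adj x z ∧ NA G y z := by
  by_contra hno
  push Not at hno
  refine hv ⟨y, hy⟩ ?_
  have : (G.induce (G.neighborSet x)).neighborFinset ⟨y, hy⟩ = Finset.univ.erase ⟨y, hy⟩ := by
    ext ⟨z, hz⟩
    simp only [mem_neighborFinset, comap_adj, Function.Embedding.subtype_apply,
      Finset.mem_erase, ne_eq, Finset.mem_univ, and_true]
    constructor
    · intro h e; exact h.ne' (congrArg Subtype.val e)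
    · intro h
      by_contra h'
      exact hno z hz ⟨fun e => h (Subtype.ext e.symm), h'⟩
  rw [← card_neighborFinset_eq_degree, this, Finset.card_erase_of_mem (Finset.mem_univ _),
    Finset.card_univ, card_neighborSet_eq_degree, hx]

/-- A connected set outside the closed neighbourhood of `x` attached to two nonadjacent
neighbours of `x`. -/
theorem exists_attach [Fintype V] [DecidableEq V] [DecidableRel G.Adj]
    (hG : G.DoubleCritical 8) (hδ : G.minDegree = 10) {x y : V}
    (hx : G.degree x = 10) (hy : G.Adj x y) (hyz : ∃ z, G.Adj x z ∧ NA G y z) :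
    ∃ C : Set V, (G.induce C).Connected ∧ (∀ u ∈ C, u ≠ x ∧ ¬ G.Adj x u) ∧
      ∃ a b, G.Adj x a ∧ G.Adj x b ∧ NA G a b ∧ (∃ u ∈ C, G.Adj u a) ∧ ∃ u ∈ C, G.Adj u b := by
  obtain ⟨z, hz, hyz⟩ := hyz
  obtain ⟨w, hyw, hwx, hxw⟩ : ∃ w, G.Adj y w ∧ w ≠ x ∧ ¬ G.Adj x w := by
    by_contra hno
    push Not at hno
    have hsub : G.neighborFinset y ⊆ insert x (((G.neighborFinset x).erase y).erase z) := by
      intro w hw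
      rw [mem_neighborFinset] at hw
      by_cases h : w = x
      · simp [h]
      · refine Finset.mem_insert_of_mem (Finset.mem_erase.2 ⟨?_, Finset.mem_erase.2
          ⟨hw.ne', ?_⟩⟩)
        · rintro rfl; exact hyz.2 hw
        · simpa using hno w hw h
    have h1 := Finset.card_le_card hsub
    have h2 := Finset.card_insert_le x (((G.neighborFinset x).erase y).erase z)
    rw [Finset.card_erase_of_mem, Finset.card_erase_of_mem, card_neighborFinset_eq_degree,
      hx] at h2
    · rw [card_neighborFinset_eq_degree] at h1
      have := G.minDegree_le_degree y
      omega
    · simpa using hy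
    · simpa [hyz.1.symm] using hz
  let P : Set (Set V) := {C | (G.induce C).Connected ∧ ∀ u ∈ C, u ≠ x ∧ ¬ G.Adj x u}
  have hP : ({w} : Set V) ∈ P := by
    refine ⟨?_, ?_⟩
    · exact conn_single G w
    · rintro u rfl; exact ⟨hwx, hxw⟩
  obtain ⟨C, hwC, hmax⟩ := (Set.toFinite P).exists_le_maximal hP
  have hwC : w ∈ C := hwC rfl
  obtain ⟨hCc, hCx⟩ := hmax.prop
  have hclosed : ∀ u ∈ C, ∀ v, G.Adj u v → v ∉ C → G.Adj x v := by
    intro u hu v huv hv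
    by_contra hxv
    have hvx : v ≠ x := by rintro rfl; exact (hCx u hu).2 huv.symm
    have hin : C ∪ {v} ∈ P := by
      refine ⟨conn_union hCc (conn_single G v) hu rfl huv, ?_⟩
      rintro t (ht | rfl)
      · exact hCx t ht
      · exact ⟨hvx, hxv⟩
    exact hv (hmax.le_of_ge hin Set.subset_union_left (Or.inr rfl))
  refine ⟨C, hCc, hCx, ?_⟩
  by_contra hno
  push Not at hno
  let K : Set V := {a | G.Adj x a ∧ ∃ u ∈ C, G.Adj u a}
  have hK : ∀ a ∈ K, ∀ b ∈ K, a ≠ b → G.Adj a b := by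
    rintro a ⟨ha, u, hu, hua⟩ b ⟨hb, t, ht, htb⟩ hab
    by_contra h
    exact hno a b ha hb ⟨hab, h⟩ ⟨u, hu, hua⟩ t ht htb
  obtain ⟨f, hf⟩ := col7 hG hyw.symm
  obtain ⟨g, hg⟩ := col7 hG hy
  have hKw : ∀ a ∈ K, a ≠ w := by rintro a ⟨ha, -⟩ rfl; exact hxw ha
  have hKx : ∀ a ∈ K, a ≠ x := by rintro a ⟨ha, -⟩; exact ha.ne'
  have finj : Set.InjOn f K := by
    intro a ha b hb h
    by_contra hab
    exact hf a b (hKw a ha) (hKw b hb) (hK a ha b hb hab) h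
  have ginj : Set.InjOn g K := by
    intro a ha b hb h
    by_contra hab
    exact hg a b (hKx a ha) (hKx b hb) (hK a ha b hb hab) h
  obtain ⟨σ, hσ⟩ : ∃ σ : Equiv.Perm (Fin 7), ∀ a ∈ K, σ (g a) = f a := by
    classical
    let e : {c // c ∈ g '' K} ≃ {c // c ∈ f '' K} :=
      (Equiv.Set.imageOfInjOn g K ginj).symm.trans (Equiv.Set.imageOfInjOn f K finj)
    refine ⟨e.extendSubtype, fun a ha => ?_⟩
    rw [Equiv.extendSubtype_apply_of_mem e (g a) ⟨a, ha, rfl⟩]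
    have : (Equiv.Set.imageOfInjOn g K ginj).symm ⟨g a, a, ha, rfl⟩ = ⟨a, ha⟩ := by
      rw [Equiv.symm_apply_eq]; rfl
    simp only [e, Equiv.trans_apply, this]
    rfl
  classical
  have cross : ∀ a b, G.Adj a b → a ∈ C → b ∉ C → σ (g a) ≠ f b := by
    intro a b hab ha hb
    have hxb := hclosed a ha b hab hb
    rw [← hσ b ⟨hxb, a, ha, hab⟩]
    intro h
    exact hg a b (hCx a ha).1 hxb.ne' hab (σ.injective h)
  refine no7 hG (fun v => if v ∈ C then σ (g v) else f v) ?_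
  intro a b hab
  by_cases ha : a ∈ C <;> by_cases hb : b ∈ C
  · simp only [ha, hb, if_true]
    intro h
    exact hg a b (hCx a ha).1 (hCx b hb).1 hab (σ.injective h)
  · simpa only [ha, hb, if_true, if_false] using cross a b hab ha hb
  · simpa only [ha, hb, if_true, if_false] using (cross b a hab.symm hb ha).symm
  · simp only [ha, hb, if_false]
    exact hf a b (by rintro rfl; exact ha hwC) (by rintro rfl; exact hb hwC) hab

theorem exists_perm (q : ℕ × ℕ) : ∃ σ : Equiv.Perm (Fin 8), ∀ a b : Fin 8, K8minus.Adj a b →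
    ((σ a : ℕ), (σ b : ℕ)) ≠ q := by
  by_cases hq : q.1 < 8 ∧ q.2 < 8 ∧ q.1 ≠ q.2
  · obtain ⟨h1, h2, h3⟩ := hq
    let i : Fin 8 := ⟨q.1, h1⟩
    let j : Fin 8 := ⟨q.2, h2⟩
    have hij : i ≠ j := fun h => h3 (by simpa [i, j] using h)
    let τ : Equiv.Perm (Fin 8) := Equiv.swap 0 i
    let m := τ.symm j
    have hm : m ≠ 0 := by
      intro h
      have : j = τ 0 := by rw [← h]; simp [m]
      simp only [τ, Equiv.swap_apply_left] at this
      exact hij this.symm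
    let σ : Equiv.Perm (Fin 8) := (Equiv.swap 1 m).trans τ
    have h0 : σ 0 = i := by
      simp [σ, τ, Equiv.swap_apply_of_ne_of_ne (show (0 : Fin 8) ≠ 1 by decide) hm.symm]
    have h1' : σ 1 = j := by simp [σ, m]
    refine ⟨σ, fun a b hab h => ?_⟩
    have ha : σ a = σ 0 := by rw [h0]; ext; simp [i, ← h]
    have hb : σ b = σ 1 := by rw [h1']; ext; simp [j, ← h]
    rw [σ.injective ha, σ.injective hb] at hab
    simp [K8minus] at hab
  · refine ⟨1, fun a b hab h => hq ?_⟩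
    rw [← h]
    refine ⟨a.2, b.2, ?_⟩
    simpa [Fin.val_inj] using hab.ne

theorem minor_of_part {x : V} {N : Set V} (hN : ∀ a, a ∈ N → G.Adj x a) (H : V → V → Prop)
    (φ : V → Set V) (hc : ∀ a ∈ N, (G.induce (φ a)).Connected) (hm : ∀ a ∈ N, a ∈ φ a)
    (hx : ∀ a ∈ N, x ∉ φ a)
    (hd : ∀ a ∈ N, ∀ b ∈ N, a ≠ b → Disjoint (φ a) (φ b))
    (hadj : ∀ a ∈ N, ∀ b ∈ N, a ≠ b → ¬ H a b → ∃ u ∈ φ a, ∃ v ∈ φ b, G.Adj u v)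
    (h : HasPart N H) : G.HasMinor K8minus := by
  obtain ⟨p, q, h1, h2, h3⟩ := h
  obtain ⟨σ, hσ⟩ := exists_perm q
  let B : Fin 8 → Set V := fun i =>
    if (i : ℕ) < 7 then φ (p i).1 ∪ φ (p i).2 else {x}
  have B1 : ∀ i : Fin 8, (i : ℕ) < 7 → B i = φ (p i).1 ∪ φ (p i).2 := fun i hi => by simp [B, hi]
  have B2 : ∀ i : Fin 8, ¬ (i : ℕ) < 7 → B i = {x} := fun i hi => by simp [B, hi]
  have hBc : ∀ i, (G.induce (B i)).Connected := by
    intro i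
    by_cases hi : (i : ℕ) < 7
    · rw [B1 i hi]
      obtain ⟨m1, m2, m3⟩ := h1 i hi
      by_cases e : (p i).1 = (p i).2
      · rw [e, Set.union_self]; exact hc _ m2
      · obtain ⟨u, hu, v, hv, huv⟩ := hadj _ m1 _ m2 e (m3 e)
        exact conn_union (hc _ m1) (hc _ m2) hu hv huv
    · rw [B2 i hi]; exact conn_single G x
  have hBd : ∀ i j, i ≠ j → Disjoint (B i) (B j) := by
    have hxd : ∀ i : Fin 8, (i : ℕ) < 7 → x ∉ B i := by
      intro i hi
      rw [B1 i hi]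
      rintro (h | h)
      · exact hx _ (h1 i hi).1 h
      · exact hx _ (h1 i hi).2.1 h
    intro i j hij
    have hij' : (i : ℕ) ≠ j := fun h => hij (Fin.ext h)
    by_cases hi : (i : ℕ) < 7 <;> by_cases hj : (j : ℕ) < 7
    · rw [B1 i hi, B1 j hj]
      obtain ⟨n1, n2, n3, n4⟩ := h2 i hi j hj hij'
      obtain ⟨i1, i2, -⟩ := h1 i hi
      obtain ⟨j1, j2, -⟩ := h1 j hj
      rw [Set.disjoint_union_left, Set.disjoint_union_right, Set.disjoint_union_right]
      exact ⟨⟨hd _ i1 _ j1 n1, hd _ i1 _ j2 n2⟩, ⟨hd _ i2 _ j1 n3, hd _ i2 _ j2 n4⟩⟩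
    · rw [B2 j hj, Set.disjoint_singleton_right]; exact hxd i hi
    · rw [B2 i hi, Set.disjoint_singleton_left]; exact hxd j hj
    · omega
  have hBa : ∀ i j : Fin 8, i < j → ((i : ℕ), (j : ℕ)) ≠ q →
      ∃ u ∈ B i, ∃ v ∈ B j, G.Adj u v := by
    intro i j hij hq
    have hij' : (i : ℕ) < j := hij
    have hi : (i : ℕ) < 7 := by omega
    by_cases hj : (j : ℕ) < 7
    · rw [B1 i hi, B1 j hj]
      obtain ⟨n1, n2, n3, n4⟩ := h2 i hi j hj (by omega)
      obtain ⟨i1, i2, -⟩ := h1 i hi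
      obtain ⟨j1, j2, -⟩ := h1 j hj
      rcases h3 i j hij' hj hq with h | h | h | h
      · obtain ⟨u, hu, v, hv, huv⟩ := hadj _ i1 _ j1 n1 h
        exact ⟨u, Or.inl hu, v, Or.inl hv, huv⟩
      · obtain ⟨u, hu, v, hv, huv⟩ := hadj _ i1 _ j2 n2 h
        exact ⟨u, Or.inl hu, v, Or.inr hv, huv⟩
      · obtain ⟨u, hu, v, hv, huv⟩ := hadj _ i2 _ j1 n3 h
        exact ⟨u, Or.inr hu, v, Or.inl hv, huv⟩
      · obtain ⟨u, hu, v, hv, huv⟩ := hadj _ i2 _ j2 n4 h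
        exact ⟨u, Or.inr hu, v, Or.inr hv, huv⟩
    · rw [B1 i hi, B2 j hj]
      have hi1 := (h1 i hi).1
      exact ⟨_, Or.inl (hm _ hi1), x, rfl, (hN _ hi1).symm⟩
  refine ⟨fun i => B (σ i), fun i => ?_, ?_, fun i => hBc _, ?_⟩
  · exact Set.nonempty_coe_sort.1 (hBc (σ i)).nonempty
  · intro i j hij
    exact hBd _ _ fun h => hij (σ.injective h)
  · intro i j hij
    have hne : σ i ≠ σ j := fun h => hij.ne (σ.injective h)
    rcases lt_or_gt_of_ne hne with h | h
    · exact hBa _ _ h (hσ i j hij)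
    · obtain ⟨u, hu, v, hv, huv⟩ := hBa _ _ h (hσ j i hij.symm)
      exact ⟨v, hv, u, hu, huv.symm⟩

theorem main [Fintype V] [DecidableEq V] [DecidableRel G.Adj]
    (hG : G.DoubleCritical 8) (hδ : G.minDegree = 10)
    (x : V) (hx : G.degree x = 10)
    (hv : ∀ v : G.neighborSet x, (G.induce (G.neighborSet x)).degree v ≠ 9) :
    G.HasMinor K8minus := by
  have hmem : ∀ a, a ∈ G.neighborFinset x ↔ G.Adj x a := fun a => by simp
  have hH : Hyp (G.neighborFinset x) (NA G) := by
    refine ⟨fun a b h => ⟨h.1.symm, fun h' => h.2 h'.symm⟩, fun a h => h.1 rfl, ?_, ?_, ?_⟩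
    · intro y hy S hS hS'
      exact deg_cond hG hx ((hmem y).1 hy) S hS hS'
    · intro y hy
      obtain ⟨z, hz, h⟩ := exists_NA hx ((hmem y).1 hy) hv
      exact ⟨z, (hmem z).2 hz, h⟩
    · intro a ha w hw haw
      obtain ⟨c, hc, h⟩ := nbh_cond hG ((hmem a).1 ha) ((hmem w).1 hw) haw
      exact ⟨c, (hmem c).2 hc, h⟩
  have hN : ∀ a, a ∈ ((G.neighborFinset x : Finset V) : Set V) → G.Adj x a := fun a ha =>
    (hmem a).1 ha
  rcases combinatorial hH (by rw [card_neighborFinset_eq_degree, hx]) with h | h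
  · refine minor_of_part hN (NA G) (fun a => {a}) ?_ ?_ ?_ ?_ ?_ h
    · intro a _; exact conn_single G a
    · intro a _; rfl
    · intro a ha h'; exact (hN a ha).ne h'
    · intro a _ b _ hab; simpa using hab
    · intro a _ b _ hab hn
      refine ⟨a, rfl, b, rfl, ?_⟩
      by_contra h'
      exact hn ⟨hab, h'⟩
  · obtain ⟨y, hy⟩ : ∃ y, G.Adj x y := by
      have : 0 < (G.neighborFinset x).card := by rw [card_neighborFinset_eq_degree, hx]; omega
      obtain ⟨y, hy⟩ := Finset.card_pos.1 this
      exact ⟨y, (hmem y).1 hy⟩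
    obtain ⟨C, hC, hCx, a, b, ha, hb, hab, ⟨s, hs, hsa⟩, ⟨t, ht, htb⟩⟩ :=
      exists_attach hG hδ hx hy (exists_NA hx hy hv)
    have hp := h a ((hmem a).2 ha) b ((hmem b).2 hb) hab
    let φ : V → Set V := fun v => if v = a then C ∪ {a} else {v}
    have φa : φ a = C ∪ {a} := by simp [φ]
    have φn : ∀ v, v ≠ a → φ v = {v} := fun v hv => by simp [φ, hv]
    have hφm : ∀ v, v ∈ φ v := by
      intro v
      by_cases e : v = a
      · subst e; rw [φa]; exact Or.inr rfl
      · rw [φn v e]; rfl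
    have hout : ∀ v, G.Adj x v → v ≠ a → v ∉ φ a := by
      intro v hv hne
      rw [φa]
      rintro (h' | h')
      · exact (hCx v h').2 hv
      · exact hne h'
    refine minor_of_part hN _ φ ?_ (fun v _ => hφm v) ?_ ?_ ?_ hp
    · intro v _
      by_cases e : v = a
      · subst e; rw [φa]
        exact conn_union hC (conn_single G v) hs rfl hsa
      · rw [φn v e]; exact conn_single G v
    · intro v hv h'
      by_cases e : v = a
      · subst e; rw [φa] at h'
        rcases h' with h' | h'
        · exact (hCx x h').1 rfl
        · exact ha.ne h'
      · rw [φn v e] at h'; exact (hN v hv).ne h'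
    · intro c hc d hd hcd
      by_cases e : c = a
      · subst e
        rw [φn d hcd.symm, Set.disjoint_singleton_right]
        exact hout d (hN d hd) hcd.symm
      · rw [φn c e, Set.disjoint_singleton_left]
        by_cases e' : d = a
        · subst e'; exact hout c (hN c hc) hcd
        · rw [φn d e']; exact hcd
    · intro c hc d hd hcd hn
      by_cases hadj : G.Adj c d
      · exact ⟨c, hφm c, d, hφm d, hadj⟩
      · have hn' : (c = a ∧ d = b) ∨ (c = b ∧ d = a) := by
          by_contra h'
          push Not at h'
          exact hn ⟨⟨hcd, hadj⟩, fun h1 => h'.1 h1.1 h1.2, fun h1 => h'.2 h1.1 h1.2⟩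
        rcases hn' with ⟨rfl, rfl⟩ | ⟨rfl, rfl⟩
        · exact ⟨t, by rw [φa]; exact Or.inl ht, d, hφm d, htb⟩
        · exact ⟨c, hφm c, t, by rw [φa]; exact Or.inl ht, htb.symm⟩

end Graph

end DC

/-- If `G` is a double-critical 8-chromatic graph with minimum degree 10 containing a
vertex `x` of degree 10 such that no vertex of the neighbourhood graph `G_x` has
degree 9 in `G_x`, then `G` has a `K₈⁻` minor. -/
theorem double_critical_eight_chromatic_neighborhood_no_degree_nine_hasMinor_K8minus
    {V : Type*} [Fintype V] [DecidableEq V] (G : SimpleGraph V) [DecidableRel G.Adj]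
    (hG : G.DoubleCritical 8) (hδ : G.minDegree = 10)
    (x : V) (hx : G.degree x = 10)
    (hv : ∀ v : G.neighborSet x, (G.induce (G.neighborSet x)).degree v ≠ 9) :
    G.HasMinor K8minus := by
  exact DC.main hG hδ x hx hv
end
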